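/- Suppose Conditions D, M_r with r = 7 + 2a₀, and S hold (a₀ as in Condition D), and that ℓ₂ n^{-1/3} → 0 as n → ∞. Then for each k ∈ {ℓ₂, 2ℓ₂}, the MBB variance estimator satisfies E[σ̂_n²(k)] = k·E[Ȳ_k²] + O(n^{-1}k) and Var(σ̂_n²(k)) = O(n^{-1}k), where Ȳ_k = k^{-1}Σ_{i=1}^k Y_i with the centered linearization Y_i = ∇′(X_i − μ). -/

import Mathlib

open MeasureTheory ProbabilityTheory Filter
open scoped Classical

noncomputable section

namespace BlockLength

variable {Ω : Type*} [MeasurableSpace Ω] {d : ℕ}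

/-- σ-algebra generated by the coordinates `X i`, `i ∈ S`. -/
def sigmaOf (X : ℤ → Ω → Fin d → ℝ) (S : Set ℤ) : MeasurableSpace Ω :=
  ⨆ i ∈ S, MeasurableSpace.comap (X i) inferInstance

/-- Strong mixing (α-mixing) coefficient of the process `X`. -/
def alphaMix (μ : Measure Ω) (X : ℤ → Ω → Fin d → ℝ) (k : ℕ) : ℝ :=
  sSup { x | ∃ A B : Set Ω,
    MeasurableSet[sigmaOf X {i | i ≤ 0}] A ∧
    MeasurableSet[sigmaOf X {i | (k : ℤ) ≤ i}] B ∧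
    x = |(μ (A ∩ B)).toReal - (μ A).toReal * (μ B).toReal| }

/-- Strict stationarity of the process `X`. -/
def IsStationary (μ : Measure Ω) (X : ℤ → Ω → Fin d → ℝ) : Prop :=
  ∀ k : ℤ, Measure.map (fun ω => fun i : ℤ => X (i + k) ω) μ =
    Measure.map (fun ω => fun i : ℤ => X i ω) μ

/-- Condition (D): `H` is three times continuously differentiable with
third derivatives of polynomial growth of order `a₀`. -/
def CondD (H : (Fin d → ℝ) → ℝ) (a₀ : ℕ) : Prop :=
  ContDiff ℝ 3 H ∧ ∃ C : ℝ, 0 < C ∧ ∀ x : Fin d → ℝ,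
    ‖iteratedFDeriv ℝ 3 H x‖ ≤ C * (1 + ‖x‖ ^ a₀)

/-- Condition (M_r): moment and strong-mixing conditions. -/
def CondM (μ : Measure Ω) (X : ℤ → Ω → Fin d → ℝ) (r : ℕ) : Prop :=
  ∃ δ : ℝ, 0 < δ ∧
    Integrable (fun ω => ‖X 1 ω‖ ^ ((2 * r : ℝ) + δ)) μ ∧
    Summable (fun k : ℕ => (k : ℝ) ^ (2 * r - 1) *
      alphaMix μ X k ^ (δ / ((2 * r : ℝ) + δ)))

/-- The mean vector `μ = E X₁`. -/
def meanVec (μ : Measure Ω) (X : ℤ → Ω → Fin d → ℝ) : Fin d → ℝ :=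
  fun j => ∫ ω, X 1 ω j ∂μ

/-- Centered linearization `Y_i = ∇'(X_i − μ)`, where `∇ = ∂H(μ)/∂x`. -/
def Ylin (μ : Measure Ω) (X : ℤ → Ω → Fin d → ℝ) (H : (Fin d → ℝ) → ℝ)
    (i : ℤ) (ω : Ω) : ℝ :=
  fderiv ℝ H (meanVec μ X) (fun j => X i ω j - meanVec μ X j)

/-- Autocovariance `r(k) = Cov(∇'X₀, ∇'X_k)`. -/
def rcov (μ : Measure Ω) (X : ℤ → Ω → Fin d → ℝ) (H : (Fin d → ℝ) → ℝ)
    (k : ℤ) : ℝ :=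
  ∫ ω, Ylin μ X H 0 ω * Ylin μ X H k ω ∂μ -
    (∫ ω, Ylin μ X H 0 ω ∂μ) * ∫ ω, Ylin μ X H k ω ∂μ

/-- `B₀ = Σ_k |k| r(k)`. -/
def B0 (μ : Measure Ω) (X : ℤ → Ω → Fin d → ℝ) (H : (Fin d → ℝ) → ℝ) : ℝ :=
  ∑' k : ℤ, |(k : ℝ)| * rcov μ X H k

/-- `σ_∞² = Σ_k r(k)`. -/
def sigInfSq (μ : Measure Ω) (X : ℤ → Ω → Fin d → ℝ) (H : (Fin d → ℝ) → ℝ) : ℝ :=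
  ∑' k : ℤ, rcov μ X H k

/-- `V₀ = (4/3) σ_∞⁴`. -/
def V0 (μ : Measure Ω) (X : ℤ → Ω → Fin d → ℝ) (H : (Fin d → ℝ) → ℝ) : ℝ :=
  (4 / 3) * sigInfSq μ X H ^ 2

/-- `C₀ = (2B₀²/V₀)^{1/3}`. -/
def C0 (μ : Measure Ω) (X : ℤ → Ω → Fin d → ℝ) (H : (Fin d → ℝ) → ℝ) : ℝ :=
  (2 * B0 μ X H ^ 2 / V0 μ X H) ^ ((1 : ℝ) / 3)

/-- Condition (S): `B₀ ≠ 0` and `V₀ > 0`. -/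
def CondS (μ : Measure Ω) (X : ℤ → Ω → Fin d → ℝ) (H : (Fin d → ℝ) → ℝ) : Prop :=
  B0 μ X H ≠ 0 ∧ 0 < V0 μ X H

/-- Sample mean `X̄_n` of `X₁,…,X_n`. -/
def sampleMean (X : ℤ → Ω → Fin d → ℝ) (n : ℕ) (ω : Ω) : Fin d → ℝ :=
  fun j => (∑ i ∈ Finset.range n, X ((i : ℤ) + 1) ω j) / n

/-- `σ_∞² = lim_n n · Var(H(X̄_n))`, identifying the target variance with `Σ_k r(k)`. -/
def SigLimit (μ : Measure Ω) (X : ℤ → Ω → Fin d → ℝ) (H : (Fin d → ℝ) → ℝ) : Prop :=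
  Tendsto (fun n : ℕ => (n : ℝ) * variance (fun ω => H (sampleMean X n ω)) μ)
    atTop (nhds (sigInfSq μ X H))

/-- MBB variance estimator obtained by resampling `k` blocks of length `ℓ`
(i.i.d. uniformly over the block-start offsets in `S`) from the data
`X_s, X_{s+1}, …`; the bootstrap variance is written out as the exact average
over all `|S|^k` equally likely block-index tuples. -/
def mbbVarOn (X : ℤ → Ω → Fin d → ℝ) (H : (Fin d → ℝ) → ℝ)
    (s : ℤ) (ℓ k : ℕ) (S : Finset ℕ) (ω : Ω) : ℝ :=
  let bm : ℕ → Fin d → ℝ := fun i j =>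
    (∑ t ∈ Finset.range ℓ, X (s + (i : ℤ) + (t : ℤ)) ω j) / ℓ
  let θ : (Fin k → ↥S) → ℝ := fun f => H (fun j => (∑ a, bm (f a : ℕ) j) / k)
  (ℓ * k : ℝ) *
    ((∑ f : Fin k → ↥S, θ f ^ 2) / (S.card : ℝ) ^ k -
      ((∑ f : Fin k → ↥S, θ f) / (S.card : ℝ) ^ k) ^ 2)

/-- MBB variance estimator with block length `ℓ` based on the sample
`X_s, …, X_{s+m-1}` (all `m − ℓ + 1` overlapping blocks, `⌊m/ℓ⌋` resampled blocks). -/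
def mbbVar (X : ℤ → Ω → Fin d → ℝ) (H : (Fin d → ℝ) → ℝ)
    (s : ℤ) (m ℓ : ℕ) (ω : Ω) : ℝ :=
  mbbVarOn X H s ℓ (m / ℓ) (Finset.range (m - ℓ + 1)) ω

/-- `σ̂_n²(ℓ)`: MBB variance estimator from `X₁,…,X_n`. -/
def sigmaHat (X : ℤ → Ω → Fin d → ℝ) (H : (Fin d → ℝ) → ℝ)
    (n ℓ : ℕ) (ω : Ω) : ℝ :=
  mbbVar X H 1 n ℓ ω

/-- `MSE_n(ℓ) = E(σ̂_n²(ℓ) − σ_∞²)²`. -/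
def MSEfun (μ : Measure Ω) (X : ℤ → Ω → Fin d → ℝ) (H : (Fin d → ℝ) → ℝ)
    (n ℓ : ℕ) : ℝ :=
  ∫ ω, (sigmaHat X H n ℓ ω - sigInfSq μ X H) ^ 2 ∂μ

/-- `f_n(ℓ) = B₀²/ℓ² + V₀ ℓ/n`. -/
def fapprox (μ : Measure Ω) (X : ℤ → Ω → Fin d → ℝ) (H : (Fin d → ℝ) → ℝ)
    (n ℓ : ℕ) : ℝ :=
  B0 μ X H ^ 2 / (ℓ : ℝ) ^ 2 + V0 μ X H * ℓ / n

/-- The block set `J_n = {ℓ ∈ ℕ : K⁻¹ n^{1/3} ≤ ℓ ≤ K n^{1/3}}` (with `ℓ ≤ n`). -/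
def Jset (K : ℝ) (n : ℕ) : Finset ℕ :=
  (Finset.Icc 1 n).filter fun ℓ =>
    K⁻¹ * (n : ℝ) ^ ((1 : ℝ) / 3) ≤ (ℓ : ℝ) ∧ (ℓ : ℝ) ≤ K * (n : ℝ) ^ ((1 : ℝ) / 3)

/-- `b` minimizes `g` over the finite block set `S`. -/
def IsArgminOn (g : ℕ → ℝ) (S : Finset ℕ) (b : ℕ) : Prop :=
  b ∈ S ∧ ∀ c ∈ S, g b ≤ g c

/-- `Z_n = O_p(a_n)`: `Z_n/a_n` is bounded in probability. -/
def IsBigOp (μ : Measure Ω) (Z : ℕ → Ω → ℝ) (a : ℕ → ℝ) : Prop :=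
  ∀ ε : ℝ, 0 < ε → ∃ C : ℝ, 0 < C ∧
    ∀ᶠ n in atTop, (μ {ω | C * |a n| < |Z n ω|}).toReal ≤ ε

/-- Convergence in probability to a constant `c`. -/
def TendstoInProb (μ : Measure Ω) (Z : ℕ → Ω → ℝ) (c : ℝ) : Prop :=
  ∀ ε : ℝ, 0 < ε →
    Tendsto (fun n => (μ {ω | ε < |Z n ω - c|}).toReal) atTop (nhds 0)

/-- Oracle subsampling MSE `MŜE_m^∞(b)`. -/
def MSEhatInf (μ : Measure Ω) (X : ℤ → Ω → Fin d → ℝ) (H : (Fin d → ℝ) → ℝ)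
    (n m b : ℕ) (ω : Ω) : ℝ :=
  (∑ i ∈ Finset.range (n - m + 1),
    (mbbVar X H ((i : ℤ) + 1) m b ω - sigInfSq μ X H) ^ 2) / ((n - m + 1 : ℕ) : ℝ)

/-- HHJ subsampling MSE `MŜE_m(b)` with pilot block length `ℓpil`. -/
def MSEhatPilot (X : ℤ → Ω → Fin d → ℝ) (H : (Fin d → ℝ) → ℝ)
    (n m b ℓpil : ℕ) (ω : Ω) : ℝ :=
  (∑ i ∈ Finset.range (n - m + 1),
    (mbbVar X H ((i : ℤ) + 1) m b ω - sigmaHat X H n ℓpil ω) ^ 2) / ((n - m + 1 : ℕ) : ℝ)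

/-- `i`-th block-deleted JAB point value (`i` 0-based), deleting `m` consecutive blocks
from the `n − ℓ + 1` MBB blocks of length `ℓ`. -/
def jabPoint (X : ℤ → Ω → Fin d → ℝ) (H : (Fin d → ℝ) → ℝ)
    (n ℓ m i : ℕ) (ω : Ω) : ℝ :=
  mbbVarOn X H 1 ℓ (n / ℓ) (Finset.range (n - ℓ + 1) \ Finset.Ico i (i + m)) ω

/-- JAB variance estimator `VÂR` of the MBB variance estimator `σ̂_n²(ℓ)`. -/
def jabVar (X : ℤ → Ω → Fin d → ℝ) (H : (Fin d → ℝ) → ℝ)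
    (n ℓ m : ℕ) (ω : Ω) : ℝ :=
  (↑m / ((((n - ℓ + 1) - m : ℕ) : ℝ) * (((n - ℓ + 1) - m + 1 : ℕ) : ℝ))) *
    ∑ i ∈ Finset.range ((n - ℓ + 1) - m + 1),
      (((((n - ℓ + 1 : ℕ) : ℝ) * sigmaHat X H n ℓ ω -
          (((n - ℓ + 1) - m : ℕ) : ℝ) * jabPoint X H n ℓ m i ω) / m) -
        sigmaHat X H n ℓ ω) ^ 2

/-- `V̂₀ = (n/ℓ₁) VÂR`. -/
def V0hat (X : ℤ → Ω → Fin d → ℝ) (H : (Fin d → ℝ) → ℝ)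
    (n ℓ₁ m : ℕ) (ω : Ω) : ℝ :=
  ((n : ℝ) / (ℓ₁ : ℝ)) * jabVar X H n ℓ₁ m ω

/-- `B̂₀ = ℓ₂ · BIÂS = 2 ℓ₂ (σ̂_n²(ℓ₂) − σ̂_n²(2ℓ₂))`. -/
def B0hat (X : ℤ → Ω → Fin d → ℝ) (H : (Fin d → ℝ) → ℝ)
    (n ℓ₂ : ℕ) (ω : Ω) : ℝ :=
  (ℓ₂ : ℝ) * (2 * (sigmaHat X H n ℓ₂ ω - sigmaHat X H n (2 * ℓ₂) ω))

/-- The NPPI block length estimator `ℓ̂_{n,NPPI}^{opt} = (2B̂₀²/V̂₀)^{1/3} n^{1/3}`. -/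
def nppiEst (X : ℤ → Ω → Fin d → ℝ) (H : (Fin d → ℝ) → ℝ)
    (n ℓ₁ ℓ₂ m : ℕ) (ω : Ω) : ℝ :=
  (2 * B0hat X H n ℓ₂ ω ^ 2 / V0hat X H n ℓ₁ m ω) ^ ((1 : ℝ) / 3) *
    (n : ℝ) ^ ((1 : ℝ) / 3)

/-- The flat-top lag window `λ`. -/
def flatTop (t : ℝ) : ℝ :=
  if |t| ≤ 1 / 2 then 1 else if |t| ≤ 1 then 2 * (1 - |t|) else 0

/-- `Ŷ_i = ∇̂'(X_i − X̄_n)` with `∇̂ = ∂H(X̄_n)/∂x`. -/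
def YhatPW (X : ℤ → Ω → Fin d → ℝ) (H : (Fin d → ℝ) → ℝ)
    (n : ℕ) (i : ℤ) (ω : Ω) : ℝ :=
  fderiv ℝ H (sampleMean X n ω) (fun j => X i ω j - sampleMean X n ω j)

/-- `∇̂' r̂(k) ∇̂ = n⁻¹ Σ_{i=1}^{n-k} Ŷ_i Ŷ_{i+k}` for `k ≥ 0`. -/
def rhatQuad (X : ℤ → Ω → Fin d → ℝ) (H : (Fin d → ℝ) → ℝ)
    (n k : ℕ) (ω : Ω) : ℝ :=
  (∑ i ∈ Finset.range (n - k),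
    YhatPW X H n ((i : ℤ) + 1) ω * YhatPW X H n ((i : ℤ) + 1 + (k : ℤ)) ω) / n

/-- `B̂ = Σ_{k=-2M}^{2M} λ(k/(2M)) |k| ∇̂'r̂(k)∇̂`. -/
def BhatPW (X : ℤ → Ω → Fin d → ℝ) (H : (Fin d → ℝ) → ℝ)
    (n Mb : ℕ) (ω : Ω) : ℝ :=
  ∑ k ∈ Finset.Icc (-(2 * Mb : ℤ)) (2 * Mb : ℤ),
    flatTop ((k : ℝ) / (2 * Mb)) * |(k : ℝ)| * rhatQuad X H n k.natAbs ω

/-- `Ŝ = Σ_{k=-2M}^{2M} λ(k/(2M)) ∇̂'r̂(k)∇̂`. -/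
def ShatPW (X : ℤ → Ω → Fin d → ℝ) (H : (Fin d → ℝ) → ℝ)
    (n Mb : ℕ) (ω : Ω) : ℝ :=
  ∑ k ∈ Finset.Icc (-(2 * Mb : ℤ)) (2 * Mb : ℤ),
    flatTop ((k : ℝ) / (2 * Mb)) * rhatQuad X H n k.natAbs ω

/-- The Politis–White block length estimator `ℓ̂_{n,PW}^{opt}`. -/
def pwEst (X : ℤ → Ω → Fin d → ℝ) (H : (Fin d → ℝ) → ℝ)
    (n Mb : ℕ) (ω : Ω) : ℝ :=
  (2 * BhatPW X H n Mb ω ^ 2 / ((4 / 3) * ShatPW X H n Mb ω ^ 4)) ^ ((1 : ℝ) / 3) *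
    (n : ℝ) ^ ((1 : ℝ) / 3)

/-- `Δ_m^∞(b)`: difference of the centered oracle subsampling MSE at `b_m^{opt}` and `b`. -/
def DeltaInf (μ : Measure Ω) (X : ℤ → Ω → Fin d → ℝ) (H : (Fin d → ℝ) → ℝ)
    (bopt n m b : ℕ) (ω : Ω) : ℝ :=
  (MSEhatInf μ X H n m bopt ω - ∫ ω', MSEhatInf μ X H n m bopt ω' ∂μ) -
    (MSEhatInf μ X H n m b ω - ∫ ω', MSEhatInf μ X H n m b ω' ∂μ)

/-- `Ω_{3,m}(b)`. -/
def Omega3 (μ : Measure Ω) (X : ℤ → Ω → Fin d → ℝ) (H : (Fin d → ℝ) → ℝ)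
    (bopt ℓpil n m b : ℕ) (ω : Ω) : ℝ :=
  2 * (sigmaHat X H n ℓpil ω - sigInfSq μ X H) / ((n - m + 1 : ℕ) : ℝ) *
    ∑ i ∈ Finset.range (n - m + 1),
      ((mbbVar X H ((i : ℤ) + 1) m b ω - mbbVar X H ((i : ℤ) + 1) m bopt ω) -
        ∫ ω', (mbbVar X H ((i : ℤ) + 1) m b ω' - mbbVar X H ((i : ℤ) + 1) m bopt ω') ∂μ)

/-- `Ω_{1,m}(b) = Ω_{3,m}(b) − E Ω_{3,m}(b)`. -/
def Omega1 (μ : Measure Ω) (X : ℤ → Ω → Fin d → ℝ) (H : (Fin d → ℝ) → ℝ)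
    (bopt ℓpil n m b : ℕ) (ω : Ω) : ℝ :=
  Omega3 μ X H bopt ℓpil n m b ω - ∫ ω', Omega3 μ X H bopt ℓpil n m b ω' ∂μ

/-- `Ω_{2,m}(b) = 2[σ̂_n²(ℓ̃) − Eσ̂_n²(ℓ̃)] · E[σ̂²_{1,m}(b_m^{opt}) − σ̂²_{1,m}(b)]`. -/
def Omega2 (μ : Measure Ω) (X : ℤ → Ω → Fin d → ℝ) (H : (Fin d → ℝ) → ℝ)
    (bopt ℓpil n m b : ℕ) (ω : Ω) : ℝ :=
  2 * (sigmaHat X H n ℓpil ω - ∫ ω', sigmaHat X H n ℓpil ω' ∂μ) *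
    ∫ ω', (mbbVar X H 1 m bopt ω' - mbbVar X H 1 m b ω') ∂μ

/-- `J_m^{opt}(C) = {b ∈ J_m : |b_m^{opt} − b| ≤ C m^{1/3}}`. -/
def JmOpt (K : ℝ) (bopt m : ℕ) (C : ℝ) : Finset ℕ :=
  (Jset K m).filter fun b => |(bopt : ℝ) - (b : ℝ)| ≤ C * (m : ℝ) ^ ((1 : ℝ) / 3)

/-- `Ȳ_k = k⁻¹ Σ_{i=1}^k Y_i`. -/
def Ybar (μ : Measure Ω) (X : ℤ → Ω → Fin d → ℝ) (H : (Fin d → ℝ) → ℝ)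
    (k : ℕ) (ω : Ω) : ℝ :=
  (∑ i ∈ Finset.range k, Ylin μ X H ((i : ℤ) + 1) ω) / k

/-- Stationarity transports the strong mixing bound from time `0` to an arbitrary time `t`. -/
lemma mixing_shift {μ : Measure Ω} [IsProbabilityMeasure μ] {X : ℤ → Ω → Fin d → ℝ}
    (hmeas : ∀ i, Measurable (X i)) (hstat : IsStationary μ X) (t : ℤ) (h : ℕ) {A B : Set Ω}
    (hA : MeasurableSet[sigmaOf X {i | i ≤ t}] A)
    (hB : MeasurableSet[sigmaOf X {i | t + h ≤ i}] B) :
    |μ.real (A ∩ B) - μ.real A * μ.real B| ≤ alphaMix μ X h := by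
  have key : ∀ (S : Set ℤ) (u : ℤ), sigmaOf X ((fun i => i + u) '' S) =
      (⨆ i ∈ S, MeasurableSpace.comap (fun p : ℤ → Fin d → ℝ => p i) inferInstance).comap
        (fun ω (i : ℤ) => X (i + u) ω) := by
    intro S u
    simp only [sigmaOf, MeasurableSpace.comap_iSup, MeasurableSpace.comap_comp, iSup_image]
    rfl
  have e1 : {i : ℤ | i ≤ t} = (fun i => i + t) '' {i | i ≤ 0} := by
    ext i; simp only [Set.mem_ofPred_eq, Set.mem_image]
    exact ⟨fun hi => ⟨i - t, by omega, by omega⟩, by rintro ⟨j, hj, rfl⟩; omega⟩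
  have e2 : {i : ℤ | t + h ≤ i} = (fun i => i + t) '' {i | (h : ℤ) ≤ i} := by
    ext i; simp only [Set.mem_ofPred_eq, Set.mem_image]
    exact ⟨fun hi => ⟨i - t, by omega, by omega⟩, by rintro ⟨j, hj, rfl⟩; omega⟩
  rw [e1, key] at hA
  rw [e2, key] at hB
  obtain ⟨A', hA', rfl⟩ := hA
  obtain ⟨B', hB', rfl⟩ := hB
  have le_pi : ∀ S : Set ℤ, (⨆ i ∈ S, MeasurableSpace.comap (fun p : ℤ → Fin d → ℝ => p i)
      inferInstance) ≤ MeasurableSpace.pi := fun S =>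
    iSup₂_le fun i _ => measurable_iff_comap_le.1 (measurable_pi_apply i)
  have hA'' := le_pi _ _ hA'
  have hB'' := le_pi _ _ hB'
  have hm : ∀ u : ℤ, Measurable (fun ω (i : ℤ) => X (i + u) ω) := fun u =>
    measurable_pi_lambda _ fun i => hmeas _
  have eq0 : ∀ C : Set (ℤ → Fin d → ℝ), MeasurableSet C →
      μ.real ((fun ω (i : ℤ) => X (i + t) ω) ⁻¹' C) =
        μ.real ((fun ω (i : ℤ) => X (i + 0) ω) ⁻¹' C) := by
    intro C hC
    have h1 := hstat t
    have h2 := hstat 0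
    simp only [Measure.real]
    rw [← Measure.map_apply (hm t) hC, ← Measure.map_apply (hm 0) hC, h1, h2]
  rw [← Set.preimage_inter, eq0 _ (hA''.inter hB''), eq0 _ hA'', eq0 _ hB'']
  refine le_csSup ⟨1, ?_⟩ ⟨(fun ω (i : ℤ) => X (i + 0) ω) ⁻¹' A',
    (fun ω (i : ℤ) => X (i + 0) ω) ⁻¹' B', ?_, ?_, ?_⟩
  · rintro x ⟨A, B, -, -, rfl⟩
    change |μ.real (A ∩ B) - μ.real A * μ.real B| ≤ 1
    have h1 : μ.real (A ∩ B) ≤ 1 := measureReal_le_one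
    have h2 : μ.real A ≤ 1 := measureReal_le_one
    have h3 : μ.real B ≤ 1 := measureReal_le_one
    have h4 : 0 ≤ μ.real A := measureReal_nonneg
    have h5 : 0 ≤ μ.real B := measureReal_nonneg
    have h6 : 0 ≤ μ.real (A ∩ B) := measureReal_nonneg
    rw [abs_le]
    constructor <;> nlinarith [mul_nonneg h4 h5]
  · have := key {i | i ≤ 0} 0
    simp only [add_zero, Set.image_id'] at this ⊢
    rw [this]
    exact ⟨A', hA', rfl⟩
  · have := key {i | (h : ℤ) ≤ i} 0
    simp only [add_zero, Set.image_id'] at this ⊢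
    rw [this]
    exact ⟨B', hB', rfl⟩
  · rfl

lemma sigmaOf_le {X : ℤ → Ω → Fin d → ℝ} (hmeas : ∀ i, Measurable (X i)) (S : Set ℤ) :
    sigmaOf X S ≤ ‹MeasurableSpace Ω› :=
  iSup₂_le fun i _ => measurable_iff_comap_le.1 (hmeas i)

omit [MeasurableSpace Ω] in
lemma measurable_sigmaOf (X : ℤ → Ω → Fin d → ℝ) {S : Set ℤ} {i : ℤ} (hi : i ∈ S) :
    Measurable[sigmaOf X S] (X i) :=
  Measurable.mono (comap_measurable (X i)) (le_iSup₂_of_le i hi le_rfl) le_rfl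

lemma abs_integral_sub_le_of_forall_measure {Ω : Type*} {m : MeasurableSpace Ω}
    [mΩ : MeasurableSpace Ω] {ν₁ ν₂ : Measure Ω} [IsFiniteMeasure ν₁]
    [IsFiniteMeasure ν₂] (hm : m ≤ mΩ) {a : ℝ}
    (h : ∀ B, MeasurableSet[m] B → |ν₁.real B - ν₂.real B| ≤ a) {η : Ω → ℝ}
    (hη : Measurable[m] η) (h0 : ∀ ω, 0 ≤ η ω) (h1 : ∀ ω, η ω ≤ 1) :
    |∫ ω, η ω ∂ν₁ - ∫ ω, η ω ∂ν₂| ≤ a := by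
  have hη' : Measurable η := hη.mono hm le_rfl
  have hint : ∀ (ν : Measure Ω) [IsFiniteMeasure ν], Integrable η ν := fun ν _ =>
    Integrable.of_bound hη'.aestronglyMeasurable 1
      (ae_of_all _ fun ω => by rw [Real.norm_eq_abs, abs_of_nonneg (h0 ω)]; exact h1 ω)
  have rep : ∀ (ν : Measure Ω) [IsFiniteMeasure ν],
      ∫ ω, η ω ∂ν = ∫ t in (0 : ℝ)..1, ν.real {ω | t < η ω} := by
    intro ν _
    rw [(hint ν).integral_eq_integral_meas_lt (ae_of_all _ h0),
      intervalIntegral.integral_of_le zero_le_one]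
    refine setIntegral_eq_of_subset_of_forall_sdiff_eq_zero measurableSet_Ioi
      (fun t ht => ht.1) ?_
    rintro t ⟨ht, ht'⟩
    have : {ω | t < η ω} = ∅ := by
      ext ω
      simp only [Set.mem_ofPred_eq, Set.mem_empty_iff_false, iff_false, not_lt]
      exact (h1 ω).trans (not_le.1 fun hc => ht' ⟨ht, hc⟩).le
    rw [this]; simp
  have ii : ∀ (ν : Measure Ω) [IsFiniteMeasure ν],
      IntervalIntegrable (fun t => ν.real {ω | t < η ω}) volume 0 1 := by
    intro ν _
    refine Antitone.intervalIntegrable fun s t hst => ?_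
    exact measureReal_mono fun ω hω => lt_of_le_of_lt hst hω
  rw [rep ν₁, rep ν₂, ← intervalIntegral.integral_sub (ii ν₁) (ii ν₂)]
  have := intervalIntegral.norm_integral_le_of_norm_le_const (a := (0 : ℝ)) (b := 1)
    (f := fun t => ν₁.real {ω | t < η ω} - ν₂.real {ω | t < η ω}) (C := a)
    (fun t _ => h _ (measurableSet_lt measurable_const hη))
  simpa using this

/-- Covariance bound for `[0, 1]`-valued variables measurable with respect to
`a`-mixing σ-algebras. -/
lemma abs_cov_le_of_unit {Ω : Type*} {m₁ m₂ : MeasurableSpace Ω} [mΩ : MeasurableSpace Ω]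
    {μ : Measure Ω} [IsProbabilityMeasure μ] (hm₁ : m₁ ≤ mΩ) (hm₂ : m₂ ≤ mΩ) {a : ℝ}
    (h : ∀ A B, MeasurableSet[m₁] A → MeasurableSet[m₂] B →
      |μ.real (A ∩ B) - μ.real A * μ.real B| ≤ a) {ξ η : Ω → ℝ}
    (hξ : Measurable[m₁] ξ) (hη : Measurable[m₂] η)
    (hξ0 : ∀ ω, 0 ≤ ξ ω) (hξ1 : ∀ ω, ξ ω ≤ 1) (hη0 : ∀ ω, 0 ≤ η ω) (hη1 : ∀ ω, η ω ≤ 1) :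
    |∫ ω, ξ ω * η ω ∂μ - (∫ ω, ξ ω ∂μ) * ∫ ω, η ω ∂μ| ≤ a := by
  have hη' : Measurable η := hη.mono hm₂ le_rfl
  have hint : Integrable η μ := Integrable.of_bound hη'.aestronglyMeasurable 1
      (ae_of_all _ fun ω => by rw [Real.norm_eq_abs, abs_of_nonneg (hη0 ω)]; exact hη1 ω)
  have step1 : ∀ A, MeasurableSet[m₁] A → |∫ ω in A, η ω ∂μ - μ.real A * ∫ ω, η ω ∂μ| ≤ a := by
    intro A hA
    have hfin : IsFiniteMeasure ((μ A) • μ) := Measure.smul_finite _ (measure_ne_top _ _)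
    have := abs_integral_sub_le_of_forall_measure (ν₁ := μ.restrict A)
      (ν₂ := (μ A) • μ) hm₂ (a := a) ?_ hη hη0 hη1
    · rw [integral_smul_measure] at this
      exact this
    · intro B hB
      have := h A B hA hB
      rw [measureReal_restrict_apply (hm₂ _ hB), Set.inter_comm]
      simpa [Measure.real] using this
  set ν₁ := μ.withDensity fun ω => ENNReal.ofReal (η ω) with hν₁
  have hEη : 0 ≤ ∫ ω, η ω ∂μ := integral_nonneg hη0
  set ν₂ := (ENNReal.ofReal (∫ ω, η ω ∂μ)) • μ with hν₂
  have hfin₂ : IsFiniteMeasure ν₂ := Measure.smul_finite _ ENNReal.ofReal_ne_top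
  have hfin₁ : IsFiniteMeasure ν₁ := isFiniteMeasure_withDensity_ofReal hint.2
  have := abs_integral_sub_le_of_forall_measure (ν₁ := ν₁) (ν₂ := ν₂) hm₁ (a := a) ?_ hξ hξ0 hξ1
  · rw [hν₂, integral_smul_measure, hν₁, integral_withDensity_eq_integral_toReal_smul
      hη'.ennreal_ofReal (ae_of_all _ fun ω => ENNReal.ofReal_lt_top),
      ENNReal.toReal_ofReal hEη] at this
    simp only [ENNReal.toReal_ofReal (hη0 _), smul_eq_mul] at this
    rw [mul_comm (∫ ω, ξ ω ∂μ)]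
    simpa only [mul_comm (η _)] using this
  · intro A hA
    have h2 : ν₁.real A = ∫ ω in A, η ω ∂μ := by
      rw [Measure.real, hν₁, withDensity_apply _ (hm₁ _ hA),
        ← ofReal_integral_eq_lintegral_ofReal hint.integrableOn (ae_of_all _ hη0),
        ENNReal.toReal_ofReal (integral_nonneg hη0)]
    have h3 : ν₂.real A = μ.real A * ∫ ω, η ω ∂μ := by
      simp [hν₂, Measure.real, ENNReal.toReal_ofReal hEη, mul_comm]
    rw [h2, h3]
    exact step1 A hA

lemma abs_cov_le_of_bounded {Ω : Type*} {m₁ m₂ : MeasurableSpace Ω} [mΩ : MeasurableSpace Ω]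
    {μ : Measure Ω} [IsProbabilityMeasure μ] (hm₁ : m₁ ≤ mΩ) (hm₂ : m₂ ≤ mΩ) {a : ℝ}
    (h : ∀ A B, MeasurableSet[m₁] A → MeasurableSet[m₂] B →
      |μ.real (A ∩ B) - μ.real A * μ.real B| ≤ a) {ξ η : Ω → ℝ}
    (hξ : Measurable[m₁] ξ) (hη : Measurable[m₂] η) {M N : ℝ} (hM : 0 < M) (hN : 0 < N)
    (hξM : ∀ ω, |ξ ω| ≤ M) (hηN : ∀ ω, |η ω| ≤ N) :
    |∫ ω, ξ ω * η ω ∂μ - (∫ ω, ξ ω ∂μ) * ∫ ω, η ω ∂μ| ≤ 4 * a * (M * N) := by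
  have bd : ∀ {x M : ℝ}, 0 < M → |x| ≤ M → 0 ≤ (x + M) / (2 * M) ∧ (x + M) / (2 * M) ≤ 1 := by
    intro x M hM hx
    rw [abs_le] at hx
    constructor
    · apply div_nonneg <;> linarith
    · rw [div_le_one] <;> linarith
  have hξ' : Measurable ξ := hξ.mono hm₁ le_rfl
  have hη' : Measurable η := hη.mono hm₂ le_rfl
  have iξ : Integrable ξ μ := Integrable.of_bound hξ'.aestronglyMeasurable M (ae_of_all _ hξM)
  have iη : Integrable η μ := Integrable.of_bound hη'.aestronglyMeasurable N (ae_of_all _ hηN)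
  have iξη : Integrable (fun ω => ξ ω * η ω) μ :=
    Integrable.of_bound (hξ'.mul hη').aestronglyMeasurable (M * N) (ae_of_all _ fun ω => by
      rw [norm_mul]
      exact mul_le_mul (hξM ω) (hηN ω) (abs_nonneg _) hM.le)
  have key := abs_cov_le_of_unit hm₁ hm₂ h (ξ := fun ω => (ξ ω + M) / (2 * M))
    (η := fun ω => (η ω + N) / (2 * N)) ((hξ.add_const M).div_const _)
    ((hη.add_const N).div_const _) (fun ω => (bd hM (hξM ω)).1) (fun ω => (bd hM (hξM ω)).2)
    (fun ω => (bd hN (hηN ω)).1) (fun ω => (bd hN (hηN ω)).2)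
  have e1 : ∫ ω, (ξ ω + M) / (2 * M) ∂μ = (∫ ω, ξ ω ∂μ + M) / (2 * M) := by
    rw [integral_div, integral_add iξ (integrable_const _)]; simp
  have e2 : ∫ ω, (η ω + N) / (2 * N) ∂μ = (∫ ω, η ω ∂μ + N) / (2 * N) := by
    rw [integral_div, integral_add iη (integrable_const _)]; simp
  have e3 : ∫ ω, (ξ ω + M) / (2 * M) * ((η ω + N) / (2 * N)) ∂μ =
      (∫ ω, ξ ω * η ω ∂μ + N * ∫ ω, ξ ω ∂μ + M * ∫ ω, η ω ∂μ + M * N) / (4 * (M * N)) := by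
    have : ∀ ω, (ξ ω + M) / (2 * M) * ((η ω + N) / (2 * N)) =
        (ξ ω * η ω + N * ξ ω + M * η ω + M * N) / (4 * (M * N)) := by
      intro ω; field_simp; ring
    simp_rw [this]
    have i₁ : Integrable (fun ω => ξ ω * η ω + N * ξ ω) μ := iξη.add (iξ.const_mul N)
    have i₂ : Integrable (fun ω => ξ ω * η ω + N * ξ ω + M * η ω) μ := i₁.add (iη.const_mul M)
    rw [integral_div, integral_add i₂ (integrable_const _), integral_add i₁ (iη.const_mul M),
      integral_add iξη (iξ.const_mul N), integral_const_mul, integral_const_mul]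
    simp
  rw [e1, e2, e3] at key
  have e4 : (∫ ω, ξ ω * η ω ∂μ + N * ∫ ω, ξ ω ∂μ + M * ∫ ω, η ω ∂μ + M * N) / (4 * (M * N)) -
      (∫ ω, ξ ω ∂μ + M) / (2 * M) * ((∫ ω, η ω ∂μ + N) / (2 * N)) =
      (∫ ω, ξ ω * η ω ∂μ - (∫ ω, ξ ω ∂μ) * ∫ ω, η ω ∂μ) / (4 * (M * N)) := by
    field_simp; ring
  have hMN : 0 < 4 * (M * N) := by positivity
  rw [e4, abs_div, abs_of_pos hMN, div_le_iff₀ hMN] at key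
  linarith

/-- Power of `x`, truncated to `0` where `|x| > T`. -/
def truncPow (T : ℝ) (j : ℕ) (x : ℝ) : ℝ := if |x| ≤ T then x ^ j else 0

lemma abs_truncPow_le {T : ℝ} (hT : 0 ≤ T) (j : ℕ) (x : ℝ) : |truncPow T j x| ≤ T ^ j := by
  unfold truncPow
  split_ifs with h
  · rw [abs_pow]; exact pow_le_pow_left₀ (abs_nonneg _) h j
  · simpa using pow_nonneg hT j

lemma measurable_truncPow (T : ℝ) (j : ℕ) : Measurable (truncPow T j) :=
  Measurable.ite (measurableSet_le (by fun_prop) measurable_const) (by fun_prop) measurable_const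

lemma abs_sub_truncPow_le {T s : ℝ} (hT : 0 < T) {j l : ℕ} (hjl : ((j + l : ℕ) : ℝ) ≤ s)
    (x y : ℝ) :
    |x ^ j * y ^ l - truncPow T j x * truncPow T l y| ≤
      T ^ (j + l) * T ^ (-s) * (|x| ^ s + |y| ^ s) := by
  have hs : 0 ≤ s := le_trans (by positivity) hjl
  have main : ∀ M : ℝ, T < M → |x| ≤ M → |y| ≤ M → (M = |x| ∨ M = |y|) →
      |x ^ j * y ^ l| ≤ T ^ (j + l) * T ^ (-s) * (|x| ^ s + |y| ^ s) := by
    intro M hTM hx hy hM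
    have hM0 : 0 < M := hT.trans hTM
    have h1 : |x ^ j * y ^ l| ≤ M ^ (j + l) := by
      rw [abs_mul, abs_pow, abs_pow, pow_add]; gcongr
    have h2 : (M / T) ^ (j + l) ≤ (M / T) ^ s := by
      rw [← Real.rpow_natCast]
      exact Real.rpow_le_rpow_of_exponent_le ((one_le_div hT).2 hTM.le) hjl
    have h3 : M ^ s ≤ |x| ^ s + |y| ^ s := by
      have := Real.rpow_nonneg (abs_nonneg x) s
      have := Real.rpow_nonneg (abs_nonneg y) s
      rcases hM with rfl | rfl <;> linarith
    calc |x ^ j * y ^ l| ≤ M ^ (j + l) := h1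
      _ = T ^ (j + l) * (M / T) ^ (j + l) := by rw [div_pow]; field_simp
      _ ≤ T ^ (j + l) * (M / T) ^ s := by gcongr
      _ = T ^ (j + l) * T ^ (-s) * M ^ s := by
          rw [Real.div_rpow hM0.le hT.le, Real.rpow_neg hT.le]; field_simp
      _ ≤ _ := by gcongr
  by_cases hx : |x| ≤ T
  · by_cases hy : |y| ≤ T
    · simp only [truncPow, hx, hy, if_true, sub_self, abs_zero]
      positivity
    · simp only [truncPow, hy, if_false, mul_zero, sub_zero]
      push Not at hy
      exact main |y| hy (hx.trans hy.le) le_rfl (Or.inr rfl)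
  · simp only [truncPow, hx, if_false, zero_mul, sub_zero]
    push Not at hx
    rcases le_total |x| |y| with h | h
    · exact main |y| (hx.trans_le h) h le_rfl (Or.inr rfl)
    · exact main |x| hx le_rfl h (Or.inl rfl)

lemma integrable_pow_mul_pow {μ : Measure Ω} [IsFiniteMeasure μ] {A B : Ω → ℝ} {s : ℝ}
    (hA : Measurable A) (hB : Measurable B) (hAs : Integrable (fun ω => |A ω| ^ s) μ)
    (hBs : Integrable (fun ω => |B ω| ^ s) μ) {j l : ℕ} (hjl : ((j + l : ℕ) : ℝ) ≤ s) :
    Integrable (fun ω => A ω ^ j * B ω ^ l) μ := by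
  refine Integrable.mono' ((integrable_const (1 : ℝ)).add (hAs.add hBs))
    ((hA.pow_const j).mul (hB.pow_const l)).aestronglyMeasurable (ae_of_all _ fun ω => ?_)
  have h1 := abs_sub_truncPow_le one_pos hjl (A ω) (B ω)
  have h2 : |truncPow 1 j (A ω) * truncPow 1 l (B ω)| ≤ 1 := by
    rw [abs_mul]
    have := abs_truncPow_le zero_le_one j (A ω)
    have := abs_truncPow_le zero_le_one l (B ω)
    simp only [one_pow] at *
    exact mul_le_one₀ ‹_› (abs_nonneg _) ‹_›
  simp only [one_pow, Real.one_rpow, one_mul] at h1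
  have := abs_sub_abs_le_abs_sub (A ω ^ j * B ω ^ l) (truncPow 1 j (A ω) * truncPow 1 l (B ω))
  simp only [Real.norm_eq_abs, Pi.add_apply]
  linarith

lemma abs_integral_sub_truncPow_le {μ : Measure Ω} [IsProbabilityMeasure μ] {A B : Ω → ℝ} {s : ℝ}
    (hA : Measurable A) (hB : Measurable B) (hAs : Integrable (fun ω => |A ω| ^ s) μ)
    (hBs : Integrable (fun ω => |B ω| ^ s) μ) {j l : ℕ} (hjl : ((j + l : ℕ) : ℝ) ≤ s)
    {T : ℝ} (hT : 0 < T) :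
    |∫ ω, A ω ^ j * B ω ^ l ∂μ - ∫ ω, truncPow T j (A ω) * truncPow T l (B ω) ∂μ| ≤
      T ^ (j + l) * T ^ (-s) * (∫ ω, |A ω| ^ s ∂μ + ∫ ω, |B ω| ^ s ∂μ) := by
  have hi : Integrable (fun ω => truncPow T j (A ω) * truncPow T l (B ω)) μ := by
    refine Integrable.of_bound (((measurable_truncPow T j).comp hA).mul
      ((measurable_truncPow T l).comp hB)).aestronglyMeasurable (T ^ j * T ^ l)
      (ae_of_all _ fun ω => ?_)
    rw [norm_mul]
    exact mul_le_mul (abs_truncPow_le hT.le _ _) (abs_truncPow_le hT.le _ _) (abs_nonneg _)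
      (by positivity)
  rw [← integral_sub (integrable_pow_mul_pow hA hB hAs hBs hjl) hi, ← integral_add hAs hBs,
    ← integral_const_mul]
  exact norm_integral_le_of_norm_le
    (f := fun ω => A ω ^ j * B ω ^ l - truncPow T j (A ω) * truncPow T l (B ω))
    (g := fun ω => T ^ (j + l) * T ^ (-s) * (|A ω| ^ s + |B ω| ^ s)) ((hAs.add hBs).const_mul _)
    (ae_of_all _ fun ω => abs_sub_truncPow_le hT hjl (A ω) (B ω))

/-- Covariance inequality for powers of variables with finite absolute moments of order `s`,
measurable with respect to `a`-mixing σ-algebras; `T` is a free truncation level. -/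
lemma abs_cov_pow_le {Ω : Type*} {m₁ m₂ : MeasurableSpace Ω} [mΩ : MeasurableSpace Ω]
    {μ : Measure Ω} [IsProbabilityMeasure μ] (hm₁ : m₁ ≤ mΩ) (hm₂ : m₂ ≤ mΩ) {a : ℝ}
    (h : ∀ A B, MeasurableSet[m₁] A → MeasurableSet[m₂] B →
      |μ.real (A ∩ B) - μ.real A * μ.real B| ≤ a) {A B : Ω → ℝ} {s : ℝ}
    (hA : Measurable[m₁] A) (hB : Measurable[m₂] B) (hAs : Integrable (fun ω => |A ω| ^ s) μ)
    (hBs : Integrable (fun ω => |B ω| ^ s) μ) {j l : ℕ} (hjl : ((j + l : ℕ) : ℝ) ≤ s)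
    {T : ℝ} (hT : 0 < T) :
    |∫ ω, A ω ^ j * B ω ^ l ∂μ - (∫ ω, A ω ^ j ∂μ) * ∫ ω, B ω ^ l ∂μ| ≤
      4 * a * T ^ (j + l) +
        2 * (T ^ (j + l) * T ^ (-s) * (∫ ω, |A ω| ^ s ∂μ + ∫ ω, |B ω| ^ s ∂μ)) := by
  have hA' : Measurable A := hA.mono hm₁ le_rfl
  have hB' : Measurable B := hB.mono hm₂ le_rfl
  have k1 := abs_integral_sub_truncPow_le hA' hB' hAs hBs hjl hT
  have k2 := abs_integral_sub_truncPow_le (μ := μ.prod μ) (hA'.comp measurable_fst)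
    (hB'.comp measurable_snd) (hAs.comp_fst μ) (hBs.comp_snd μ) hjl hT
  have k3 := abs_cov_le_of_bounded hm₁ hm₂ h (ξ := fun ω => truncPow T j (A ω))
    (η := fun ω => truncPow T l (B ω)) ((measurable_truncPow T j).comp hA)
    ((measurable_truncPow T l).comp hB) (pow_pos hT j) (pow_pos hT l)
    (fun ω => abs_truncPow_le hT.le _ _) (fun ω => abs_truncPow_le hT.le _ _)
  simp only [Function.comp_apply] at k2
  rw [integral_prod_mul (fun ω => A ω ^ j) (fun ω => B ω ^ l),
    integral_prod_mul (fun ω => truncPow T j (A ω)) (fun ω => truncPow T l (B ω)),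
    integral_fun_fst (fun ω => |A ω| ^ s), integral_fun_snd (fun ω => |B ω| ^ s)] at k2
  simp only [probReal_univ, one_smul] at k2
  rw [pow_add] at *
  rw [abs_le] at *
  constructor <;> linarith [k1.1, k1.2, k2.1, k2.2, k3.1, k3.2]

/-- Sum of the `m` consecutive terms of `Z` starting at time `t`. -/
def psum (Z : ℤ → Ω → ℝ) (t : ℤ) (m : ℕ) (ω : Ω) : ℝ := ∑ i ∈ Finset.range m, Z (t + i) ω

/-- A centred scalar process, subordinate to `X`, with moments of order `s` bounded by `D`. -/
structure IsScore (μ : Measure Ω) (X : ℤ → Ω → Fin d → ℝ) (s D : ℝ) (Z : ℤ → Ω → ℝ) : Prop where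
  meas : ∀ i, Measurable[sigmaOf X {i}] (Z i)
  mean : ∀ i, ∫ ω, Z i ω ∂μ = 0
  int : ∀ i, Integrable (fun ω => |Z i ω| ^ s) μ
  bound : ∀ i, ∫ ω, |Z i ω| ^ s ∂μ ≤ D

/-- Strong mixing bound between the past of `t` and the future of `t + h`, for all `t`. -/
def MixesWith (μ : Measure Ω) (X : ℤ → Ω → Fin d → ℝ) (α : ℕ → ℝ) : Prop :=
  ∀ (t : ℤ) (h : ℕ) (A B : Set Ω), MeasurableSet[sigmaOf X {i | i ≤ t}] A →
    MeasurableSet[sigmaOf X {i | t + h ≤ i}] B → |μ.real (A ∩ B) - μ.real A * μ.real B| ≤ α h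

omit [MeasurableSpace Ω] in
lemma sigmaOf_mono (X : ℤ → Ω → Fin d → ℝ) {S T : Set ℤ} (h : S ⊆ T) :
    sigmaOf X S ≤ sigmaOf X T :=
  iSup₂_le fun i hi => le_iSup₂_of_le i (h hi) le_rfl

omit [MeasurableSpace Ω] in
lemma measurable_psum_sigmaOf {X : ℤ → Ω → Fin d → ℝ} {Z : ℤ → Ω → ℝ}
    (hZ : ∀ i, Measurable[sigmaOf X {i}] (Z i)) {S : Set ℤ} {t : ℤ} {m : ℕ}
    (hS : ∀ i < m, t + (i : ℤ) ∈ S) : Measurable[sigmaOf X S] (psum Z t m) := by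
  refine Finset.measurable_sum _ fun i hi => ?_
  exact (hZ _).mono (sigmaOf_mono X (Set.singleton_subset_iff.2 (hS i (Finset.mem_range.1 hi))))
    le_rfl

lemma integrable_pow_of_rpow {μ : Measure Ω} [IsFiniteMeasure μ] {A : Ω → ℝ} {s : ℝ}
    (hA : Measurable A) (hAs : Integrable (fun ω => |A ω| ^ s) μ) {j : ℕ} (hj : (j : ℝ) ≤ s) :
    Integrable (fun ω => A ω ^ j) μ := by
  simpa using integrable_pow_mul_pow (j := j) (l := 0) hA hA hAs hAs (by simpa using hj)

lemma abs_pow_le_one_add_rpow {s : ℝ} {j : ℕ} (hj : (j : ℝ) ≤ s) (x : ℝ) :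
    |x| ^ j ≤ 1 + |x| ^ s := by
  rcases le_total |x| 1 with h | h
  · have := pow_le_one₀ (n := j) (abs_nonneg x) h
    have := Real.rpow_nonneg (abs_nonneg x) s
    linarith
  · have := Real.rpow_le_rpow_of_exponent_le h hj
    rw [Real.rpow_natCast] at this
    linarith

section Score

variable {μ : Measure Ω} [IsProbabilityMeasure μ] {X : ℤ → Ω → Fin d → ℝ} {s D : ℝ}
  {Z : ℤ → Ω → ℝ}

omit [IsProbabilityMeasure μ] in
lemma IsScore.measurable (hmeas : ∀ i, Measurable (X i)) (hZ : IsScore μ X s D Z) (i : ℤ) :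
    Measurable (Z i) := (hZ.meas i).mono (sigmaOf_le hmeas _) le_rfl

omit [IsProbabilityMeasure μ] in
lemma IsScore.measurable_psum (hmeas : ∀ i, Measurable (X i)) (hZ : IsScore μ X s D Z) (t : ℤ)
    (m : ℕ) : Measurable (psum Z t m) :=
  Finset.measurable_sum _ fun _ _ => hZ.measurable hmeas _

omit [IsProbabilityMeasure μ] in
lemma IsScore.nonneg (hZ : IsScore μ X s D Z) : 0 ≤ D :=
  (integral_nonneg fun _ => Real.rpow_nonneg (abs_nonneg _) _).trans (hZ.bound 0)

omit [MeasurableSpace Ω] in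
lemma abs_psum_rpow_le (hs : 1 ≤ s) (t : ℤ) (m : ℕ) (ω : Ω) :
    |psum Z t m ω| ^ s ≤ (m : ℝ) ^ (s - 1) * ∑ i ∈ Finset.range m, |Z (t + i) ω| ^ s := by
  calc |psum Z t m ω| ^ s ≤ (∑ i ∈ Finset.range m, |Z (t + i) ω|) ^ s := by
        gcongr; exact Finset.abs_sum_le_sum_abs _ _
    _ ≤ _ := by simpa using Real.rpow_sum_le_const_mul_sum_rpow (Finset.range m)
                  (fun i : ℕ => Z (t + i) ω) hs

omit [IsProbabilityMeasure μ] in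
lemma IsScore.integrable_psum_rpow (hmeas : ∀ i, Measurable (X i)) (hZ : IsScore μ X s D Z)
    (hs : 1 ≤ s) (t : ℤ) (m : ℕ) : Integrable (fun ω => |psum Z t m ω| ^ s) μ := by
  refine Integrable.mono' ((integrable_finsetSum (Finset.range m)
    fun i _ => hZ.int (t + i)).const_mul ((m : ℝ) ^ (s - 1))) ?_ (ae_of_all _ fun ω => ?_)
  · exact ((hZ.measurable_psum hmeas t m).abs.pow_const s).aestronglyMeasurable
  · rw [Real.norm_eq_abs, abs_of_nonneg (Real.rpow_nonneg (abs_nonneg _) _)]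
    exact abs_psum_rpow_le hs t m ω

omit [IsProbabilityMeasure μ] in
lemma IsScore.integral_psum_rpow_le (hmeas : ∀ i, Measurable (X i)) (hZ : IsScore μ X s D Z)
    (hs : 1 ≤ s) (t : ℤ) (m : ℕ) : ∫ ω, |psum Z t m ω| ^ s ∂μ ≤ (m : ℝ) ^ s * D := by
  calc ∫ ω, |psum Z t m ω| ^ s ∂μ
      ≤ ∫ ω, (m : ℝ) ^ (s - 1) * ∑ i ∈ Finset.range m, |Z (t + i) ω| ^ s ∂μ :=
        integral_mono (hZ.integrable_psum_rpow hmeas hs t m)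
          ((integrable_finsetSum _ fun i _ => hZ.int _).const_mul _)
          fun ω => abs_psum_rpow_le hs t m ω
    _ = (m : ℝ) ^ (s - 1) * ∑ i ∈ Finset.range m, ∫ ω, |Z (t + i) ω| ^ s ∂μ := by
        rw [integral_const_mul, integral_finsetSum _ fun i _ => hZ.int _]
    _ ≤ (m : ℝ) ^ (s - 1) * ∑ i ∈ Finset.range m, D := by
        gcongr; exact hZ.bound _
    _ = (m : ℝ) ^ s * D := by
        rcases Nat.eq_zero_or_pos m with rfl | hm
        · simp [Real.zero_rpow (by linarith : s ≠ 0)]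
        · rw [Finset.sum_const, Finset.card_range, nsmul_eq_mul, ← mul_assoc,
            Real.rpow_sub_one (by positivity), div_mul_cancel₀ _ (by positivity)]

lemma IsScore.integrable_psum_pow (hmeas : ∀ i, Measurable (X i)) (hZ : IsScore μ X s D Z)
    (hs : 1 ≤ s) (t : ℤ) (m : ℕ) {j : ℕ} (hj : (j : ℝ) ≤ s) :
    Integrable (fun ω => psum Z t m ω ^ j) μ :=
  integrable_pow_of_rpow (hZ.measurable_psum hmeas t m) (hZ.integrable_psum_rpow hmeas hs t m) hj

lemma IsScore.integral_psum (hmeas : ∀ i, Measurable (X i)) (hZ : IsScore μ X s D Z)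
    (hs : 1 ≤ s) (t : ℤ) (m : ℕ) : ∫ ω, psum Z t m ω ∂μ = 0 := by
  unfold psum
  rw [integral_finsetSum]
  · simp [hZ.mean]
  · intro i _
    simpa using integrable_pow_of_rpow (j := 1) (hZ.measurable hmeas _) (hZ.int (t + i))
      (by simpa using hs)

lemma trunc_level_bounds {n g p s κ a Ca : ℝ} (hn : 0 < n) (hg : 1 ≤ g)
    (hps : p < s) (hκ : p * s / (s - p) ≤ κ) (hCa : 0 ≤ Ca) (ha : a ≤ Ca * g ^ (-κ)) :
    a * (n * g ^ (p / (s - p))) ^ p ≤ Ca * (n ^ p * g ^ (-p)) ∧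
      (n * g ^ (p / (s - p))) ^ p * (n * g ^ (p / (s - p))) ^ (-s) * n ^ s = n ^ p * g ^ (-p) := by
  have hg0 : 0 < g := by linarith
  have hsp : 0 < s - p := by linarith
  constructor
  · rw [Real.mul_rpow hn.le (by positivity), ← Real.rpow_mul hg0.le]
    calc a * (n ^ p * g ^ (p / (s - p) * p))
        ≤ Ca * g ^ (-κ) * (n ^ p * g ^ (p / (s - p) * p)) := by gcongr
      _ = Ca * (n ^ p * g ^ (-κ + p / (s - p) * p)) := by rw [Real.rpow_add hg0]; ring
      _ ≤ Ca * (n ^ p * g ^ (-p)) := by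
          have : p * s / (s - p) = p + p / (s - p) * p := by field_simp; ring
          have := Real.rpow_le_rpow_of_exponent_le hg
            (by linarith : -κ + p / (s - p) * p ≤ -p)
          gcongr
  · rw [← Real.rpow_add (by positivity), Real.mul_rpow hn.le (by positivity),
      ← Real.rpow_mul hg0.le, mul_right_comm, ← Real.rpow_add hn]
    congr 2
    · ring
    · field_simp; ring

/-- Covariance bound for powers of two partial sums separated by a gap `g`. -/
lemma IsScore.abs_cov_psum_le (hmeas : ∀ i, Measurable (X i)) {α : ℕ → ℝ}
    (hmix : MixesWith μ X α) (hZ : IsScore μ X s D Z) {j l : ℕ} (hj : 1 ≤ j) (hl : 1 ≤ l)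
    (hjl : ((j + l : ℕ) : ℝ) < s) {κ Ca : ℝ} (hCa : 0 ≤ Ca)
    (hκ : ((j + l : ℕ) : ℝ) * s / (s - ((j + l : ℕ) : ℝ)) ≤ κ)
    (hα : ∀ g : ℕ, 1 ≤ g → α g ≤ Ca * (g : ℝ) ^ (-κ)) (t : ℤ) {m₁ m₂ g n : ℕ} (hg : 1 ≤ g)
    (hn : 1 ≤ n) (hm₁ : m₁ ≤ n) (hm₂ : m₂ ≤ n) :
    |∫ ω, psum Z t m₁ ω ^ j * psum Z (t + m₁ + g) m₂ ω ^ l ∂μ -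
      (∫ ω, psum Z t m₁ ω ^ j ∂μ) * ∫ ω, psum Z (t + m₁ + g) m₂ ω ^ l ∂μ| ≤
      (4 * Ca + 4 * D) * ((n : ℝ) ^ (j + l) / (g : ℝ) ^ (j + l)) := by
  have hs1 : 1 ≤ s := by
    have : (2 : ℝ) ≤ ((j + l : ℕ) : ℝ) := by exact_mod_cast (by omega)
    linarith
  have hn0 : (0 : ℝ) < n := by exact_mod_cast hn
  have hg1 : (1 : ℝ) ≤ g := by exact_mod_cast hg
  have hg0 : (0 : ℝ) < g := by linarith
  obtain ⟨b1, b2⟩ := trunc_level_bounds hn0 hg1 hjl hκ hCa (hα g hg)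
  set T := (n : ℝ) * (g : ℝ) ^ (((j + l : ℕ) : ℝ) / (s - ((j + l : ℕ) : ℝ))) with hTdef
  have hT : 0 < T := by positivity
  have key := abs_cov_pow_le (sigmaOf_le hmeas _) (sigmaOf_le hmeas _)
    (hmix (t + m₁) g) (A := psum Z t m₁) (B := psum Z (t + m₁ + g) m₂)
    (measurable_psum_sigmaOf hZ.meas fun i hi => by simp only [Set.mem_ofPred_eq]; omega)
    (measurable_psum_sigmaOf hZ.meas fun i hi => by simp only [Set.mem_ofPred_eq]; omega)
    (hZ.integrable_psum_rpow hmeas hs1 t m₁) (hZ.integrable_psum_rpow hmeas hs1 _ m₂)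
    (j := j) (l := l) hjl.le hT
  have mom : ∀ (t : ℤ) (m : ℕ), m ≤ n → ∫ ω, |psum Z t m ω| ^ s ∂μ ≤ (n : ℝ) ^ s * D := by
    intro t m hm
    refine (hZ.integral_psum_rpow_le hmeas hs1 t m).trans ?_
    have := hZ.nonneg
    gcongr
  have i1 := mom t m₁ hm₁
  have i2 := mom (t + m₁ + g) m₂ hm₂
  rw [Real.rpow_natCast] at b1 b2
  rw [Real.rpow_natCast, Real.rpow_neg hg0.le, Real.rpow_natCast, ← div_eq_mul_inv] at b1 b2
  refine key.trans ?_
  have h3 : T ^ (j + l) * T ^ (-s) * (∫ ω, |psum Z t m₁ ω| ^ s ∂μ +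
      ∫ ω, |psum Z (t + m₁ + g) m₂ ω| ^ s ∂μ) ≤
      T ^ (j + l) * T ^ (-s) * ((n : ℝ) ^ s * D + (n : ℝ) ^ s * D) := by gcongr
  have h4 : T ^ (j + l) * T ^ (-s) * ((n : ℝ) ^ s * D + (n : ℝ) ^ s * D) =
      2 * D * (T ^ (j + l) * T ^ (-s) * (n : ℝ) ^ s) := by ring
  rw [h4, b2] at h3
  linarith

end Score

/-- Measurability of the process together with polynomially decaying mixing coefficients, at the
rate which controls moments of order up to `P` from absolute moments of order `s`. -/
structure IsRegular (μ : Measure Ω) (X : ℤ → Ω → Fin d → ℝ) (s Ca : ℝ) (P : ℕ) : Prop where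
  meas : ∀ i, Measurable (X i)
  nonneg : 0 ≤ Ca
  four_le : 4 ≤ P
  lt : (P : ℝ) < s
  mix : ∃ α, MixesWith μ X α ∧ ∀ g : ℕ, 1 ≤ g → α g ≤ Ca * (g : ℝ) ^ (-(P * s / (s - P)))

section Moments

variable {μ : Measure Ω} [IsProbabilityMeasure μ] {X : ℤ → Ω → Fin d → ℝ} {s Ca D : ℝ} {P : ℕ}
  {Z : ℤ → Ω → ℝ}

omit [IsProbabilityMeasure μ] in
lemma IsRegular.one_le (hR : IsRegular μ X s Ca P) : 1 ≤ s := by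
  have h1 := hR.lt
  have : (4 : ℝ) ≤ P := by exact_mod_cast hR.four_le
  linarith

omit [IsProbabilityMeasure μ] in
lemma IsRegular.cast_le (hR : IsRegular μ X s Ca P) {j : ℕ} (hj : j ≤ P) : (j : ℝ) ≤ s :=
  (Nat.cast_le.2 hj).trans hR.lt.le

lemma IsRegular.abs_cov_psum_le (hR : IsRegular μ X s Ca P) (hZ : IsScore μ X s D Z) {j l : ℕ}
    (hj : 1 ≤ j) (hl : 1 ≤ l) (hjl : j + l ≤ P) (t : ℤ) {m₁ m₂ g n : ℕ} (hg : 1 ≤ g)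
    (hn : 1 ≤ n) (hm₁ : m₁ ≤ n) (hm₂ : m₂ ≤ n) :
    |∫ ω, psum Z t m₁ ω ^ j * psum Z (t + m₁ + g) m₂ ω ^ l ∂μ -
      (∫ ω, psum Z t m₁ ω ^ j ∂μ) * ∫ ω, psum Z (t + m₁ + g) m₂ ω ^ l ∂μ| ≤
      (4 * Ca + 4 * D) * ((n : ℝ) ^ (j + l) / (g : ℝ) ^ (j + l)) := by
  obtain ⟨α, hα, hb⟩ := hR.mix
  have h1 : ((j + l : ℕ) : ℝ) ≤ P := Nat.cast_le.2 hjl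
  have h2 := hR.lt
  have h3 := hR.one_le
  refine hZ.abs_cov_psum_le hR.meas hα hj hl (by linarith) hR.nonneg ?_ hb t hg hn hm₁ hm₂
  gcongr

omit [MeasurableSpace Ω] in
lemma psum_one (t : ℤ) (ω : Ω) : psum Z t 1 ω = Z t ω := by simp [psum]

omit [MeasurableSpace Ω] in
lemma psum_add (t : ℤ) (m n : ℕ) (ω : Ω) :
    psum Z t (m + n) ω = psum Z t m ω + psum Z (t + m) n ω := by
  simp [psum, Finset.sum_range_add, add_assoc]

lemma IsRegular.abs_integral_mul_le (hR : IsRegular μ X s Ca P) (hZ : IsScore μ X s D Z) (t : ℤ)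
    {h : ℕ} (hh : 1 ≤ h) :
    |∫ ω, Z t ω * Z (t + h) ω ∂μ| ≤ (4 * (4 * Ca + 4 * D) + (D + 1)) * (1 / (h : ℝ) ^ 2) := by
  have hC : 0 ≤ 4 * Ca + 4 * D := by have := hR.nonneg; have := hZ.nonneg; positivity
  have hP := hR.four_le
  rcases Nat.lt_or_ge 1 h with h2 | h2
  · have := hR.abs_cov_psum_le hZ (j := 1) (l := 1) le_rfl le_rfl (by omega) t (g := h - 1) (n := 1)
      (m₁ := 1) (m₂ := 1) (by omega) le_rfl le_rfl le_rfl
    have e : t + ((1 : ℕ) : ℤ) + ((h - 1 : ℕ) : ℤ) = t + h := by omega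
    simp only [e, psum_one, pow_one, hZ.mean, zero_mul, sub_zero] at this
    have h3 : (h : ℝ) ≤ 2 * ((h - 1 : ℕ) : ℝ) := by exact_mod_cast (by omega)
    have h4 : (0 : ℝ) < ((h - 1 : ℕ) : ℝ) := by exact_mod_cast (by omega)
    have h5 : (0 : ℝ) < h := by exact_mod_cast (by omega)
    have h6 : ((1 : ℕ) : ℝ) ^ (1 + 1) / ((h - 1 : ℕ) : ℝ) ^ (1 + 1) ≤ 4 * (1 / (h : ℝ) ^ 2) := by
      rw [mul_one_div, div_le_div_iff₀ (by positivity) (by positivity)]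
      push_cast
      nlinarith
    calc _ ≤ _ := this
      _ ≤ (4 * Ca + 4 * D) * (4 * (1 / (h : ℝ) ^ 2)) := by gcongr
      _ = 4 * (4 * Ca + 4 * D) * (1 / (h : ℝ) ^ 2) := by ring
      _ ≤ _ := by gcongr; linarith [hZ.nonneg]
  · obtain rfl : h = 1 := le_antisymm h2 hh
    have m1 := hZ.measurable hR.meas
    have i1 : ∀ i, Integrable (fun ω => Z i ω ^ 2) μ := fun i =>
      integrable_pow_of_rpow (m1 i) (hZ.int i) (hR.cast_le (by omega))
    have b1 : ∀ i, ∫ ω, Z i ω ^ 2 ∂μ ≤ D + 1 := fun i => by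
      have : ∫ ω, Z i ω ^ 2 ∂μ ≤ ∫ ω, (1 + |Z i ω| ^ s) ∂μ := by
        refine integral_mono (i1 i) ((integrable_const _).add (hZ.int i)) fun ω => ?_
        have := abs_pow_le_one_add_rpow (hR.cast_le (j := 2) (by omega)) (Z i ω)
        simpa using this
      rw [integral_add (integrable_const _) (hZ.int i)] at this
      simp only [integral_const, probReal_univ, one_smul] at this
      linarith [hZ.bound i]
    have h1 := integrable_pow_mul_pow (j := 1) (l := 1) (m1 t) (m1 (t + 1)) (hZ.int t)
      (hZ.int (t + 1)) (hR.cast_le (by omega))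
    simp only [pow_one] at h1
    have h2 : |∫ ω, Z t ω * Z (t + 1) ω ∂μ| ≤ ∫ ω, (Z t ω ^ 2 + Z (t + 1) ω ^ 2) / 2 ∂μ := by
      refine norm_integral_le_of_norm_le (f := fun ω => Z t ω * Z (t + 1) ω)
        (((i1 t).add (i1 (t + 1))).div_const 2) (ae_of_all _ fun ω => ?_)
      simp only [Real.norm_eq_abs, abs_le]
      constructor <;> nlinarith [sq_nonneg (Z t ω + Z (t + 1) ω), sq_nonneg (Z t ω - Z (t + 1) ω)]
    rw [integral_div, integral_add (i1 t) (i1 (t + 1))] at h2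
    have := b1 t
    have := b1 (t + 1)
    simp only [Nat.cast_one, one_pow, div_one, mul_one]
    linarith

lemma exists_sum_one_div_sq_le : ∃ C : ℝ, 0 ≤ C ∧ ∀ m : ℕ,
    ∑ i ∈ Finset.range m, 1 / ((i + 1 : ℕ) : ℝ) ^ 2 ≤ C := by
  have h : Summable fun i : ℕ => 1 / ((i + 1 : ℕ) : ℝ) ^ 2 :=
    (summable_nat_add_iff 1).2 (Real.summable_one_div_nat_pow.2 one_lt_two)
  exact ⟨_, tsum_nonneg fun i => by positivity, fun m => h.sum_le_tsum _ fun i _ => by positivity⟩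

lemma IsRegular.exists_second_moment (hR : IsRegular μ X s Ca P) (D : ℝ) : ∃ C : ℝ, 0 ≤ C ∧
    ∀ Z, IsScore μ X s D Z → ∀ t m, ∫ ω, psum Z t m ω ^ 2 ∂μ ≤ C * m := by
  rcases lt_or_ge D 0 with hD | hD
  · exact ⟨0, le_rfl, fun Z hZ => absurd hZ.nonneg (not_le.2 hD)⟩
  obtain ⟨C, hC, hsum⟩ := exists_sum_one_div_sq_le
  have hCa := hR.nonneg
  have hP := hR.four_le
  refine ⟨2 * ((4 * (4 * Ca + 4 * D) + (D + 1)) * C) + (1 + D), by positivity,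
    fun Z hZ t m => ?_⟩
  have m1 := hZ.measurable hR.meas
  have h2s : ((2 : ℕ) : ℝ) ≤ s := hR.cast_le (by omega)
  have i1 : ∀ i, Integrable (fun ω => Z i ω ^ 2) μ := fun i =>
    integrable_pow_of_rpow (m1 i) (hZ.int i) h2s
  have b1 : ∀ i, ∫ ω, Z i ω ^ 2 ∂μ ≤ 1 + D := fun i => by
    have : ∫ ω, Z i ω ^ 2 ∂μ ≤ ∫ ω, (1 + |Z i ω| ^ s) ∂μ := by
      refine integral_mono (i1 i) ((integrable_const _).add (hZ.int i)) fun ω => ?_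
      simpa using abs_pow_le_one_add_rpow h2s (Z i ω)
    rw [integral_add (integrable_const _) (hZ.int i)] at this
    simp only [integral_const, probReal_univ, one_smul] at this
    linarith [hZ.bound i]
  have i2 : ∀ i j, Integrable (fun ω => Z i ω * Z j ω) μ := fun i j => by
    simpa using integrable_pow_mul_pow (j := 1) (l := 1) (m1 i) (m1 j) (hZ.int i)
      (hZ.int j) h2s
  induction m with
  | zero => simp [psum]
  | succ m ih =>
    have e : ∀ ω, psum Z t (m + 1) ω ^ 2 = psum Z t m ω ^ 2 +
        2 * (∑ i ∈ Finset.range m, Z (t + i) ω * Z (t + m) ω) + Z (t + m) ω ^ 2 := fun ω => by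
      rw [psum_add, psum_one, ← Finset.sum_mul]
      unfold psum
      ring
    simp only [e]
    rw [integral_add, integral_add, integral_const_mul, integral_finsetSum _ fun i _ => i2 _ _]
    · have h3 : ∑ i ∈ Finset.range m, ∫ ω, Z (t + i) ω * Z (t + m) ω ∂μ ≤
          (4 * (4 * Ca + 4 * D) + (D + 1)) * C := by
        calc _ ≤ ∑ i ∈ Finset.range m, (4 * (4 * Ca + 4 * D) + (D + 1)) *
              (1 / ((m - 1 - i + 1 : ℕ) : ℝ) ^ 2) := by
              refine Finset.sum_le_sum fun i hi => (le_abs_self _).trans ?_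
              have := Finset.mem_range.1 hi
              have := hR.abs_integral_mul_le hZ (t + i) (h := m - 1 - i + 1) (by omega)
              rwa [show t + (i : ℤ) + ((m - 1 - i + 1 : ℕ) : ℤ) = t + m by omega] at this
          _ = (4 * (4 * Ca + 4 * D) + (D + 1)) *
              ∑ i ∈ Finset.range m, 1 / ((i + 1 : ℕ) : ℝ) ^ 2 := by
              rw [← Finset.mul_sum,
                Finset.sum_range_reflect (fun i => 1 / ((i + 1 : ℕ) : ℝ) ^ 2)]
          _ ≤ _ := by gcongr; exact hsum m
      push_cast
      linarith [b1 (t + m)]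
    · exact hZ.integrable_psum_pow hR.meas hR.one_le t m h2s
    · exact (integrable_finsetSum _ fun i _ => i2 _ _).const_mul _
    · exact (hZ.integrable_psum_pow hR.meas hR.one_le t m h2s).add
        ((integrable_finsetSum _ fun i _ => i2 _ _).const_mul _)
    · exact i1 _

end Moments

lemma exists_add_pow_le (p : ℕ) : ∃ c : ℝ, 0 ≤ c ∧ ∀ x y : ℝ,
    |x + y| ^ p ≤ 3 / 2 * |x| ^ p + c * |y| ^ p := by
  have h1 : ∀ᶠ ε : ℝ in nhds 0, (1 + ε) ^ p < 3 / 2 := by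
    have : Tendsto (fun ε : ℝ => (1 + ε) ^ p) (nhds 0) (nhds ((1 + 0) ^ p)) :=
      Continuous.tendsto (by fun_prop) 0
    exact this.eventually_lt_const (by norm_num)
  obtain ⟨ε, h2, hε⟩ := ((h1.filter_mono nhdsWithin_le_nhds).and
    (self_mem_nhdsWithin : ∀ᶠ ε : ℝ in nhdsWithin 0 (Set.Ioi 0), ε ∈ Set.Ioi 0)).exists
  have hε : 0 < ε := hε
  refine ⟨(1 + 1 / ε) ^ p, by positivity, fun x y => ?_⟩
  have h3 := abs_add_le x y
  rcases le_total |y| (ε * |x|) with h | h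
  · calc |x + y| ^ p ≤ ((1 + ε) * |x|) ^ p := by gcongr; linarith
      _ = (1 + ε) ^ p * |x| ^ p := mul_pow _ _ _
      _ ≤ 3 / 2 * |x| ^ p := by gcongr
      _ ≤ _ := by have : 0 ≤ (1 + 1 / ε) ^ p * |y| ^ p := by positivity
                  linarith
  · have h4 : |x| ≤ 1 / ε * |y| := by rw [one_div, le_inv_mul_iff₀ hε]; exact h
    calc |x + y| ^ p ≤ ((1 + 1 / ε) * |y|) ^ p := by gcongr; linarith
      _ = (1 + 1 / ε) ^ p * |y| ^ p := mul_pow _ _ _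
      _ ≤ _ := by have : 0 ≤ 3 / 2 * |x| ^ p := by positivity
                  linarith

/-- The partial sums of `Z` have moments of order `2q` of the order `m ^ q` of independence. -/
def HasMoments (μ : Measure Ω) (Z : ℤ → Ω → ℝ) (q : ℕ) (C : ℝ) : Prop :=
  ∀ t m, ∫ ω, psum Z t m ω ^ (2 * q) ∂μ ≤ C * (m : ℝ) ^ q

section Moments

variable {μ : Measure Ω} [IsProbabilityMeasure μ] {X : ℤ → Ω → Fin d → ℝ} {s Ca D : ℝ} {P : ℕ}
  {Z : ℤ → Ω → ℝ}

lemma IsRegular.abs_integral_psum_pow_le (hR : IsRegular μ X s Ca P) (hZ : IsScore μ X s D Z)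
    {q : ℕ} {C : ℝ} (hq : HasMoments μ Z q C) (hC : 0 ≤ C) (hqP : 2 * q ≤ P) {j : ℕ}
    (hj : j ≤ 2 * q) (t : ℤ) {m n : ℕ} (hn : 1 ≤ n) (hmn : m ≤ n) :
    |∫ ω, psum Z t m ω ^ j ∂μ| ≤ √n ^ j * (1 + C) := by
  have hn0 : (0 : ℝ) < n := by exact_mod_cast hn
  have hi := hZ.integrable_psum_pow hR.meas hR.one_le t m (hR.cast_le hqP)
  have key : ∀ x : ℝ, |x| ^ j ≤ √n ^ j * (1 + x ^ (2 * q) / (n : ℝ) ^ q) := fun x => by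
    have h1 : |x / √n| ^ j ≤ 1 + |x / √n| ^ (2 * q) := by
      have := abs_pow_le_one_add_rpow (s := ((2 * q : ℕ) : ℝ)) (Nat.cast_le.2 hj) (x / √n)
      rwa [Real.rpow_natCast] at this
    have h2 : |x / √n| ^ (2 * q) = x ^ (2 * q) / (n : ℝ) ^ q := by
      rw [pow_mul, sq_abs, div_pow, Real.sq_sqrt hn0.le, div_pow, ← pow_mul]
    rw [h2, abs_div, abs_of_nonneg (Real.sqrt_nonneg _), div_pow,
      div_le_iff₀ (by positivity)] at h1
    linarith
  calc |∫ ω, psum Z t m ω ^ j ∂μ|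
      ≤ ∫ ω, √n ^ j * (1 + psum Z t m ω ^ (2 * q) / (n : ℝ) ^ q) ∂μ := by
        refine norm_integral_le_of_norm_le (f := fun ω => psum Z t m ω ^ j)
          (((integrable_const _).add (hi.div_const _)).const_mul _) (ae_of_all _ fun ω => ?_)
        rw [Real.norm_eq_abs, abs_pow]
        exact key _
    _ = √n ^ j * (1 + (∫ ω, psum Z t m ω ^ (2 * q) ∂μ) / (n : ℝ) ^ q) := by
        rw [integral_const_mul, integral_add (integrable_const _) (hi.div_const _), integral_div]
        simp
    _ ≤ √n ^ j * (1 + C) := by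
        have : (∫ ω, psum Z t m ω ^ (2 * q) ∂μ) / (n : ℝ) ^ q ≤ C := by
          rw [div_le_iff₀ (by positivity)]
          refine (hq t m).trans ?_
          gcongr
        gcongr

lemma four_mul_sqrt_sq {n : ℕ} (hn : 1 ≤ n) : n ≤ 4 * n.sqrt ^ 2 := by
  have h1 := Nat.sqrt_le_add n
  have h2 : 1 ≤ n.sqrt := Nat.sqrt_pos.2 hn
  nlinarith

/-- Moment of the sum of two halves separated by a gap. -/
lemma IsRegular.exists_two_block (hR : IsRegular μ X s Ca P) {q : ℕ} (hq : 1 ≤ q)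
    (hqP : 2 * (q + 1) ≤ P) {C : ℝ} (hC : 0 ≤ C) (hD : 0 ≤ D) : ∃ C₂ : ℝ, 0 ≤ C₂ ∧
    ∀ Z, IsScore μ X s D Z → HasMoments μ Z q C → ∀ t n m, 1 ≤ n → m ≤ n →
      ∫ ω, (psum Z t (n / 2) ω + psum Z (t + (n / 2 : ℕ) + n.sqrt) m ω) ^ (2 * (q + 1)) ∂μ ≤
        ∫ ω, psum Z t (n / 2) ω ^ (2 * (q + 1)) ∂μ +
        ∫ ω, psum Z (t + (n / 2 : ℕ) + n.sqrt) m ω ^ (2 * (q + 1)) ∂μ + C₂ * (n : ℝ) ^ (q + 1) := by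
  have hCa := hR.nonneg
  set p := 2 * (q + 1) with hp
  set E := (1 + C) * (1 + C) + (4 * Ca + 4 * D) * 4 ^ (q + 1) with hE
  have hE0 : 0 ≤ E := by positivity
  refine ⟨∑ j ∈ Finset.Ico 1 p, E * (p.choose j : ℝ), by positivity, fun Z hZ hM t n m hn hm => ?_⟩
  set A := psum Z t (n / 2)
  set B := psum Z (t + (n / 2 : ℕ) + n.sqrt) m
  have mA : Measurable A := hZ.measurable_psum hR.meas _ _
  have mB : Measurable B := hZ.measurable_psum hR.meas _ _
  have iA := hZ.integrable_psum_rpow hR.meas hR.one_le t (n / 2)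
  have iB := hZ.integrable_psum_rpow hR.meas hR.one_le (t + (n / 2 : ℕ) + n.sqrt) m
  have hi : ∀ j ≤ p, Integrable (fun ω => A ω ^ j * B ω ^ (p - j)) μ := fun j hj =>
    integrable_pow_mul_pow mA mB iA iB (hR.cast_le (by omega))
  have hg : 1 ≤ n.sqrt := Nat.sqrt_pos.2 hn
  have hn0 : (0 : ℝ) < n := by exact_mod_cast hn
  have hg0 : (0 : ℝ) < n.sqrt := by exact_mod_cast hg
  have mid : ∀ j ∈ Finset.Ico 1 p, ∫ ω, A ω ^ j * B ω ^ (p - j) ∂μ ≤ E * (n : ℝ) ^ (q + 1) := by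
    intro j hj
    rw [Finset.mem_Ico] at hj
    have h1 := hR.abs_cov_psum_le hZ hj.1 (l := p - j) (by omega) (by omega) t (g := n.sqrt)
      (m₁ := n / 2) (m₂ := m) hg hn (by omega) hm
    have h2 : |(∫ ω, A ω ^ j ∂μ) * ∫ ω, B ω ^ (p - j) ∂μ| ≤
        (1 + C) * (1 + C) * (n : ℝ) ^ (q + 1) := by
      have e0 : ∀ t m, ∫ ω, psum Z t m ω ∂μ = 0 := hZ.integral_psum hR.meas hR.one_le
      by_cases c1 : j = 1
      · have : ∫ ω, A ω ^ j ∂μ = 0 := by simp only [c1, pow_one]; exact e0 _ _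
        rw [this, zero_mul, abs_zero]; positivity
      by_cases c2 : p - j = 1
      · have : ∫ ω, B ω ^ (p - j) ∂μ = 0 := by simp only [c2, pow_one]; exact e0 _ _
        rw [this, mul_zero, abs_zero]; positivity
      rw [abs_mul]
      calc _ ≤ (√n ^ j * (1 + C)) * (√n ^ (p - j) * (1 + C)) := by
            gcongr
            · exact hR.abs_integral_psum_pow_le hZ hM hC (by omega) (by omega) _ hn (by omega)
            · exact hR.abs_integral_psum_pow_le hZ hM hC (by omega) (by omega) _ hn hm
        _ = (1 + C) * (1 + C) * √n ^ (j + (p - j)) := by rw [pow_add]; ring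
        _ = _ := by
            rw [show j + (p - j) = 2 * (q + 1) by omega, pow_mul, Real.sq_sqrt hn0.le]
    have h3 : (n : ℝ) ^ (j + (p - j)) / (n.sqrt : ℝ) ^ (j + (p - j)) ≤
        4 ^ (q + 1) * (n : ℝ) ^ (q + 1) := by
      rw [show j + (p - j) = 2 * (q + 1) by omega, div_le_iff₀ (by positivity), pow_mul, pow_mul,
        ← mul_pow, ← mul_pow]
      gcongr
      have : (n : ℝ) ≤ 4 * (n.sqrt : ℝ) ^ 2 := by exact_mod_cast four_mul_sqrt_sq hn
      nlinarith
    have h4 : (4 * Ca + 4 * D) * ((n : ℝ) ^ (j + (p - j)) / (n.sqrt : ℝ) ^ (j + (p - j))) ≤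
        (4 * Ca + 4 * D) * (4 ^ (q + 1) * (n : ℝ) ^ (q + 1)) := by gcongr
    have h5 := (abs_le.1 (h1.trans h4)).2
    have h6 := (abs_le.1 h2).2
    rw [hE, add_mul]
    linarith
  have exp : ∀ ω, (A ω + B ω) ^ p = A ω ^ p + B ω ^ p +
      ∑ j ∈ Finset.Ico 1 p, A ω ^ j * B ω ^ (p - j) * (p.choose j : ℝ) := fun ω => by
    rw [add_pow, Finset.sum_range_succ, Finset.range_eq_Ico,
      Finset.sum_eq_sum_Ico_succ_bot (by omega : 0 < p)]
    simp
    ring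
  simp only [exp]
  rw [integral_add, integral_add, integral_finsetSum]
  · have : ∑ j ∈ Finset.Ico 1 p, ∫ ω, A ω ^ j * B ω ^ (p - j) * (p.choose j : ℝ) ∂μ ≤
        ∑ j ∈ Finset.Ico 1 p, E * (n : ℝ) ^ (q + 1) * (p.choose j : ℝ) := by
      refine Finset.sum_le_sum fun j hj => ?_
      rw [integral_mul_const]
      gcongr
      exact mid j hj
    rw [Finset.sum_mul]
    simp only [mul_right_comm E] at this ⊢
    linarith
  · exact fun j hj => (hi j (Finset.mem_Ico.1 hj).2.le).mul_const _
  · simpa using hi p le_rfl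
  · simpa using hi 0 (by omega)
  · exact (by simpa using hi p le_rfl : Integrable (fun ω => A ω ^ p) μ).add
      (by simpa using hi 0 (by omega) : Integrable (fun ω => B ω ^ p) μ)
  · exact integrable_finsetSum _ fun j hj => (hi j (Finset.mem_Ico.1 hj).2.le).mul_const _

end Moments

section Moments

variable {μ : Measure Ω} [IsProbabilityMeasure μ] {X : ℤ → Ω → Fin d → ℝ} {s Ca D : ℝ} {P : ℕ}
  {Z : ℤ → Ω → ℝ}

lemma IsRegular.exists_moments_succ (hR : IsRegular μ X s Ca P) {q : ℕ} (hq : 1 ≤ q)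
    (hqP : 2 * (q + 1) ≤ P) {C : ℝ} (hC : 0 ≤ C) (hD : 0 ≤ D) : ∃ K : ℝ, 0 ≤ K ∧
    ∀ Z, IsScore μ X s D Z → HasMoments μ Z q C → HasMoments μ Z (q + 1) K := by
  obtain ⟨C₂, hC₂, h₂⟩ := hR.exists_two_block hq hqP hC hD
  obtain ⟨c, hc, hadd⟩ := exists_add_pow_le (2 * (q + 1))
  set K := 4 * (3 / 2 * C₂ + c * (1 + D)) with hK
  have hK0 : 0 ≤ K := by positivity
  refine ⟨K, hK0, fun Z hZ hM => ?_⟩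
  have int : ∀ t m, Integrable (fun ω => psum Z t m ω ^ (2 * (q + 1))) μ := fun t m =>
    hZ.integrable_psum_pow hR.meas hR.one_le t m (hR.cast_le hqP)
  have evn : Even (2 * (q + 1)) := even_two_mul _
  intro t n
  induction n using Nat.strong_induction_on generalizing t with
  | _ n ih =>
  rcases Nat.eq_zero_or_pos n with rfl | hn
  · simp [psum]
  have hg : 1 ≤ n.sqrt := Nat.sqrt_pos.2 hn
  have hg2 : n.sqrt * n.sqrt ≤ n := Nat.sqrt_le n
  have hgn : n.sqrt ≤ n - n / 2 := by
    rcases Nat.lt_or_ge n.sqrt 2 with h | h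
    · omega
    · have : 2 * n.sqrt ≤ n.sqrt * n.sqrt := Nat.mul_le_mul_right _ h
      omega
  set m := n - n / 2 - n.sqrt with hm
  have hm2 : m ≤ n / 2 := by omega
  have hn0 : (0 : ℝ) < n := by exact_mod_cast hn
  have hg0 : (0 : ℝ) < n.sqrt := by exact_mod_cast hg
  set A := psum Z t (n / 2)
  set G := psum Z (t + (n / 2 : ℕ)) n.sqrt
  set B := psum Z (t + (n / 2 : ℕ) + n.sqrt) m
  have hS : ∀ ω, psum Z t n ω = A ω + B ω + G ω := fun ω => by
    have : n = n / 2 + (n.sqrt + m) := by omega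
    conv_lhs => rw [this, psum_add, psum_add]
    ring
  have half : ∀ m' ≤ n / 2, K * (m' : ℝ) ^ (q + 1) ≤ K * (n : ℝ) ^ (q + 1) / 4 := by
    intro m' hm'
    have h1 : (m' : ℝ) ≤ n / 2 := by
      rw [le_div_iff₀ two_pos]; exact_mod_cast (by omega : m' * 2 ≤ n)
    calc K * (m' : ℝ) ^ (q + 1) ≤ K * ((n : ℝ) / 2) ^ (q + 1) := by gcongr
      _ = K * (n : ℝ) ^ (q + 1) / 2 ^ (q + 1) := by rw [div_pow]; ring
      _ ≤ K * (n : ℝ) ^ (q + 1) / 2 ^ 2 := by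
          gcongr
          · norm_num
          · omega
      _ = _ := by norm_num
  have hA := (ih (n / 2) (by omega) t).trans (half _ le_rfl)
  have hB := (ih m (by omega) (t + (n / 2 : ℕ) + n.sqrt)).trans (half _ hm2)
  have hAB := h₂ Z hZ hM t n m hn (by omega)
  have hG : ∫ ω, G ω ^ (2 * (q + 1)) ∂μ ≤ (1 + D) * (n : ℝ) ^ (q + 1) := by
    have mom := hZ.integral_psum_rpow_le hR.meas hR.one_le (t + (n / 2 : ℕ)) n.sqrt
    have ir := hZ.integrable_psum_rpow hR.meas hR.one_le (t + (n / 2 : ℕ)) n.sqrt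
    have pt : ∀ x : ℝ, x ^ (2 * (q + 1)) ≤
        (n : ℝ) ^ (q + 1) * (1 + |x| ^ s / (n.sqrt : ℝ) ^ s) := fun x => by
      have h1 := abs_pow_le_one_add_rpow (hR.cast_le hqP) (x / n.sqrt)
      rw [abs_div, abs_of_pos hg0, div_pow, evn.pow_abs, Real.div_rpow (abs_nonneg x) hg0.le,
        div_le_iff₀ (by positivity)] at h1
      refine h1.trans ?_
      rw [mul_comm]
      gcongr
      rw [pow_mul]
      gcongr
      exact_mod_cast (sq n.sqrt).trans_le hg2
    calc ∫ ω, G ω ^ (2 * (q + 1)) ∂μ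
        ≤ ∫ ω, (n : ℝ) ^ (q + 1) * (1 + |G ω| ^ s / (n.sqrt : ℝ) ^ s) ∂μ :=
          integral_mono (int _ _) (((integrable_const _).add (ir.div_const _)).const_mul _)
            fun ω => pt _
      _ = (n : ℝ) ^ (q + 1) * (1 + (∫ ω, |G ω| ^ s ∂μ) / (n.sqrt : ℝ) ^ s) := by
          rw [integral_const_mul, integral_add (integrable_const _) (ir.div_const _), integral_div]
          simp only [integral_const, probReal_univ, one_smul, G]
      _ ≤ (n : ℝ) ^ (q + 1) * (1 + D) := by
          have : (∫ ω, |G ω| ^ s ∂μ) / (n.sqrt : ℝ) ^ s ≤ D := by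
            rw [div_le_iff₀ (by positivity), mul_comm]; exact mom
          gcongr
      _ = _ := mul_comm _ _
  have iAB : Integrable (fun ω => (A ω + B ω) ^ (2 * (q + 1))) μ := by
    have hAB' : ∀ ω, A ω + B ω = psum Z t n ω - G ω := fun ω => by rw [hS]; ring
    refine Integrable.mono' ((((int t n).const_mul (3 / 2)).add
      ((int (t + (n / 2 : ℕ)) n.sqrt).const_mul c))) ?_ (ae_of_all _ fun ω => ?_)
    · exact (((hZ.measurable_psum hR.meas _ _).add
        (hZ.measurable_psum hR.meas _ _)).pow_const _).aestronglyMeasurable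
    · have := hadd (psum Z t n ω) (-G ω)
      rw [Real.norm_eq_abs, abs_pow, hAB', sub_eq_add_neg]
      rwa [abs_neg, evn.pow_abs (psum Z t n ω), evn.pow_abs (G ω)] at this
  calc ∫ ω, psum Z t n ω ^ (2 * (q + 1)) ∂μ
      ≤ ∫ ω, (3 / 2 * (A ω + B ω) ^ (2 * (q + 1)) + c * G ω ^ (2 * (q + 1))) ∂μ := by
        refine integral_mono (int t n) ((iAB.const_mul _).add ((int _ _).const_mul c)) fun ω => ?_
        have := hadd (A ω + B ω) (G ω)
        simp only [evn.pow_abs] at this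
        simp only [hS]
        exact this
    _ = 3 / 2 * ∫ ω, (A ω + B ω) ^ (2 * (q + 1)) ∂μ + c * ∫ ω, G ω ^ (2 * (q + 1)) ∂μ := by
        rw [integral_add (iAB.const_mul _) ((int _ _).const_mul c), integral_const_mul,
          integral_const_mul]
    _ ≤ 3 / 2 * (K * (n : ℝ) ^ (q + 1) / 4 + K * (n : ℝ) ^ (q + 1) / 4 + C₂ * (n : ℝ) ^ (q + 1)) +
        c * ((1 + D) * (n : ℝ) ^ (q + 1)) := by gcongr; linarith
    _ = K * (n : ℝ) ^ (q + 1) := by rw [hK]; ring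

/-- Moments of even order of partial sums are of the same order as under independence. -/
theorem IsRegular.exists_moments (hR : IsRegular μ X s Ca P) (hD : 0 ≤ D) {q : ℕ} (hq : 1 ≤ q)
    (hqP : 2 * q ≤ P) : ∃ C : ℝ, 0 ≤ C ∧ ∀ Z, IsScore μ X s D Z → HasMoments μ Z q C := by
  induction q, hq using Nat.le_induction with
  | base =>
    obtain ⟨C, hC, h⟩ := hR.exists_second_moment D
    exact ⟨C, hC, fun Z hZ t m => by simpa using h Z hZ t m⟩
  | succ q hq ih =>
    obtain ⟨C, hC, h⟩ := ih (by omega)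
    obtain ⟨K, hK, h'⟩ := hR.exists_moments_succ hq hqP hC hD
    exact ⟨K, hK, fun Z hZ => h' Z hZ (h Z hZ)⟩

end Moments

section Averages

variable {α β ι : Type*} [Fintype α] [Fintype β] [Fintype ι]

/-- Average of a function over a finite type. -/
def avg (F : α → ℝ) : ℝ := (∑ a, F a) / Fintype.card α

lemma avg_add (F G : α → ℝ) : avg (fun a => F a + G a) = avg F + avg G := by
  simp [avg, Finset.sum_add_distrib, add_div]

lemma avg_sub (F G : α → ℝ) : avg (fun a => F a - G a) = avg F - avg G := by
  simp [avg, Finset.sum_sub_distrib, sub_div]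

lemma avg_const_mul (c : ℝ) (F : α → ℝ) : avg (fun a => c * F a) = c * avg F := by
  simp [avg, ← Finset.mul_sum, mul_div_assoc]

lemma avg_mul_const (F : α → ℝ) (c : ℝ) : avg (fun a => F a * c) = avg F * c := by
  simp only [mul_comm _ c, avg_const_mul]

lemma avg_div_const (F : α → ℝ) (c : ℝ) : avg (fun a => F a / c) = avg F / c := by
  simp only [div_eq_mul_inv, avg_mul_const]

lemma avg_finsetSum {κ : Type*} (s : Finset κ) (F : κ → α → ℝ) :
    avg (fun a => ∑ j ∈ s, F j a) = ∑ j ∈ s, avg (F j) := by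
  simp only [avg]
  rw [Finset.sum_comm, Finset.sum_div]

@[simp] lemma avg_const [Nonempty α] (c : ℝ) : avg (fun _ : α => c) = c := by
  simp [avg]

lemma avg_mono {F G : α → ℝ} (h : ∀ a, F a ≤ G a) : avg F ≤ avg G := by
  unfold avg
  gcongr
  exact h _

lemma avg_nonneg {F : α → ℝ} (h : ∀ a, 0 ≤ F a) : 0 ≤ avg F :=
  div_nonneg (Finset.sum_nonneg fun a _ => h a) (Nat.cast_nonneg _)

lemma abs_avg_le (F : α → ℝ) : |avg F| ≤ avg fun a => |F a| := by
  unfold avg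
  rw [abs_div, Nat.abs_cast]
  gcongr
  exact Finset.abs_sum_le_sum_abs _ _

lemma avg_pow_le_avg_pow [Nonempty α] (F : α → ℝ) {p : ℕ} (hp : Even p) :
    avg F ^ p ≤ avg fun a => F a ^ p := by
  have hc : (0 : ℝ) < Fintype.card α := by exact_mod_cast Fintype.card_pos
  have := hp.convexOn_pow (𝕜 := ℝ) |>.map_sum_le (t := Finset.univ)
    (w := fun _ : α => (Fintype.card α : ℝ)⁻¹) (p := F) (fun _ _ => by positivity)
    (by simp [hc.ne']) (fun _ _ => Set.mem_univ _)
  simp only [smul_eq_mul, ← Finset.mul_sum] at this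
  unfold avg
  rwa [div_eq_inv_mul, div_eq_inv_mul]

lemma avg_sq_le [Nonempty α] (F : α → ℝ) : avg F ^ 2 ≤ avg fun a => F a ^ 2 :=
  avg_pow_le_avg_pow F even_two

lemma avg_sq_sq_le [Nonempty α] (F : α → ℝ) :
    avg (fun a => F a ^ 2) ^ 2 ≤ avg fun a => F a ^ 4 := by
  have h := avg_sq_le fun a => F a ^ 2
  have e : ∀ a, (F a ^ 2) ^ 2 = F a ^ 4 := fun a => by ring
  rwa [funext e] at h

/-- Covariance under the uniform distribution. -/
def acov (F G : α → ℝ) : ℝ := avg (fun a => F a * G a) - avg F * avg G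

lemma acov_comm (F G : α → ℝ) : acov F G = acov G F := by simp only [acov, mul_comm]

lemma acov_add_left (F₁ F₂ G : α → ℝ) :
    acov (fun a => F₁ a + F₂ a) G = acov F₁ G + acov F₂ G := by
  simp only [acov, add_mul, avg_add]; ring

lemma acov_const_mul_left (c : ℝ) (F G : α → ℝ) : acov (fun a => c * F a) G = c * acov F G := by
  simp only [acov, mul_assoc, avg_const_mul]; ring

lemma acov_add_right (F G₁ G₂ : α → ℝ) :
    acov F (fun a => G₁ a + G₂ a) = acov F G₁ + acov F G₂ := by
  simp only [acov, mul_add, avg_add]; ring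

lemma acov_const_mul_right (c : ℝ) (F G : α → ℝ) : acov F (fun a => c * G a) = c * acov F G := by
  simp only [acov, mul_left_comm _ c, avg_const_mul]; ring

lemma acov_finsetSum_right {κ : Type*} (s : Finset κ) (F : α → ℝ) (G : κ → α → ℝ) :
    acov F (fun a => ∑ j ∈ s, G j a) = ∑ j ∈ s, acov F (G j) := by
  simp only [acov, Finset.mul_sum, avg_finsetSum, Finset.sum_sub_distrib]

lemma acov_self_le (F : α → ℝ) : acov F F ≤ avg fun a => F a ^ 2 := by
  simp only [acov, ← sq]
  linarith [sq_nonneg (avg F)]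

lemma acov_self_nonneg [Nonempty α] (F : α → ℝ) : 0 ≤ acov F F := by
  simp only [acov, ← sq]
  linarith [avg_sq_le F]

lemma two_mul_abs_acov_le [Nonempty α] (F G : α → ℝ) {t : ℝ} (ht : 0 < t) :
    2 * |acov F G| ≤ t⁻¹ * acov F F + t * acov G G := by
  have h : ∀ c : ℝ, 0 ≤ acov F F + 2 * c * acov F G + c ^ 2 * acov G G := fun c => by
    have h1 := acov_self_nonneg fun a => F a + c * G a
    simp only [acov_add_left, acov_const_mul_left, acov_add_right, acov_const_mul_right] at h1
    rw [acov_comm G F] at h1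
    linarith
  have h1 := mul_nonneg (inv_nonneg.2 ht.le) (h t)
  have h2 := mul_nonneg (inv_nonneg.2 ht.le) (h (-t))
  have e1 : t⁻¹ * (acov F F + 2 * t * acov F G + t ^ 2 * acov G G) =
      t⁻¹ * acov F F + 2 * acov F G + t * acov G G := by field_simp
  have e2 : t⁻¹ * (acov F F + 2 * -t * acov F G + (-t) ^ 2 * acov G G) =
      t⁻¹ * acov F F - 2 * acov F G + t * acov G G := by field_simp; ring
  rw [e1] at h1
  rw [e2] at h2
  rcases abs_cases (acov F G) with ⟨h, _⟩ | ⟨h, _⟩ <;> rw [h] <;> linarith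

lemma acov_const_add_self [Nonempty α] (c : ℝ) (F : α → ℝ) :
    acov (fun a => c + F a) (fun a => c + F a) = acov F F := by
  have e : ∀ a, (c + F a) * (c + F a) = c * c + 2 * c * F a + F a * F a := fun a => by ring
  simp only [acov, e, avg_add, avg_const, avg_const_mul]
  ring

/-- Variance of a second-order expansion under the uniform distribution: the terms involving the
remainder, and the variance of the quadratic part, are negligible. -/
lemma sq_acov_expansion_le [Nonempty α] (c : ℝ) (L Q R : α → ℝ) {m n : ℝ} (hm : 0 ≤ m)
    (hmn : m ≤ n) (hn : 1 ≤ n) :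
    (m * (acov (fun a => c + (L a + Q a + R a)) (fun a => c + (L a + Q a + R a)) -
      acov L L - 2 * acov L Q)) ^ 2 ≤ 3 * (avg (fun a => L a ^ 4) +
        4 * n ^ 2 * avg (fun a => Q a ^ 4) + 9 * n ^ 4 * avg (fun a => R a ^ 4)) := by
  have hn0 : 0 < n := by linarith
  rw [acov_const_add_self]
  have e : acov (fun a => L a + Q a + R a) (fun a => L a + Q a + R a) - acov L L - 2 * acov L Q =
      2 * acov L R + acov Q Q + 2 * acov Q R + acov R R := by
    simp only [acov_add_left, acov_add_right, acov_comm R L, acov_comm R Q, acov_comm Q L]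
    ring
  rw [e]
  have h1 := two_mul_abs_acov_le L R hn0
  have h2 := two_mul_abs_acov_le Q R one_pos
  have hLL := acov_self_le L
  have hQQ := acov_self_le Q
  have hRR := acov_self_le R
  have pL := acov_self_nonneg L
  have pQ := acov_self_nonneg Q
  have pR := acov_self_nonneg R
  set l := avg fun a => L a ^ 2
  set q := avg fun a => Q a ^ 2
  set r := avg fun a => R a ^ 2
  have hl : l ^ 2 ≤ avg fun a => L a ^ 4 := avg_sq_sq_le L
  have hq : q ^ 2 ≤ avg fun a => Q a ^ 4 := avg_sq_sq_le Q
  have hr : r ^ 2 ≤ avg fun a => R a ^ 4 := avg_sq_sq_le R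
  have pl : 0 ≤ l := pL.trans hLL
  have pq : 0 ≤ q := pQ.trans hQQ
  have pr : 0 ≤ r := pR.trans hRR
  have h3 : |2 * acov L R + acov Q Q + 2 * acov Q R + acov R R| ≤ n⁻¹ * l + 2 * q + 3 * n * r := by
    have b1 : n⁻¹ * acov L L ≤ n⁻¹ * l := by gcongr
    have b2 : n * acov R R ≤ n * r := by gcongr
    have b3 : r ≤ n * r := le_mul_of_one_le_left pr hn
    have c1 := abs_le.1 (le_refl |acov L R|)
    have c2 := abs_le.1 (le_refl |acov Q R|)
    rw [abs_le]
    constructor <;> linarith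
  have h4 : |m * (2 * acov L R + acov Q Q + 2 * acov Q R + acov R R)| ≤
      l + 2 * n * q + 3 * n ^ 2 * r := by
    rw [abs_mul, abs_of_nonneg hm]
    calc _ ≤ n * (n⁻¹ * l + 2 * q + 3 * n * r) := by gcongr
      _ = _ := by field_simp
  have h5 := pow_le_pow_left₀ (abs_nonneg _) h4 2
  rw [sq_abs] at h5
  have h6 : 4 * n ^ 2 * q ^ 2 ≤ 4 * n ^ 2 * avg fun a => Q a ^ 4 := by gcongr
  have h7 : 9 * n ^ 4 * r ^ 2 ≤ 9 * n ^ 4 * avg fun a => R a ^ 4 := by gcongr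
  nlinarith [sq_nonneg (l - 2 * n * q), sq_nonneg (l - 3 * n ^ 2 * r),
    sq_nonneg (2 * n * q - 3 * n ^ 2 * r)]

lemma sq_mul_acov_le [Nonempty α] (L Q : α → ℝ) {m n : ℝ} (hm : 0 ≤ m)
    (hmn : m ≤ n) (hn : 0 < n) :
    (m * acov L Q) ^ 2 ≤ n * avg (fun a => L a ^ 4) + n ^ 3 * avg (fun a => Q a ^ 4) := by
  have h1 := two_mul_abs_acov_le L Q (Real.sqrt_pos.2 hn)
  have hLL := acov_self_le L
  have hQQ := acov_self_le Q
  have pL := acov_self_nonneg L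
  have pQ := acov_self_nonneg Q
  set l := avg fun a => L a ^ 2
  set q := avg fun a => Q a ^ 2
  have hl : l ^ 2 ≤ avg fun a => L a ^ 4 := avg_sq_sq_le L
  have hq : q ^ 2 ≤ avg fun a => Q a ^ 4 := avg_sq_sq_le Q
  have hs : 0 < √n := Real.sqrt_pos.2 hn
  have h2 : 2 * |acov L Q| ≤ (√n)⁻¹ * l + √n * q := by
    refine h1.trans ?_
    gcongr
  have h3 : |m * acov L Q| ≤ n * (((√n)⁻¹ * l + √n * q) / 2) := by
    rw [abs_mul, abs_of_nonneg hm]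
    gcongr
    linarith
  have h4 := pow_le_pow_left₀ (abs_nonneg _) h3 2
  rw [sq_abs] at h4
  have e1 : ((√n)⁻¹ * l) ^ 2 = n⁻¹ * l ^ 2 := by
    rw [mul_pow, inv_pow, Real.sq_sqrt hn.le]
  have e2 : (√n * q) ^ 2 = n * q ^ 2 := by rw [mul_pow, Real.sq_sqrt hn.le]
  have h5 : ((√n)⁻¹ * l + √n * q) ^ 2 ≤ 2 * (n⁻¹ * l ^ 2 + n * q ^ 2) := by
    nlinarith [sq_nonneg ((√n)⁻¹ * l - √n * q)]
  calc _ ≤ _ := h4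
    _ = n ^ 2 / 4 * ((√n)⁻¹ * l + √n * q) ^ 2 := by ring
    _ ≤ n ^ 2 / 4 * (2 * (n⁻¹ * l ^ 2 + n * q ^ 2)) := by gcongr
    _ = (n * l ^ 2 + n ^ 3 * q ^ 2) / 2 := by field_simp; ring
    _ ≤ n * l ^ 2 + n ^ 3 * q ^ 2 := half_le_self (by positivity)
    _ ≤ _ := by gcongr

end Averages

lemma abs_pow_mul_abs_pow_le {j k m : ℕ} (h : j ≤ m) (x y : ℝ) :
    |x| ^ j * |y| ^ (k + (m - j)) ≤ |x| ^ m * |y| ^ k + |y| ^ (m + k) := by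
  rcases le_total |y| |x| with hxy | hxy
  · calc |x| ^ j * |y| ^ (k + (m - j)) = |x| ^ j * |y| ^ (m - j) * |y| ^ k := by ring
      _ ≤ |x| ^ j * |x| ^ (m - j) * |y| ^ k := by gcongr
      _ = |x| ^ m * |y| ^ k := by rw [← pow_add, Nat.add_sub_cancel' h]
      _ ≤ _ := le_add_of_nonneg_right (by positivity)
  · calc |x| ^ j * |y| ^ (k + (m - j)) ≤ |y| ^ j * |y| ^ (k + (m - j)) := by gcongr
      _ = |y| ^ (m + k) := by rw [← pow_add]; congr 1; omega
      _ ≤ _ := le_add_of_nonneg_left (by positivity)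

lemma add_pow_even_le (q : ℕ) (x y : ℝ) : (x + y) ^ (2 * q + 2) ≤
    x ^ (2 * q + 2) + (2 * q + 2) * (x ^ (2 * q + 1) * y) +
      2 ^ (2 * q + 2) * (x ^ (2 * q) * y ^ 2 + y ^ (2 * q + 2)) := by
  have e1 : |x| ^ (2 * q) = x ^ (2 * q) := (even_two_mul q).pow_abs x
  have e2 : |y| ^ (2 * q + 2) = y ^ (2 * q + 2) := (even_two_mul (q + 1)).pow_abs y
  have h1 : ∑ j ∈ Finset.range (2 * q + 1), x ^ j * y ^ (2 * q + 2 - j) *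
      ((2 * q + 2).choose j : ℝ) ≤ ∑ j ∈ Finset.range (2 * q + 1),
      (x ^ (2 * q) * y ^ 2 + y ^ (2 * q + 2)) * ((2 * q + 2).choose j : ℝ) := by
    refine Finset.sum_le_sum fun j hj => ?_
    have hj := Finset.mem_range.1 hj
    gcongr
    refine (le_abs_self _).trans ?_
    rw [abs_mul, abs_pow, abs_pow, show 2 * q + 2 - j = 2 + (2 * q - j) by omega]
    refine (abs_pow_mul_abs_pow_le (by omega) x y).trans ?_
    rw [e1, e2, sq_abs]
  have h2 : ∑ j ∈ Finset.range (2 * q + 1), ((2 * q + 2).choose j : ℝ) ≤ 2 ^ (2 * q + 2) := by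
    have := Nat.sum_range_choose (2 * q + 2)
    have h3 : ∑ j ∈ Finset.range (2 * q + 1), (2 * q + 2).choose j ≤ 2 ^ (2 * q + 2) := by
      rw [← this]
      exact Finset.sum_le_sum_of_subset (Finset.range_mono (by omega))
    exact_mod_cast h3
  have h3 : 0 ≤ x ^ (2 * q) * y ^ 2 + y ^ (2 * q + 2) := by
    rw [← e1, ← e2]; positivity
  rw [← Finset.mul_sum] at h1
  have h4 := mul_le_mul_of_nonneg_left h2 h3
  rw [add_pow, Finset.sum_range_succ, Finset.sum_range_succ]
  simp only [Nat.sub_self, pow_zero, mul_one, Nat.choose_self, Nat.cast_one]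
  rw [show 2 * q + 2 - (2 * q + 1) = 1 by omega, Nat.choose_succ_self_right (2 * q + 1)]
  push_cast
  linarith

section Resampling

variable {ι : Type*} [Fintype ι] [Nonempty ι]

/-- Average of the values of `u` at a tuple of resampled indices. -/
def resMean (u : ι → ℝ) {b : ℕ} (f : Fin b → ι) : ℝ := (∑ a, u (f a)) / b

omit [Nonempty ι] in
lemma avg_tuple_succ {b : ℕ} (F : (Fin (b + 1) → ι) → ℝ) :
    avg F = avg fun i => avg fun f : Fin b → ι => F (Fin.cons i f) := by
  have h := (Fin.consEquiv (fun _ : Fin (b + 1) => ι)).sum_comp F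
  simp only [avg, ← Finset.sum_div]
  rw [← h, Fintype.sum_prod_type, div_div]
  congr 1
  simp [pow_succ]

lemma avg_sum_tuple {v : ι → ℝ} (hv : avg v = 0) (b : ℕ) :
    avg (fun f : Fin b → ι => ∑ a, v (f a)) = 0 := by
  induction b with
  | zero => simp [avg]
  | succ b ih =>
    rw [avg_tuple_succ]
    simp [Fin.sum_univ_succ, avg_add, ih, hv]

lemma avg_sum_mul_sum_tuple {v w : ι → ℝ} (hv : avg v = 0) (hw : avg w = 0) (b : ℕ) :
    avg (fun f : Fin b → ι => (∑ a, v (f a)) * ∑ a, w (f a)) = b * avg fun i => v i * w i := by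
  induction b with
  | zero => simp [avg]
  | succ b ih =>
    rw [avg_tuple_succ]
    simp only [Fin.sum_univ_succ, Fin.cons_zero, Fin.cons_succ, add_mul, mul_add, avg_add, ih,
      avg_const_mul, avg_mul_const, avg_sum_tuple hv, avg_sum_tuple hw, avg_const]
    push_cast
    ring

lemma avg_sum_mul_sum_mul_sum_tuple {v w z : ι → ℝ} (hv : avg v = 0) (hw : avg w = 0)
    (hz : avg z = 0) (b : ℕ) :
    avg (fun f : Fin b → ι => (∑ a, v (f a)) * (∑ a, w (f a)) * ∑ a, z (f a)) =
      b * avg fun i => v i * w i * z i := by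
  induction b with
  | zero => simp [avg]
  | succ b ih =>
    rw [avg_tuple_succ]
    simp only [Fin.sum_univ_succ, Fin.cons_zero, Fin.cons_succ]
    have e : ∀ (i : ι) (f : Fin b → ι), (v i + ∑ a, v (f a)) * (w i + ∑ a, w (f a)) *
        (z i + ∑ a, z (f a)) = v i * w i * z i + v i * w i * (∑ a, z (f a)) +
        v i * z i * (∑ a, w (f a)) + w i * z i * (∑ a, v (f a)) +
        v i * ((∑ a, w (f a)) * ∑ a, z (f a)) + w i * ((∑ a, v (f a)) * ∑ a, z (f a)) +
        z i * ((∑ a, v (f a)) * ∑ a, w (f a)) +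
        (∑ a, v (f a)) * (∑ a, w (f a)) * ∑ a, z (f a) := fun i f => by ring
    simp only [e, avg_add, ih, avg_const_mul, avg_mul_const, avg_sum_tuple hv, avg_sum_tuple hw,
      avg_sum_tuple hz, avg_const, avg_sum_mul_sum_tuple hv hw, avg_sum_mul_sum_tuple hv hz,
      avg_sum_mul_sum_tuple hw hz, hv, hw, hz]
    push_cast
    ring

lemma exists_avg_sum_tuple_pow_le (q : ℕ) : ∃ C : ℝ, 0 ≤ C ∧
    ∀ {ι : Type} [Fintype ι] [Nonempty ι] (v : ι → ℝ), avg v = 0 → ∀ b : ℕ,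
      avg (fun f : Fin b → ι => (∑ a, v (f a)) ^ (2 * q)) ≤
        C * (b : ℝ) ^ q * avg fun i => v i ^ (2 * q) := by
  induction q with
  | zero => exact ⟨1, zero_le_one, fun v _ b => by simp⟩
  | succ q ih =>
    obtain ⟨C, hC, h⟩ := ih
    set K := 2 ^ (2 * q + 2) * (2 * C + 1) with hK
    refine ⟨K, by positivity, fun {ι} _ _ v hv b => ?_⟩
    have evn : Even (2 * q + 2) := even_two_mul (q + 1)
    set M := avg fun i => v i ^ (2 * (q + 1)) with hM
    have hM0 : 0 ≤ M := avg_nonneg fun i => evn.pow_nonneg _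
    induction b with
    | zero => simp [avg]
    | succ b ihb =>
      have hcross : avg (fun i => v i ^ (2 * q)) * avg (fun i => v i ^ 2) ≤ 2 * M := by
        have h1 : avg (fun i => avg fun j => v i ^ (2 * q) * v j ^ 2) ≤
            avg fun i => avg fun j => v i ^ (2 * (q + 1)) + v j ^ (2 * (q + 1)) := by
          refine avg_mono fun i => avg_mono fun j => ?_
          have e1 : |v i| ^ (2 * q) = v i ^ (2 * q) := (even_two_mul q).pow_abs _
          rcases le_total |v j| |v i| with hij | hij
          · calc v i ^ (2 * q) * v j ^ 2 = |v i| ^ (2 * q) * |v j| ^ 2 := by rw [e1, sq_abs]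
              _ ≤ |v i| ^ (2 * q) * |v i| ^ 2 := by gcongr
              _ = v i ^ (2 * (q + 1)) := by rw [← pow_add]; exact evn.pow_abs _
              _ ≤ _ := le_add_of_nonneg_right (evn.pow_nonneg _)
          · calc v i ^ (2 * q) * v j ^ 2 = |v i| ^ (2 * q) * |v j| ^ 2 := by rw [e1, sq_abs]
              _ ≤ |v j| ^ (2 * q) * |v j| ^ 2 := by gcongr
              _ = v j ^ (2 * (q + 1)) := by rw [← pow_add]; exact evn.pow_abs _
              _ ≤ _ := le_add_of_nonneg_left (evn.pow_nonneg _)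
        simp only [avg_const_mul, avg_mul_const, avg_add, avg_const, ← hM] at h1
        linarith
      rw [avg_tuple_succ]
      have h1 : (avg fun i => avg fun f : Fin b → ι =>
          (∑ a, v ((Fin.cons i f : Fin (b + 1) → ι) a)) ^ (2 * (q + 1))) ≤
          avg fun i => avg fun f : Fin b → ι => (∑ a, v (f a)) ^ (2 * (q + 1)) +
            (2 * q + 2) * ((∑ a, v (f a)) ^ (2 * q + 1) * v i) +
            2 ^ (2 * q + 2) * ((∑ a, v (f a)) ^ (2 * q) * v i ^ 2 + v i ^ (2 * (q + 1))) := by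
        refine avg_mono fun i => avg_mono fun f => ?_
        simp only [Fin.sum_univ_succ, Fin.cons_zero, Fin.cons_succ]
        rw [add_comm]
        exact add_pow_even_le q _ _
      refine h1.trans ?_
      simp only [avg_add, avg_const_mul, avg_mul_const, avg_const, hv, ← hM]
      set A := avg fun i => v i ^ (2 * q)
      set A₂ := avg fun i => v i ^ 2
      have h2 : avg (fun f : Fin b → ι => (∑ a, v (f a)) ^ (2 * q)) * A₂ ≤
          C * (b : ℝ) ^ q * (2 * M) := by
        calc _ ≤ C * (b : ℝ) ^ q * A * A₂ := by
              gcongr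
              · exact avg_nonneg fun i => sq_nonneg _
              · exact h v hv b
          _ = C * (b : ℝ) ^ q * (A * A₂) := by ring
          _ ≤ _ := by gcongr
      have h3 : (b : ℝ) ^ q ≤ ((b : ℝ) + 1) ^ q := by gcongr; linarith
      have h4 : (1 : ℝ) ≤ ((b : ℝ) + 1) ^ q :=
        one_le_pow₀ (by linarith [Nat.cast_nonneg (α := ℝ) b])
      have h5 : C * (b : ℝ) ^ q * (2 * M) + M ≤ (2 * C + 1) * (((b : ℝ) + 1) ^ q * M) := by
        have := mul_le_mul_of_nonneg_left h3 (by positivity : 0 ≤ C * (2 * M))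
        have := mul_le_mul_of_nonneg_right h4 hM0
        linarith
      have h6 : (b : ℝ) ^ (q + 1) + ((b : ℝ) + 1) ^ q ≤ ((b : ℝ) + 1) ^ (q + 1) := by
        rw [pow_succ, pow_succ]
        have := mul_le_mul_of_nonneg_right h3 (Nat.cast_nonneg (α := ℝ) b)
        linarith
      have h7 := mul_le_mul_of_nonneg_left h6 (by positivity : 0 ≤ K * M)
      have hA := mul_le_mul_of_nonneg_left h2 (by positivity : (0 : ℝ) ≤ 2 ^ (2 * q + 2))
      have h8 := mul_le_mul_of_nonneg_left h5 (by positivity : (0 : ℝ) ≤ 2 ^ (2 * q + 2))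
      push_cast
      rw [hK] at h7 ihb ⊢
      linarith

omit [Nonempty ι] in
/-- Decomposition of a resampled mean into the overall mean and a centred part. -/
lemma resMean_eq (u : ι → ℝ) {b : ℕ} (hb : 0 < b) (f : Fin b → ι) :
    resMean u f = avg u + (∑ a, (u (f a) - avg u)) / b := by
  have hb : (b : ℝ) ≠ 0 := by positivity
  simp only [resMean, Finset.sum_sub_distrib, Finset.sum_const, Finset.card_univ,
    Fintype.card_fin, nsmul_eq_mul]
  field_simp
  ring

lemma avg_centred (u : ι → ℝ) : avg (fun i => u i - avg u) = 0 := by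
  rw [avg_sub, avg_const, sub_self]

lemma avg_centred_mul (u v : ι → ℝ) : avg (fun i => (u i - avg u) * (v i - avg v)) = acov u v := by
  have e : ∀ i, (u i - avg u) * (v i - avg v) =
      u i * v i - avg v * u i - avg u * v i + avg u * avg v := fun i => by ring
  simp only [e, avg_add, avg_sub, avg_const_mul, avg_const, acov]
  ring

lemma avg_resMean (u : ι → ℝ) {b : ℕ} (hb : 0 < b) :
    avg (fun f : Fin b → ι => resMean u f) = avg u := by
  simp only [resMean_eq u hb, avg_add, avg_const, avg_div_const, avg_sum_tuple (avg_centred u),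
    zero_div, add_zero]

lemma acov_resMean (u v : ι → ℝ) {b : ℕ} (hb : 0 < b) :
    acov (fun f : Fin b → ι => resMean u f) (fun f => resMean v f) = acov u v / b := by
  have hb' : (b : ℝ) ≠ 0 := by positivity
  have h := avg_sum_mul_sum_tuple (avg_centred u) (avg_centred v) b
  have e : ∀ f : Fin b → ι, resMean u f * resMean v f = avg u * avg v +
      avg u * ((∑ a, (v (f a) - avg v)) / b) + avg v * ((∑ a, (u (f a) - avg u)) / b) +
      (∑ a, (u (f a) - avg u)) * (∑ a, (v (f a) - avg v)) / b ^ 2 := fun f => by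
    rw [resMean_eq u hb, resMean_eq v hb]; field_simp; ring
  rw [acov, avg_resMean u hb, avg_resMean v hb]
  simp only [e, avg_add, avg_const, avg_const_mul, avg_div_const, h,
    avg_sum_tuple (avg_centred u), avg_sum_tuple (avg_centred v), avg_centred_mul]
  field_simp
  ring

/-- Covariance of a resampled mean with a product of two resampled means. -/
lemma acov_resMean_mul (y x z : ι → ℝ) {b : ℕ} (hb : 0 < b) :
    acov (fun f : Fin b → ι => resMean y f) (fun f => resMean x f * resMean z f) =
      (avg x * acov y z + avg z * acov y x) / b +
        avg (fun i => (y i - avg y) * (x i - avg x) * (z i - avg z)) / b ^ 2 := by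
  have hb' : (b : ℝ) ≠ 0 := by positivity
  set Y := fun f : Fin b → ι => ∑ a, (y (f a) - avg y) with hY
  set X := fun f : Fin b → ι => ∑ a, (x (f a) - avg x) with hX
  set Z := fun f : Fin b → ι => ∑ a, (z (f a) - avg z) with hZ
  have hYX : avg (fun f => Y f * X f) = b * acov y x := by
    rw [← avg_centred_mul, avg_sum_mul_sum_tuple (avg_centred y) (avg_centred x)]
  have hYZ : avg (fun f => Y f * Z f) = b * acov y z := by
    rw [← avg_centred_mul, avg_sum_mul_sum_tuple (avg_centred y) (avg_centred z)]
  have h3 : avg (fun f => Y f * X f * Z f) =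
      b * avg fun i => (y i - avg y) * (x i - avg x) * (z i - avg z) :=
    avg_sum_mul_sum_mul_sum_tuple (avg_centred y) (avg_centred x) (avg_centred z) b
  have h0 : avg Y = 0 := avg_sum_tuple (avg_centred y) b
  have hy : ∀ f : Fin b → ι, resMean y f = avg y + Y f / b := resMean_eq y hb
  have e : ∀ f : Fin b → ι, resMean y f * (resMean x f * resMean z f) =
      avg y * (resMean x f * resMean z f) + (avg x * avg z / b) * Y f +
        avg x / b ^ 2 * (Y f * Z f) + avg z / b ^ 2 * (Y f * X f) +
        1 / b ^ 3 * (Y f * X f * Z f) := fun f => by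
    rw [resMean_eq x hb, resMean_eq z hb, hy]; field_simp; ring
  rw [acov, avg_resMean y hb]
  simp only [e, avg_add, avg_const_mul, hYX, hYZ, h3, h0]
  field_simp
  ring

end Resampling

lemma exists_avg_resMean_pow_le (q : ℕ) : ∃ C : ℝ, 0 ≤ C ∧
    ∀ {ι : Type} [Fintype ι] [Nonempty ι] (u : ι → ℝ) (b : ℕ), 0 < b →
      avg (fun f : Fin b → ι => resMean u f ^ (2 * q)) ≤
        C * (avg u ^ (2 * q) + avg (fun i => u i ^ (2 * q)) / (b : ℝ) ^ q) := by
  obtain ⟨C, hC, h⟩ := exists_avg_sum_tuple_pow_le q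
  set c : ℝ := 2 ^ (2 * q) with hc
  have evn : Even (2 * q) := even_two_mul q
  have two : ∀ x y : ℝ, (x + y) ^ (2 * q) ≤ c * (x ^ (2 * q) + y ^ (2 * q)) := fun x y => by
    have h1 : |x + y| ≤ 2 * max |x| |y| := by
      have := abs_add_le x y
      have := le_max_left |x| |y|
      have := le_max_right |x| |y|
      linarith
    have h2 := pow_le_pow_left₀ (abs_nonneg _) h1 (2 * q)
    rw [evn.pow_abs, mul_pow] at h2
    refine h2.trans ?_
    gcongr
    rcases max_choice |x| |y| with hm | hm <;> rw [hm, evn.pow_abs]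
    · exact le_add_of_nonneg_right (evn.pow_nonneg _)
    · exact le_add_of_nonneg_left (evn.pow_nonneg _)
  refine ⟨c * (1 + C * (2 * c)), by positivity, fun {ι} _ _ u b hb => ?_⟩
  have hb0 : (0 : ℝ) < b := by exact_mod_cast hb
  set m := avg u with hm
  set M := avg fun i => u i ^ (2 * q) with hM
  have hmM : m ^ (2 * q) ≤ M := avg_pow_le_avg_pow u evn
  have h1 : avg (fun i => (u i - m) ^ (2 * q)) ≤ 2 * c * M := by
    calc _ ≤ avg fun i => c * (u i ^ (2 * q) + (-m) ^ (2 * q)) :=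
          avg_mono fun i => by rw [sub_eq_add_neg]; exact two _ _
      _ = c * (M + m ^ (2 * q)) := by
          rw [avg_const_mul, avg_add, avg_const, evn.neg_pow]
      _ ≤ c * (M + M) := by gcongr
      _ = 2 * c * M := by ring
  have h2 := h (fun i => u i - m) (avg_centred u) b
  calc avg (fun f : Fin b → ι => resMean u f ^ (2 * q))
      ≤ avg fun f : Fin b → ι => c * (m ^ (2 * q) + ((∑ a, (u (f a) - m)) / b) ^ (2 * q)) :=
        avg_mono fun f => by rw [resMean_eq u hb]; exact two _ _
    _ = c * (m ^ (2 * q) + avg (fun f : Fin b → ι => (∑ a, (u (f a) - m)) ^ (2 * q)) /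
          (b : ℝ) ^ (2 * q)) := by
        simp only [div_pow, avg_const_mul, avg_add, avg_const, avg_div_const]
    _ ≤ c * (m ^ (2 * q) + C * (b : ℝ) ^ q * (2 * c * M) / (b : ℝ) ^ (2 * q)) := by
        gcongr
        exact h2.trans (by gcongr)
    _ = c * (m ^ (2 * q) + C * (2 * c) * (M / (b : ℝ) ^ q)) := by
        have e : (b : ℝ) ^ (2 * q) = (b : ℝ) ^ q * (b : ℝ) ^ q := by rw [two_mul, pow_add]
        rw [e]
        field_simp
    _ ≤ c * (1 + C * (2 * c)) * (m ^ (2 * q) + M / (b : ℝ) ^ q) := by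
        have hM0 : 0 ≤ M / (b : ℝ) ^ q :=
          div_nonneg (avg_nonneg fun i => evn.pow_nonneg _) (by positivity)
        have hm0 : 0 ≤ m ^ (2 * q) := evn.pow_nonneg _
        have hc0 : 0 ≤ c := by positivity
        nlinarith [mul_nonneg hc0 hM0, mul_nonneg (mul_nonneg hc0 hC) (mul_nonneg hc0 hm0)]

lemma exists_sum_mul_eq_iteratedFDeriv_two (H : (Fin d → ℝ) → ℝ) (x : Fin d → ℝ) :
    ∃ β : Fin d → Fin d → ℝ, ∀ w : Fin d → ℝ,
      iteratedFDeriv ℝ 2 H x (fun _ => w) = ∑ j, ∑ l, β j l * (w j * w l) := by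
  refine ⟨fun j l => fderiv ℝ (fderiv ℝ H) x (Pi.single j 1) (Pi.single l 1), fun w => ?_⟩
  rw [iteratedFDeriv_two_apply]
  conv_lhs => rw [← Finset.univ_sum_single w]
  have e : ∀ j, (Pi.single j (w j) : Fin d → ℝ) = w j • Pi.single j 1 := fun j => by
    ext i; simp [Pi.single_apply]
  simp only [e, map_sum, map_smul, sum_apply, smul_apply,
    smul_eq_mul]
  rw [Finset.sum_comm]
  refine Finset.sum_congr rfl fun j _ => ?_
  simp only [Finset.mul_sum]
  refine Finset.sum_congr rfl fun l _ => ?_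
  ring

/-- Second-order Taylor expansion of `H` with a remainder of polynomial growth. -/
lemma CondD.exists_taylor {H : (Fin d → ℝ) → ℝ} {a₀ : ℕ} (hD : CondD H a₀) (x : Fin d → ℝ) :
    ∃ (β : Fin d → Fin d → ℝ) (C : ℝ), 0 ≤ C ∧ ∀ w : Fin d → ℝ,
      |H (x + w) - H x - fderiv ℝ H x w - ∑ j, ∑ l, β j l * (w j * w l)| ≤
        C * (‖w‖ ^ 3 + ‖w‖ ^ (3 + a₀)) := by
  obtain ⟨hH, C, hC, hbound⟩ := hD
  obtain ⟨β, hβ⟩ := exists_sum_mul_eq_iteratedFDeriv_two H x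
  refine ⟨fun j l => β j l / 2, C * (1 + 2 ^ a₀ * (‖x‖ ^ a₀ + 1)), by positivity, fun w => ?_⟩
  have ht := map_add_eq_sum_add_integral_iteratedFDeriv (n := 2) (f := H) (x := x) (y := w)
    fun t _ => by norm_num; exact hH.contDiffAt
  simp only [Finset.sum_range_succ, Finset.sum_range_zero, zero_add, Nat.factorial,
    iteratedFDeriv_zero_apply, iteratedFDeriv_one_apply, hβ, smul_eq_mul] at ht
  have hI : |∫ t in (0 : ℝ)..1, (1 - t) ^ 2 * iteratedFDeriv ℝ 3 H (x + t • w) fun _ => w| ≤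
      C * (1 + 2 ^ a₀ * (‖x‖ ^ a₀ + ‖w‖ ^ a₀)) * ‖w‖ ^ 3 := by
    have := intervalIntegral.norm_integral_le_of_norm_le_const (a := (0 : ℝ)) (b := 1)
      (f := fun t => (1 - t) ^ 2 * iteratedFDeriv ℝ 3 H (x + t • w) fun _ => w)
      (C := C * (1 + 2 ^ a₀ * (‖x‖ ^ a₀ + ‖w‖ ^ a₀)) * ‖w‖ ^ 3) fun t ht => ?_
    · simpa using this
    rw [Set.uIoc_of_le zero_le_one] at ht
    have h1 : ‖iteratedFDeriv ℝ 3 H (x + t • w) fun _ => w‖ ≤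
        ‖iteratedFDeriv ℝ 3 H (x + t • w)‖ * ‖w‖ ^ 3 := by
      simpa using (iteratedFDeriv ℝ 3 H (x + t • w)).le_opNorm fun _ => w
    have h2 : ‖x + t • w‖ ≤ ‖x‖ + ‖w‖ := by
      refine (norm_add_le _ _).trans ?_
      rw [norm_smul, Real.norm_eq_abs, abs_of_nonneg ht.1.le]
      have := mul_le_of_le_one_left (norm_nonneg w) ht.2
      linarith
    have h3 : ‖x + t • w‖ ^ a₀ ≤ 2 ^ a₀ * (‖x‖ ^ a₀ + ‖w‖ ^ a₀) := by
      calc ‖x + t • w‖ ^ a₀ ≤ (2 * max ‖x‖ ‖w‖) ^ a₀ := by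
            have := le_max_left ‖x‖ ‖w‖
            have := le_max_right ‖x‖ ‖w‖
            gcongr
            linarith
        _ = 2 ^ a₀ * max ‖x‖ ‖w‖ ^ a₀ := mul_pow _ _ _
        _ ≤ _ := by
            gcongr
            rcases max_choice ‖x‖ ‖w‖ with h | h <;> rw [h]
            · exact le_add_of_nonneg_right (by positivity)
            · exact le_add_of_nonneg_left (by positivity)
    have h4 : (1 - t) ^ 2 ≤ 1 := by nlinarith [ht.1, ht.2]
    rw [norm_mul, Real.norm_eq_abs, abs_of_nonneg (sq_nonneg _)]
    calc _ ≤ 1 * (‖iteratedFDeriv ℝ 3 H (x + t • w)‖ * ‖w‖ ^ 3) := by gcongr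
      _ ≤ 1 * (C * (1 + ‖x + t • w‖ ^ a₀) * ‖w‖ ^ 3) := by gcongr; exact hbound _
      _ ≤ _ := by rw [one_mul]; gcongr
  have e : H (x + w) - H x - fderiv ℝ H x w - ∑ j, ∑ l, β j l / 2 * (w j * w l) =
      2⁻¹ * ∫ t in (0 : ℝ)..1, (1 - t) ^ 2 * iteratedFDeriv ℝ 3 H (x + t • w) fun _ => w := by
    have e2 : ∑ j, ∑ l, β j l / 2 * (w j * w l) = 2⁻¹ * ∑ j, ∑ l, β j l * (w j * w l) := by
      simp only [Finset.mul_sum]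
      exact Finset.sum_congr rfl fun j _ => Finset.sum_congr rfl fun l _ => by ring
    rw [ht, e2]
    norm_num
    ring
  rw [e, abs_mul, abs_of_pos (by norm_num : (0 : ℝ) < 2⁻¹)]
  have hw : 0 ≤ ‖w‖ ^ 3 := by positivity
  calc _ ≤ 1 * (C * (1 + 2 ^ a₀ * (‖x‖ ^ a₀ + ‖w‖ ^ a₀)) * ‖w‖ ^ 3) := by gcongr; norm_num
    _ = C * (1 + 2 ^ a₀ * ‖x‖ ^ a₀) * ‖w‖ ^ 3 + C * 2 ^ a₀ * ‖w‖ ^ (3 + a₀) := by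
        rw [pow_add]; ring
    _ ≤ C * (1 + 2 ^ a₀ * (‖x‖ ^ a₀ + 1)) * ‖w‖ ^ 3 +
        C * (1 + 2 ^ a₀ * (‖x‖ ^ a₀ + 1)) * ‖w‖ ^ (3 + a₀) := by
        have : (2 : ℝ) ^ a₀ ≤ 1 + 2 ^ a₀ * (‖x‖ ^ a₀ + 1) := by
          have : 0 ≤ (2 : ℝ) ^ a₀ * ‖x‖ ^ a₀ := by positivity
          linarith
        gcongr
        linarith
    _ = _ := by ring

lemma sum_comp_le_sum_of_injOn {s t : Finset ℕ} {φ : ℕ → ℝ} (hφ : ∀ m, 0 ≤ φ m) {f : ℕ → ℕ}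
    (hf : Set.InjOn f s) (hst : ∀ i ∈ s, f i ∈ t) : ∑ i ∈ s, φ (f i) ≤ ∑ m ∈ t, φ m := by
  rw [← Finset.sum_image (f := φ) hf]
  exact Finset.sum_le_sum_of_subset_of_nonneg (Finset.image_subset_iff.2 hst) fun m _ _ => hφ m

lemma sum_sum_dist_le {φ : ℕ → ℝ} (hφ : ∀ m, 0 ≤ φ m) (N : ℕ) :
    ∑ i ∈ Finset.range N, ∑ j ∈ Finset.range N, φ (Nat.dist i j) ≤
      2 * N * ∑ m ∈ Finset.range N, φ m := by
  have h : ∀ i ∈ Finset.range N,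
      ∑ j ∈ Finset.range N, φ (Nat.dist i j) ≤ 2 * ∑ m ∈ Finset.range N, φ m := by
    intro i hi
    rw [← Finset.sum_filter_add_sum_filter_not _ (fun j => j ≤ i), two_mul]
    simp only [Finset.mem_range] at hi
    refine add_le_add (sum_comp_le_sum_of_injOn hφ ?_ ?_) (sum_comp_le_sum_of_injOn hφ ?_ ?_)
    · intro a ha b hb hab
      simp only [Finset.coe_filter, Finset.mem_range, Set.mem_ofPred_eq] at ha hb
      simp only [Nat.dist] at hab
      omega
    · intro a ha
      simp only [Finset.mem_filter, Finset.mem_range, Nat.dist] at ha ⊢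
      omega
    · intro a ha b hb hab
      simp only [Finset.coe_filter, Finset.mem_range, Set.mem_ofPred_eq] at ha hb
      simp only [Nat.dist] at hab
      omega
    · intro a ha
      simp only [Finset.mem_filter, Finset.mem_range, Nat.dist] at ha ⊢
      omega
  refine (Finset.sum_le_sum h).trans ?_
  rw [Finset.sum_const, Finset.card_range, nsmul_eq_mul]
  linarith

/-- Covariance envelope for functionals of blocks of length `k` whose starts are `m` apart. -/
def blockDecay (k m : ℕ) : ℝ := if m < k then 1 else 1 / ((m - k + 1 : ℕ) : ℝ) ^ 2

lemma blockDecay_nonneg (k m : ℕ) : 0 ≤ blockDecay k m := by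
  unfold blockDecay; split_ifs <;> positivity

lemma exists_sum_blockDecay_le :
    ∃ C : ℝ, 0 ≤ C ∧ ∀ N k : ℕ, 1 ≤ k → ∑ m ∈ Finset.range N, blockDecay k m ≤ C * k := by
  obtain ⟨C, hC, h⟩ := exists_sum_one_div_sq_le
  refine ⟨1 + C, by linarith, fun N k hk => ?_⟩
  have hk' : (1 : ℝ) ≤ k := by exact_mod_cast hk
  rw [← Finset.sum_filter_add_sum_filter_not _ (fun m => m < k), add_mul, one_mul]
  refine add_le_add ?_ ((?_ : _ ≤ C).trans (le_mul_of_one_le_right hC hk'))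
  · rw [Finset.sum_congr rfl (g := fun _ => (1 : ℝ))
      fun m hm => by simp [blockDecay, (Finset.mem_filter.1 hm).2]]
    rw [Finset.sum_const, nsmul_eq_mul, mul_one]
    refine Nat.cast_le.2 ((Finset.card_le_card (t := Finset.range k) fun m hm => ?_).trans_eq
      (Finset.card_range k))
    simpa using (Finset.mem_filter.1 hm).2
  · rw [Finset.sum_congr rfl (g := fun m => 1 / ((m - k + 1 : ℕ) : ℝ) ^ 2)
      fun m hm => by simp [blockDecay, (Finset.mem_filter.1 hm).2]]
    refine le_trans (sum_comp_le_sum_of_injOn (t := Finset.range N)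
      (φ := fun j => 1 / ((j + 1 : ℕ) : ℝ) ^ 2) (fun j => by positivity) (f := fun m => m - k)
      ?_ ?_) (h N)
    · intro a ha b hb hab
      simp only [Finset.coe_filter, Finset.mem_range, Set.mem_ofPred_eq] at ha hb hab
      omega
    · intro a ha
      simp only [Finset.mem_filter, Finset.mem_range] at ha ⊢
      omega

section BlockCov

variable {μ : Measure Ω} [IsProbabilityMeasure μ] {X : ℤ → Ω → Fin d → ℝ} {s Ca : ℝ} {P : ℕ}

lemma integral_sq_le_one_add {A : Ω → ℝ} (hA : Measurable A)
    (hA4 : Integrable (fun ω => A ω ^ 4) μ) {C : ℝ} (hC : ∫ ω, A ω ^ 4 ∂μ ≤ C) :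
    Integrable (fun ω => A ω ^ 2) μ ∧ ∫ ω, A ω ^ 2 ∂μ ≤ 1 + C := by
  have hint : Integrable (fun ω => 1 + A ω ^ 4) μ := (integrable_const 1).add hA4
  have hle : ∀ ω, A ω ^ 2 ≤ 1 + A ω ^ 4 := fun ω => by nlinarith [sq_nonneg (A ω ^ 2 - 1)]
  have hA2 : Integrable (fun ω => A ω ^ 2) μ := hint.mono' (by fun_prop)
    (ae_of_all _ fun ω => by rw [Real.norm_eq_abs, abs_of_nonneg (sq_nonneg _)]; exact hle ω)
  refine ⟨hA2, (integral_mono hA2 hint hle).trans ?_⟩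
  rw [integral_add (integrable_const 1) hA4]
  simpa using hC

lemma abs_cov_le_of_fourth {A B : Ω → ℝ} (hA : Measurable A) (hB : Measurable B)
    (hA4 : Integrable (fun ω => A ω ^ 4) μ) (hB4 : Integrable (fun ω => B ω ^ 4) μ) {C : ℝ}
    (hAC : ∫ ω, A ω ^ 4 ∂μ ≤ C) (hBC : ∫ ω, B ω ^ 4 ∂μ ≤ C) :
    |∫ ω, A ω * B ω ∂μ - (∫ ω, A ω ∂μ) * ∫ ω, B ω ∂μ| ≤ 2 * (1 + C) := by
  obtain ⟨hA2, hA2'⟩ := integral_sq_le_one_add hA hA4 hAC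
  obtain ⟨hB2, hB2'⟩ := integral_sq_le_one_add hB hB4 hBC
  have h1 : |∫ ω, A ω * B ω ∂μ| ≤ 1 + C := by
    have hi : Integrable (fun ω => (A ω ^ 2 + B ω ^ 2) / 2) μ := (hA2.add hB2).div_const 2
    rw [← Real.norm_eq_abs]
    refine (norm_integral_le_of_norm_le hi (ae_of_all _ fun ω => ?_)).trans ?_
    · rw [Real.norm_eq_abs, abs_le]
      constructor <;> nlinarith [sq_nonneg (A ω - B ω), sq_nonneg (A ω + B ω)]
    · rw [integral_div, integral_add hA2 hB2]; linarith
  have hsq : ∀ {F : Ω → ℝ}, Measurable F → Integrable (fun ω => F ω ^ 2) μ →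
      (∫ ω, F ω ∂μ) ^ 2 ≤ ∫ ω, F ω ^ 2 ∂μ := fun {F} hF hF2 => by
    have hv := variance_nonneg F μ
    rw [variance_eq_sub ((memLp_two_iff_integrable_sq hF.aestronglyMeasurable).2 hF2)] at hv
    simp only [Pi.pow_apply] at hv
    linarith
  have hA1 := hsq hA hA2
  have hB1 := hsq hB hB2
  have h2 : |(∫ ω, A ω ∂μ) * ∫ ω, B ω ∂μ| ≤ 1 + C := by
    rw [abs_le]
    constructor <;> nlinarith [sq_nonneg ((∫ ω, A ω ∂μ) - ∫ ω, B ω ∂μ),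
      sq_nonneg ((∫ ω, A ω ∂μ) + ∫ ω, B ω ∂μ)]
  exact (abs_sub _ _).trans (by linarith)

lemma IsRegular.abs_cov_le_of_gap (hR : IsRegular μ X s Ca P) {t u : ℤ} {g : ℕ} (hg : 1 ≤ g)
    (hu : u = t + g) {A B : Ω → ℝ} (hA : Measurable[sigmaOf X {i | i ≤ t}] A)
    (hB : Measurable[sigmaOf X {i | u ≤ i}] B)
    (hA4 : Integrable (fun ω => A ω ^ 4) μ) (hB4 : Integrable (fun ω => B ω ^ 4) μ) {C : ℝ}
    (hAC : ∫ ω, A ω ^ 4 ∂μ ≤ C) (hBC : ∫ ω, B ω ^ 4 ∂μ ≤ C) :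
    |∫ ω, A ω * B ω ∂μ - (∫ ω, A ω ∂μ) * ∫ ω, B ω ∂μ| ≤
      4 * (Ca + C) * (1 / (g : ℝ) ^ 2) := by
  obtain ⟨α, hmix, hα⟩ := hR.mix
  subst hu
  have hg' : (1 : ℝ) ≤ g := by exact_mod_cast hg
  have hg0 : (0 : ℝ) < g := by linarith
  have e4 : ∀ x : ℝ, |x| ^ (4 : ℝ) = x ^ 4 := fun x => by
    rw [show (4 : ℝ) = ((4 : ℕ) : ℝ) by norm_num, Real.rpow_natCast]; exact Even.pow_abs ⟨2, rfl⟩ x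
  have key := abs_cov_pow_le (sigmaOf_le hR.meas _) (sigmaOf_le hR.meas _)
    (hmix t g) (s := 4) hA hB (by simpa only [e4] using hA4) (by simpa only [e4] using hB4)
    (j := 1) (l := 1) (by norm_num) hg0
  simp only [pow_one, e4] at key
  have hP : (4 : ℝ) ≤ P := by exact_mod_cast hR.four_le
  have hs := hR.lt
  have hκ : (4 : ℝ) ≤ P * s / (s - P) := by
    rw [le_div_iff₀ (by linarith)]; nlinarith
  have hαg : α g ≤ Ca * ((g : ℝ) ^ 4)⁻¹ := by
    refine (hα g hg).trans (mul_le_mul_of_nonneg_left ?_ hR.nonneg)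
    rw [← Real.rpow_natCast, ← Real.rpow_neg hg0.le]
    exact Real.rpow_le_rpow_of_exponent_le hg' (by push_cast; linarith)
  have hT : (g : ℝ) ^ (-(4 : ℝ)) = ((g : ℝ) ^ 4)⁻¹ := by
    rw [Real.rpow_neg hg0.le, show (4 : ℝ) = ((4 : ℕ) : ℝ) by norm_num, Real.rpow_natCast]
  rw [hT] at key
  refine key.trans ?_
  have e : (g : ℝ) ^ (1 + 1) * ((g : ℝ) ^ 4)⁻¹ = 1 / (g : ℝ) ^ 2 := by field_simp
  rw [e]
  have h1 : 4 * α g * (g : ℝ) ^ (1 + 1) ≤ 4 * Ca * (1 / (g : ℝ) ^ 2) := by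
    rw [← e]
    nlinarith [mul_le_mul_of_nonneg_right hαg (show (0 : ℝ) ≤ (g : ℝ) ^ (1 + 1) by positivity)]
  have h2 : 1 / (g : ℝ) ^ 2 * (∫ ω, A ω ^ 4 ∂μ + ∫ ω, B ω ^ 4 ∂μ) ≤
      1 / (g : ℝ) ^ 2 * (C + C) :=
    mul_le_mul_of_nonneg_left (add_le_add hAC hBC) (by positivity)
  linarith

/-- Covariances of functionals of overlapping blocks of length `k`, summed over all pairs of
blocks, are of order `N * k`. -/
lemma IsRegular.exists_abs_sum_sum_cov_le (hR : IsRegular μ X s Ca P) {C : ℝ} (hC : 0 ≤ C) :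
    ∃ K : ℝ, 0 ≤ K ∧ ∀ (k N : ℕ) (ξ η : ℕ → Ω → ℝ), 1 ≤ k →
      (∀ i : ℕ, Measurable[sigmaOf X {j | (i : ℤ) + 1 ≤ j ∧ j ≤ i + k}] (ξ i)) →
      (∀ i : ℕ, Measurable[sigmaOf X {j | (i : ℤ) + 1 ≤ j ∧ j ≤ i + k}] (η i)) →
      (∀ i, Integrable (fun ω => ξ i ω ^ 4) μ) → (∀ i, Integrable (fun ω => η i ω ^ 4) μ) →
      (∀ i, ∫ ω, ξ i ω ^ 4 ∂μ ≤ C) → (∀ i, ∫ ω, η i ω ^ 4 ∂μ ≤ C) →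
      |∑ i ∈ Finset.range N, ∑ j ∈ Finset.range N,
        (∫ ω, ξ i ω * η j ω ∂μ - (∫ ω, ξ i ω ∂μ) * ∫ ω, η j ω ∂μ)| ≤ K * (N * k) := by
  obtain ⟨S, hS, hsum⟩ := exists_sum_blockDecay_le
  have hCa := hR.nonneg
  refine ⟨(2 + 4 * (Ca + C)) * (2 * S), by positivity,
    fun k N ξ η hk hξ hη hξ4 hη4 hξC hηC => ?_⟩
  have hle := fun i : ℕ => sigmaOf_le hR.meas {j | (i : ℤ) + 1 ≤ j ∧ j ≤ i + k}
  have hpair : ∀ i j, |∫ ω, ξ i ω * η j ω ∂μ - (∫ ω, ξ i ω ∂μ) * ∫ ω, η j ω ∂μ| ≤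
      (2 + 4 * (Ca + C)) * blockDecay k (Nat.dist i j) := by
    intro i j
    unfold blockDecay
    split_ifs with h
    · refine (abs_cov_le_of_fourth ((hξ i).mono (hle i) le_rfl) ((hη j).mono (hle j) le_rfl)
        (hξ4 i) (hη4 j) (hξC i) (hηC j)).trans ?_
      linarith
    · have hd : 0 ≤ 1 / ((Nat.dist i j - k + 1 : ℕ) : ℝ) ^ 2 := by positivity
      have hpast : ∀ {a b : ℕ}, a < b → sigmaOf X {j | (a : ℤ) + 1 ≤ j ∧ j ≤ a + k} ≤
          sigmaOf X {j | j ≤ (a : ℤ) + k} := fun _ => sigmaOf_mono X fun _ h => h.2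
      have hfut : ∀ b : ℕ, sigmaOf X {j | (b : ℤ) + 1 ≤ j ∧ j ≤ b + k} ≤
          sigmaOf X {j | (b : ℤ) + 1 ≤ j} := fun _ => sigmaOf_mono X fun _ h => h.1
      rcases lt_or_ge i j with hij | hij
      · have hdist : Nat.dist i j = j - i := Nat.dist_eq_sub_of_le hij.le
        refine (hR.abs_cov_le_of_gap (t := (i : ℤ) + k) (u := (j : ℤ) + 1)
          (g := Nat.dist i j - k + 1) (by omega) (by omega) ((hξ i).mono (hpast hij) le_rfl)
          ((hη j).mono (hfut j) le_rfl) (hξ4 i) (hη4 j) (hξC i) (hηC j)).trans ?_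
        exact mul_le_mul_of_nonneg_right (by linarith) hd
      · have hdist : Nat.dist i j = i - j := Nat.dist_eq_sub_of_le_right hij
        have hji : j < i := by omega
        have := hR.abs_cov_le_of_gap (t := (j : ℤ) + k) (u := (i : ℤ) + 1)
          (g := Nat.dist i j - k + 1) (by omega) (by omega) ((hη j).mono (hpast hji) le_rfl)
          ((hξ i).mono (hfut i) le_rfl) (hη4 j) (hξ4 i) (hηC j) (hξC i)
        simp only [mul_comm (ξ i _)]
        rw [mul_comm (∫ ω, ξ i ω ∂μ)]
        exact this.trans (mul_le_mul_of_nonneg_right (by linarith) hd)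
  calc |∑ i ∈ Finset.range N, ∑ j ∈ Finset.range N,
        (∫ ω, ξ i ω * η j ω ∂μ - (∫ ω, ξ i ω ∂μ) * ∫ ω, η j ω ∂μ)|
      ≤ ∑ i ∈ Finset.range N, ∑ j ∈ Finset.range N,
        (2 + 4 * (Ca + C)) * blockDecay k (Nat.dist i j) :=
        (Finset.abs_sum_le_sum_abs _ _).trans (Finset.sum_le_sum fun i _ =>
          (Finset.abs_sum_le_sum_abs _ _).trans (Finset.sum_le_sum fun j _ => hpair i j))
    _ = (2 + 4 * (Ca + C)) * ∑ i ∈ Finset.range N, ∑ j ∈ Finset.range N,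
        blockDecay k (Nat.dist i j) := by simp only [Finset.mul_sum]
    _ ≤ (2 + 4 * (Ca + C)) * (2 * N * (S * k)) := by
        refine mul_le_mul_of_nonneg_left ((sum_sum_dist_le (blockDecay_nonneg k) N).trans ?_)
          (by positivity)
        exact mul_le_mul_of_nonneg_left (hsum N k hk) (by positivity)
    _ = (2 + 4 * (Ca + C)) * (2 * S) * (N * k) := by ring

end BlockCov

/-- Mean of the block of length `k` started `i` steps after time `1`. -/
def bmean (Z : ℤ → Ω → ℝ) (k i : ℕ) (ω : Ω) : ℝ := psum Z (1 + i) k ω / k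

omit [MeasurableSpace Ω] in
lemma avg_range (F : ℕ → ℝ) (N : ℕ) :
    avg (fun i : ↥(Finset.range N) => F i) = (∑ i ∈ Finset.range N, F i) / N := by
  rw [avg, Fintype.card_coe, Finset.card_range, Finset.sum_coe_sort (Finset.range N) F]

omit [MeasurableSpace Ω] in
lemma avg_bmean_comm (Z : ℤ → Ω → ℝ) (k N : ℕ) (ω : Ω) :
    avg (fun i : ↥(Finset.range N) => bmean Z k i ω) =
      avg (fun i : ↥(Finset.range k) => bmean Z N i ω) := by
  rw [avg_range (fun i => bmean Z k i ω), avg_range (fun i => bmean Z N i ω)]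
  simp only [bmean, psum, ← Finset.sum_div]
  rw [Finset.sum_comm, div_right_comm]
  simp only [add_right_comm]

/-- Relations between sample size `n`, block length `k`, number `N` of overlapping blocks and
number `b` of resampled blocks. -/
structure IsDesign (n k N b : ℕ) : Prop where
  one_le_k : 1 ≤ k
  k_le : k ≤ n
  le_N : n ≤ 2 * N
  le_mul : n ≤ 2 * (k * b)
  mul_le : k * b ≤ n

lemma isDesign {n k : ℕ} (hk : 1 ≤ k) (hkn : 2 * k ≤ n) : IsDesign n k (n - k + 1) (n / k) := by
  have h1 := Nat.div_mul_le_self n k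
  have h2 := Nat.lt_mul_div_succ n (show 0 < k by omega)
  have h3 : 1 ≤ n / k := (Nat.one_le_div_iff (by omega)).2 (by omega)
  refine ⟨hk, by omega, by omega, ?_, by rwa [mul_comm]⟩
  nlinarith

namespace IsDesign

variable {n k N b : ℕ}

lemma one_le_n (h : IsDesign n k N b) : 1 ≤ n := h.one_le_k.trans h.k_le
lemma one_le_N (h : IsDesign n k N b) : 1 ≤ N := by have := h.le_N; have := h.one_le_n; omega
lemma one_le_b (h : IsDesign n k N b) : 1 ≤ b := by
  rcases Nat.eq_zero_or_pos b with rfl | hb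
  · have := h.le_mul; have := h.one_le_n; simp at *; omega
  · exact hb

lemma k_pos (h : IsDesign n k N b) : (0 : ℝ) < k := by exact_mod_cast h.one_le_k
lemma n_pos (h : IsDesign n k N b) : (0 : ℝ) < n := by exact_mod_cast h.one_le_n
lemma N_pos (h : IsDesign n k N b) : (0 : ℝ) < N := by exact_mod_cast h.one_le_N
lemma b_pos (h : IsDesign n k N b) : (0 : ℝ) < b := by exact_mod_cast h.one_le_b

lemma one_div_N_le (h : IsDesign n k N b) : 1 / (N : ℝ) ≤ 2 / n := by
  rw [div_le_div_iff₀ h.N_pos h.n_pos]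
  have := h.le_N
  rw [one_mul]
  exact_mod_cast this

lemma one_div_mul_le (h : IsDesign n k N b) : 1 / ((k : ℝ) * b) ≤ 2 / n := by
  rw [div_le_div_iff₀ (mul_pos h.k_pos h.b_pos) h.n_pos]
  have := h.le_mul
  rw [one_mul]
  exact_mod_cast this

lemma one_div_n_le (h : IsDesign n k N b) : 1 / (n : ℝ) ≤ k / n :=
  div_le_div_of_nonneg_right (by exact_mod_cast h.one_le_k) h.n_pos.le

end IsDesign

section Moments

variable {μ : Measure Ω} [IsProbabilityMeasure μ] {X : ℤ → Ω → Fin d → ℝ} {s Ca D : ℝ} {P : ℕ}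
  {Z : ℤ → Ω → ℝ}

omit [IsProbabilityMeasure μ] in
lemma integrable_avg {α : Type*} [Fintype α] {F : α → Ω → ℝ} (hF : ∀ a, Integrable (F a) μ) :
    Integrable (fun ω => avg fun a => F a ω) μ :=
  (integrable_finsetSum _ fun a _ => hF a).div_const _

omit [IsProbabilityMeasure μ] in
lemma integral_avg {α : Type*} [Fintype α] {F : α → Ω → ℝ} (hF : ∀ a, Integrable (F a) μ) :
    ∫ ω, avg (fun a => F a ω) ∂μ = avg fun a => ∫ ω, F a ω ∂μ := by
  simp only [avg]
  rw [integral_div, integral_finsetSum _ fun a _ => hF a]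

lemma measurable_avg {α : Type*} [Fintype α] {F : α → Ω → ℝ} (hF : ∀ a, Measurable (F a)) :
    Measurable (fun ω => avg fun a => F a ω) :=
  (Finset.measurable_sum _ fun a _ => hF a).div_const _

omit [IsProbabilityMeasure μ] in
lemma IsScore.measurable_bmean (hmeas : ∀ i, Measurable (X i)) (hZ : IsScore μ X s D Z)
    (k i : ℕ) : Measurable (bmean Z k i) := (hZ.measurable_psum hmeas _ _).div_const _

omit [IsProbabilityMeasure μ] in
lemma IsScore.measurable_bmean_sigmaOf (hZ : IsScore μ X s D Z) (k i : ℕ) :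
    Measurable[sigmaOf X {j | (i : ℤ) + 1 ≤ j ∧ j ≤ i + k}] (bmean Z k i) := by
  refine Measurable.div_const (measurable_psum_sigmaOf hZ.meas fun m hm => ?_) _
  simp only [Set.mem_ofPred_eq]
  omega

lemma IsRegular.integrable_bmean_pow (hR : IsRegular μ X s Ca P) (hZ : IsScore μ X s D Z)
    (k i : ℕ) {j : ℕ} (hj : j ≤ P) : Integrable (fun ω => bmean Z k i ω ^ j) μ := by
  simp only [bmean, div_pow]
  exact (hZ.integrable_psum_pow hR.meas hR.one_le _ _ (hR.cast_le hj)).div_const _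

lemma IsRegular.integral_bmean (hR : IsRegular μ X s Ca P) (hZ : IsScore μ X s D Z) (k i : ℕ) :
    ∫ ω, bmean Z k i ω ∂μ = 0 := by
  simp only [bmean]
  rw [integral_div, hZ.integral_psum hR.meas hR.one_le, zero_div]

omit [IsProbabilityMeasure μ] in
lemma HasMoments.integral_bmean_pow_le {q : ℕ} {C : ℝ} (h : HasMoments μ Z q C) {k : ℕ}
    (hk : 1 ≤ k) (i : ℕ) : ∫ ω, bmean Z k i ω ^ (2 * q) ∂μ ≤ C * (1 / (k : ℝ)) ^ q := by
  have hk' : (0 : ℝ) < k := by exact_mod_cast hk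
  simp only [bmean, div_pow, one_pow]
  rw [integral_div, div_le_iff₀ (by positivity)]
  refine (h _ k).trans_eq ?_
  field_simp
  ring

/-- Even moments of the average of all block means. -/
lemma IsRegular.integral_avg_bmean_pow_le (hR : IsRegular μ X s Ca P) (hZ : IsScore μ X s D Z)
    {q : ℕ} {C : ℝ} (h : HasMoments μ Z q C) (hqP : 2 * q ≤ P) {k N : ℕ} (hk : 1 ≤ k)
    (hN : 1 ≤ N) :
    Integrable (fun ω => avg (fun i : ↥(Finset.range N) => bmean Z k i ω) ^ (2 * q)) μ ∧
    ∫ ω, avg (fun i : ↥(Finset.range N) => bmean Z k i ω) ^ (2 * q) ∂μ ≤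
      C * (1 / (N : ℝ)) ^ q := by
  have : Nonempty ↥(Finset.range k) := ⟨⟨0, Finset.mem_range.2 hk⟩⟩
  simp only [avg_bmean_comm Z k N]
  have hI : ∀ i : ↥(Finset.range k), Integrable (fun ω => bmean Z N i ω ^ (2 * q)) μ :=
    fun i => hR.integrable_bmean_pow hZ N i hqP
  have hle : ∀ ω, avg (fun i : ↥(Finset.range k) => bmean Z N i ω) ^ (2 * q) ≤
      avg fun i : ↥(Finset.range k) => bmean Z N i ω ^ (2 * q) :=
    fun ω => avg_pow_le_avg_pow _ (even_two_mul q)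
  have hint : Integrable
      (fun ω => avg (fun i : ↥(Finset.range k) => bmean Z N i ω) ^ (2 * q)) μ :=
    (integrable_avg hI).mono' ((measurable_avg fun i : ↥(Finset.range k) => hZ.measurable_bmean hR.meas N i).pow_const
      _).aestronglyMeasurable (ae_of_all _ fun ω => by
        rw [Real.norm_eq_abs, abs_of_nonneg ((even_two_mul q).pow_nonneg _)]; exact hle ω)
  refine ⟨hint, (integral_mono hint (integrable_avg hI) hle).trans ?_⟩
  rw [integral_avg hI]
  exact (avg_mono fun i : ↥(Finset.range k) => h.integral_bmean_pow_le hN i).trans_eq (avg_const _)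

/-- Even moments of the resampled mean. -/
lemma IsRegular.exists_resMean_moment (hR : IsRegular μ X s Ca P) (hD : 0 ≤ D) {q : ℕ}
    (hq : 1 ≤ q) (hqP : 2 * q ≤ P) : ∃ C : ℝ, 0 ≤ C ∧ ∀ Z, IsScore μ X s D Z →
      ∀ n k N b, IsDesign n k N b →
        Integrable (fun ω => avg fun f : Fin b → ↥(Finset.range N) =>
          resMean (fun i : ↥(Finset.range N) => bmean Z k i ω) f ^ (2 * q)) μ ∧
        ∫ ω, avg (fun f : Fin b → ↥(Finset.range N) =>
          resMean (fun i : ↥(Finset.range N) => bmean Z k i ω) f ^ (2 * q)) ∂μ ≤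
            C * (1 / (n : ℝ)) ^ q := by
  obtain ⟨C₁, hC₁, h₁⟩ := hR.exists_moments hD hq hqP
  obtain ⟨C₂, hC₂, h₂⟩ := exists_avg_resMean_pow_le q
  refine ⟨C₂ * (2 * C₁ * 2 ^ q), by positivity, fun Z hZ n k N b hd => ?_⟩
  have hZm := h₁ Z hZ
  have : Nonempty ↥(Finset.range N) := ⟨⟨0, Finset.mem_range.2 hd.one_le_N⟩⟩
  obtain ⟨i1, e1⟩ := hR.integral_avg_bmean_pow_le hZ hZm hqP hd.one_le_k hd.one_le_N
  have hI : ∀ i : ↥(Finset.range N), Integrable (fun ω => bmean Z k i ω ^ (2 * q)) μ :=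
    fun i => hR.integrable_bmean_pow hZ k i hqP
  have i2 := integrable_avg hI
  have e2 : ∫ ω, avg (fun i : ↥(Finset.range N) => bmean Z k i ω ^ (2 * q)) ∂μ ≤
      C₁ * (1 / (k : ℝ)) ^ q := by
    rw [integral_avg hI]
    exact (avg_mono fun i : ↥(Finset.range N) => hZm.integral_bmean_pow_le hd.one_le_k i).trans_eq (avg_const _)
  have i3 := (i1.add (i2.div_const ((b : ℝ) ^ q))).const_mul C₂
  have hle : ∀ ω, avg (fun f : Fin b → ↥(Finset.range N) =>
      resMean (fun i : ↥(Finset.range N) => bmean Z k i ω) f ^ (2 * q)) ≤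
      C₂ * (avg (fun i : ↥(Finset.range N) => bmean Z k i ω) ^ (2 * q) +
        avg (fun i : ↥(Finset.range N) => bmean Z k i ω ^ (2 * q)) / (b : ℝ) ^ q) :=
    fun ω => h₂ _ b hd.one_le_b
  have hint : Integrable (fun ω => avg fun f : Fin b → ↥(Finset.range N) =>
      resMean (fun i : ↥(Finset.range N) => bmean Z k i ω) f ^ (2 * q)) μ := by
    refine i3.mono' (Measurable.aestronglyMeasurable (measurable_avg fun f =>
      ((Finset.measurable_sum _ fun a _ => hZ.measurable_bmean hR.meas k _).div_const
        _).pow_const _)) (ae_of_all _ fun ω => ?_)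
    rw [Real.norm_eq_abs, abs_of_nonneg (avg_nonneg fun f => (even_two_mul q).pow_nonneg _)]
    exact hle ω
  refine ⟨hint, (integral_mono hint i3 hle).trans ?_⟩
  simp only [Pi.add_apply]
  rw [integral_const_mul, integral_add i1 (i2.div_const _), integral_div, mul_assoc C₂]
  refine mul_le_mul_of_nonneg_left ?_ hC₂
  have hb := hd.b_pos
  have hk := hd.k_pos
  have hn := hd.n_pos
  have f1 : (1 / (N : ℝ)) ^ q ≤ (2 / n) ^ q := by have := hd.one_div_N_le; gcongr
  have f2 : (1 / ((k : ℝ) * b)) ^ q ≤ (2 / n) ^ q := by have := hd.one_div_mul_le; gcongr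
  have f3 : C₁ * (1 / (k : ℝ)) ^ q / (b : ℝ) ^ q = C₁ * (1 / ((k : ℝ) * b)) ^ q := by
    simp only [div_pow, mul_pow, one_pow]
    field_simp
  have f4 : (2 / (n : ℝ)) ^ q = 2 ^ q * (1 / (n : ℝ)) ^ q := by
    rw [← mul_pow]; ring_nf
  calc _ ≤ C₁ * (1 / (N : ℝ)) ^ q + C₁ * (1 / (k : ℝ)) ^ q / (b : ℝ) ^ q := by gcongr
    _ ≤ C₁ * (2 / (n : ℝ)) ^ q + C₁ * (2 / (n : ℝ)) ^ q := by
      rw [f3]; gcongr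
    _ = _ := by rw [f4]; ring

end Moments

section BlockAverages

variable {μ : Measure Ω} [IsProbabilityMeasure μ] {X : ℤ → Ω → Fin d → ℝ} {s Ca D : ℝ} {P : ℕ}
  {Z : ℤ → Ω → ℝ}

lemma memLp_two_of_fourth {A : Ω → ℝ} (hA : Measurable A)
    (hA4 : Integrable (fun ω => A ω ^ 4) μ) : MemLp A 2 μ :=
  (memLp_two_iff_integrable_sq hA.aestronglyMeasurable).2
    (integral_sq_le_one_add hA hA4 le_rfl).1

/-- The covariance of averages of block functionals is of order `k / N`. -/
lemma IsRegular.exists_abs_cov_avg_le (hR : IsRegular μ X s Ca P) {C : ℝ} (hC : 0 ≤ C) :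
    ∃ K : ℝ, 0 ≤ K ∧ ∀ (k N : ℕ) (ξ η : ℕ → Ω → ℝ), 1 ≤ k → 1 ≤ N →
      (∀ i : ℕ, Measurable[sigmaOf X {j | (i : ℤ) + 1 ≤ j ∧ j ≤ i + k}] (ξ i)) →
      (∀ i : ℕ, Measurable[sigmaOf X {j | (i : ℤ) + 1 ≤ j ∧ j ≤ i + k}] (η i)) →
      (∀ i, Integrable (fun ω => ξ i ω ^ 4) μ) → (∀ i, Integrable (fun ω => η i ω ^ 4) μ) →
      (∀ i, ∫ ω, ξ i ω ^ 4 ∂μ ≤ C) → (∀ i, ∫ ω, η i ω ^ 4 ∂μ ≤ C) →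
      Integrable (fun ω => avg (fun i : ↥(Finset.range N) => ξ i ω) *
        avg (fun i : ↥(Finset.range N) => η i ω)) μ ∧
      |∫ ω, avg (fun i : ↥(Finset.range N) => ξ i ω) *
          avg (fun i : ↥(Finset.range N) => η i ω) ∂μ -
        (∫ ω, avg (fun i : ↥(Finset.range N) => ξ i ω) ∂μ) *
          ∫ ω, avg (fun i : ↥(Finset.range N) => η i ω) ∂μ| ≤ K * ((k : ℝ) / N) := by
  obtain ⟨K, hK, h⟩ := hR.exists_abs_sum_sum_cov_le hC
  refine ⟨K, hK, fun k N ξ η hk hN hξ hη hξ4 hη4 hξC hηC => ?_⟩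
  have hN' : (0 : ℝ) < N := by exact_mod_cast hN
  have key := h k N ξ η hk hξ hη hξ4 hη4 hξC hηC
  have hle := fun i : ℕ => sigmaOf_le hR.meas {j | (i : ℤ) + 1 ≤ j ∧ j ≤ i + k}
  have lξ : ∀ i, MemLp (ξ i) 2 μ := fun i =>
    memLp_two_of_fourth ((hξ i).mono (hle i) le_rfl) (hξ4 i)
  have lη : ∀ i, MemLp (η i) 2 μ := fun i =>
    memLp_two_of_fourth ((hη i).mono (hle i) le_rfl) (hη4 i)
  have iξ : ∀ i, Integrable (ξ i) μ := fun i => (lξ i).integrable (by norm_num)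
  have iη : ∀ i, Integrable (η i) μ := fun i => (lη i).integrable (by norm_num)
  have iξη : ∀ i j, Integrable (fun ω => ξ i ω * η j ω) μ :=
    fun i j => (lξ i).integrable_mul (lη j)
  have e : ∀ ω, avg (fun i : ↥(Finset.range N) => ξ i ω) *
      avg (fun i : ↥(Finset.range N) => η i ω) =
      (∑ i ∈ Finset.range N, ∑ j ∈ Finset.range N, ξ i ω * η j ω) / (N : ℝ) ^ 2 := fun ω => by
    rw [avg_range (fun i => ξ i ω), avg_range (fun i => η i ω), div_mul_div_comm,
      Finset.sum_mul_sum, sq]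
  have hI : Integrable (fun ω => ∑ i ∈ Finset.range N, ∑ j ∈ Finset.range N, ξ i ω * η j ω) μ :=
    integrable_finsetSum _ fun i _ => integrable_finsetSum _ fun j _ => iξη i j
  simp only [e]
  refine ⟨hI.div_const _, ?_⟩
  rw [integral_div, integral_finsetSum _ fun i _ => integrable_finsetSum _ fun j _ => iξη i j,
    integral_avg fun i : ↥(Finset.range N) => iξ i, integral_avg fun i : ↥(Finset.range N) => iη i,
    avg_range (fun i => ∫ ω, ξ i ω ∂μ), avg_range (fun i => ∫ ω, η i ω ∂μ), div_mul_div_comm,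
    Finset.sum_mul_sum, ← sq, ← sub_div, ← Finset.sum_sub_distrib]
  simp only [integral_finsetSum _ fun j _ => iξη _ j, ← Finset.sum_sub_distrib]
  rw [abs_div, abs_of_pos (by positivity : (0 : ℝ) < (N : ℝ) ^ 2), div_le_iff₀ (by positivity)]
  refine key.trans_eq ?_
  field_simp

omit [IsProbabilityMeasure μ] in
lemma IsDesign.div_N_le {n k N b : ℕ} (h : IsDesign n k N b) : (k : ℝ) / N ≤ 2 * (k / n) := by
  have := mul_le_mul_of_nonneg_left h.one_div_N_le h.k_pos.le
  rw [mul_one_div] at this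
  exact this.trans_eq (by ring)

/-- The variance of the average squared block mean. -/
lemma IsRegular.exists_variance_avg_sq_le (hR : IsRegular μ X s Ca P) (hD : 0 ≤ D)
    (hP : 8 ≤ P) : ∃ K : ℝ, 0 ≤ K ∧ ∀ Z, IsScore μ X s D Z → ∀ n k N b, IsDesign n k N b →
      MemLp (fun ω => k * avg (fun i : ↥(Finset.range N) => bmean Z k i ω ^ 2)) 2 μ ∧
      variance (fun ω => k * avg (fun i : ↥(Finset.range N) => bmean Z k i ω ^ 2)) μ ≤
        K * ((k : ℝ) / n) := by
  obtain ⟨C, hC, hm⟩ := hR.exists_moments hD (q := 4) (by norm_num) hP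
  obtain ⟨K, hK, h⟩ := hR.exists_abs_cov_avg_le hC
  refine ⟨K * 2, by positivity, fun Z hZ n k N b hd => ?_⟩
  have hk := hd.k_pos
  have h4 : ∀ i : ℕ, Integrable (fun ω => (k * bmean Z k i ω ^ 2) ^ 4) μ := fun i => by
    simp only [mul_pow, ← pow_mul]
    exact (hR.integrable_bmean_pow hZ k i hP).const_mul _
  have h4C : ∀ i : ℕ, ∫ ω, (k * bmean Z k i ω ^ 2) ^ 4 ∂μ ≤ C := fun i => by
    simp only [mul_pow, ← pow_mul]
    rw [integral_const_mul]
    refine (mul_le_mul_of_nonneg_left ((hm Z hZ).integral_bmean_pow_le hd.one_le_k i)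
      (by positivity)).trans_eq ?_
    field_simp
  have hmeas : ∀ i : ℕ, Measurable[sigmaOf X {j | (i : ℤ) + 1 ≤ j ∧ j ≤ i + k}]
      (fun ω => k * bmean Z k i ω ^ 2) := fun i =>
    ((hZ.measurable_bmean_sigmaOf k i).pow_const 2).const_mul _
  obtain ⟨i1, b1⟩ := h k N (fun i ω => k * bmean Z k i ω ^ 2) (fun i ω => k * bmean Z k i ω ^ 2)
    hd.one_le_k hd.one_le_N hmeas hmeas h4 h4 h4C h4C
  simp only [avg_const_mul] at i1 b1
  have hmM : Measurable fun ω => k * avg (fun i : ↥(Finset.range N) => bmean Z k i ω ^ 2) :=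
    (measurable_avg fun i : ↥(Finset.range N) =>
      (hZ.measurable_bmean hR.meas k i).pow_const 2).const_mul _
  have hL : MemLp (fun ω => k * avg (fun i : ↥(Finset.range N) => bmean Z k i ω ^ 2)) 2 μ :=
    (memLp_two_iff_integrable_sq hmM.aestronglyMeasurable).2 (by simpa only [sq] using i1)
  refine ⟨hL, ?_⟩
  rw [variance_eq_sub hL]
  simp only [Pi.pow_apply, pow_two (_ * _ : ℝ), pow_two (∫ ω, _ ∂μ)]
  refine (le_abs_self _).trans (b1.trans ?_)
  rw [mul_assoc K]
  exact mul_le_mul_of_nonneg_left hd.div_N_le hK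

end BlockAverages

lemma integrable_and_abs_integral_le {μ : Measure Ω} {F G : Ω → ℝ} (hF : Measurable F)
    (hG : Integrable G μ) (h : ∀ ω, |F ω| ≤ G ω) :
    Integrable F μ ∧ |∫ ω, F ω ∂μ| ≤ ∫ ω, G ω ∂μ :=
  ⟨hG.mono' hF.aestronglyMeasurable (ae_of_all _ h), by
    rw [← Real.norm_eq_abs]; exact norm_integral_le_of_norm_le hG (ae_of_all _ h)⟩

lemma abs_mul_mul_le (a b c : ℝ) : |a * b * c| ≤ a ^ 2 + b ^ 4 + c ^ 4 := by
  rw [abs_le]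
  constructor <;>
  nlinarith [sq_nonneg (a + b * c), sq_nonneg (a - b * c), sq_nonneg (b ^ 2 - c ^ 2),
    sq_nonneg a, sq_nonneg (b ^ 2), sq_nonneg (c ^ 2)]

lemma sub_pow_four_le (a b : ℝ) : (a - b) ^ 4 ≤ 8 * (a ^ 4 + b ^ 4) := by
  nlinarith [sq_nonneg (a + b), sq_nonneg (a - b), sq_nonneg (a ^ 2 - b ^ 2),
    sq_nonneg ((a - b) ^ 2 - 0), sq_nonneg ((a + b) ^ 2), sq_nonneg (a ^ 2 + b ^ 2),
    mul_nonneg (sq_nonneg (a + b)) (sq_nonneg (a - b))]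

section Cumulant

variable {ι : Type*} [Fintype ι] [Nonempty ι]

lemma avg_centred_pow_four_le (u : ι → ℝ) :
    avg (fun i => (u i - avg u) ^ 4) ≤ 16 * avg fun i => u i ^ 4 := by
  have h := avg_mono fun i => sub_pow_four_le (u i) (avg u)
  rw [avg_const_mul, avg_add, avg_const] at h
  have := avg_pow_le_avg_pow u (p := 4) (by decide)
  linarith

lemma abs_avg_centred_mul_mul_le (y x z : ι → ℝ) :
    |avg fun i => (y i - avg y) * (x i - avg x) * (z i - avg z)| ≤
      avg (fun i => x i ^ 2) + 16 * avg (fun i => y i ^ 4) + 16 * avg fun i => z i ^ 4 := by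
  have h := avg_mono fun i => abs_mul_mul_le (x i - avg x) (y i - avg y) (z i - avg z)
  simp only [avg_add] at h
  have h1 : avg (fun i => (x i - avg x) ^ 2) ≤ avg fun i => x i ^ 2 := by
    simp only [sq (_ - _), avg_centred_mul]
    exact acov_self_le x
  have h2 := avg_centred_pow_four_le y
  have h3 := avg_centred_pow_four_le z
  refine (abs_avg_le _).trans ?_
  simp only [mul_comm (y _ - avg y)]
  linarith

lemma mul_acov_resMean_mul (y x z : ι → ℝ) {b : ℕ} (hb : 0 < b) (k : ℝ) :
    k * b * acov (fun f : Fin b → ι => resMean y f) (fun f => resMean x f * resMean z f) =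
      (avg x * avg (fun i => k * (y i * z i)) - k * (avg x * avg y * avg z)) +
      (avg z * avg (fun i => k * (y i * x i)) - k * (avg z * avg y * avg x)) +
      k / b * avg fun i => (y i - avg y) * (x i - avg x) * (z i - avg z) := by
  have hb' : (b : ℝ) ≠ 0 := by positivity
  rw [acov_resMean_mul y x z hb]
  simp only [avg_const_mul, acov]
  field_simp

end Cumulant

section Cumulant

variable {μ : Measure Ω} [IsProbabilityMeasure μ] {X : ℤ → Ω → Fin d → ℝ} {s Ca D : ℝ} {P : ℕ}

lemma IsRegular.exists_integral_avg_mul_avg_le (hR : IsRegular μ X s Ca P) (hD : 0 ≤ D)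
    (hP : 8 ≤ P) : ∃ K : ℝ, 0 ≤ K ∧ ∀ x y z, IsScore μ X s D x → IsScore μ X s D y →
      IsScore μ X s D z → ∀ n k N b, IsDesign n k N b →
      Integrable (fun ω => avg (fun i : ↥(Finset.range N) => bmean x k i ω) *
        avg (fun i : ↥(Finset.range N) => k * (bmean y k i ω * bmean z k i ω))) μ ∧
      |∫ ω, avg (fun i : ↥(Finset.range N) => bmean x k i ω) *
        avg (fun i : ↥(Finset.range N) => k * (bmean y k i ω * bmean z k i ω)) ∂μ| ≤
          K * ((k : ℝ) / n) := by
  obtain ⟨C₄, hC₄, hm₄⟩ := hR.exists_moments hD (q := 4) (by norm_num) hP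
  obtain ⟨C₂, hC₂, hm₂⟩ := hR.exists_moments hD (q := 2) (by norm_num) (by omega)
  obtain ⟨K, hK, h⟩ := hR.exists_abs_cov_avg_le (C := C₂ + C₄) (by positivity)
  refine ⟨K * 2, by positivity, fun x y z hx hy hz n k N b hd => ?_⟩
  have hk := hd.k_pos
  have hk1 : (1 : ℝ) ≤ k := by exact_mod_cast hd.one_le_k
  have iy : ∀ i : ℕ, Integrable (fun ω => (k : ℝ) ^ 4 * (bmean y k i ω ^ 8 + bmean z k i ω ^ 8)) μ :=
    fun i => ((hR.integrable_bmean_pow hy k i hP).add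
      (hR.integrable_bmean_pow hz k i hP)).const_mul _
  have hle : ∀ (i : ℕ) ω, (k * (bmean y k i ω * bmean z k i ω)) ^ 4 ≤
      (k : ℝ) ^ 4 * (bmean y k i ω ^ 8 + bmean z k i ω ^ 8) / 2 := fun i ω => by
    rw [mul_pow, mul_div_assoc]
    refine mul_le_mul_of_nonneg_left ?_ (by positivity)
    nlinarith [sq_nonneg (bmean y k i ω ^ 4 - bmean z k i ω ^ 4)]
  have hmyz : ∀ i : ℕ, Measurable[sigmaOf X {j | (i : ℤ) + 1 ≤ j ∧ j ≤ i + k}]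
      (fun ω => k * (bmean y k i ω * bmean z k i ω)) := fun i =>
    ((hy.measurable_bmean_sigmaOf k i).mul (hz.measurable_bmean_sigmaOf k i)).const_mul _
  have iyz : ∀ i : ℕ, Integrable (fun ω => (k * (bmean y k i ω * bmean z k i ω)) ^ 4) μ ∧
      |∫ ω, (k * (bmean y k i ω * bmean z k i ω)) ^ 4 ∂μ| ≤
        ∫ ω, (k : ℝ) ^ 4 * (bmean y k i ω ^ 8 + bmean z k i ω ^ 8) / 2 ∂μ := fun i =>
    integrable_and_abs_integral_le (((hmyz i).mono (sigmaOf_le hR.meas _) le_rfl).pow_const 4)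
      ((iy i).div_const 2) fun ω => by
        rw [abs_of_nonneg (Even.pow_nonneg (by decide) _)]; exact hle i ω
  have byz : ∀ i : ℕ, ∫ ω, (k * (bmean y k i ω * bmean z k i ω)) ^ 4 ∂μ ≤ C₂ + C₄ := fun i => by
    refine (le_abs_self _).trans ((iyz i).2.trans ?_)
    rw [integral_div, integral_const_mul, integral_add (hR.integrable_bmean_pow hy k i hP)
      (hR.integrable_bmean_pow hz k i hP)]
    have h1 := (hm₄ y hy).integral_bmean_pow_le hd.one_le_k i
    have h2 := (hm₄ z hz).integral_bmean_pow_le hd.one_le_k i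
    have h3 : (k : ℝ) ^ 4 * (C₄ * (1 / (k : ℝ)) ^ 4 + C₄ * (1 / (k : ℝ)) ^ 4) / 2 = C₄ := by
      field_simp; ring
    have h4 : (k : ℝ) ^ 4 * (∫ ω, bmean y k i ω ^ 8 ∂μ + ∫ ω, bmean z k i ω ^ 8 ∂μ) / 2 ≤
        (k : ℝ) ^ 4 * (C₄ * (1 / (k : ℝ)) ^ 4 + C₄ * (1 / (k : ℝ)) ^ 4) / 2 := by gcongr
    linarith
  have bx : ∀ i : ℕ, ∫ ω, bmean x k i ω ^ 4 ∂μ ≤ C₂ + C₄ := fun i => by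
    refine ((hm₂ x hx).integral_bmean_pow_le hd.one_le_k i).trans ?_
    have : (1 / (k : ℝ)) ^ 2 ≤ 1 := pow_le_one₀ (by positivity) (by
      rw [div_le_one hk]; exact hk1)
    nlinarith
  obtain ⟨i1, b1⟩ := h k N (bmean x k) (fun i ω => k * (bmean y k i ω * bmean z k i ω))
    hd.one_le_k hd.one_le_N (hx.measurable_bmean_sigmaOf k) hmyz
    (fun i => hR.integrable_bmean_pow hx k i (by omega)) (fun i => (iyz i).1) bx byz
  refine ⟨i1, ?_⟩
  rw [integral_avg fun i : ↥(Finset.range N) => by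
    simpa using hR.integrable_bmean_pow hx k i (j := 1) (by omega)] at b1
  simp only [hR.integral_bmean hx] at b1
  rw [show avg (fun _ : ↥(Finset.range N) => (0 : ℝ)) = 0 by simp [avg], zero_mul, sub_zero] at b1
  rw [mul_assoc K]
  exact b1.trans (mul_le_mul_of_nonneg_left hd.div_N_le hK)

lemma IsRegular.exists_integral_avg_mul_mul_le (hR : IsRegular μ X s Ca P) (hD : 0 ≤ D) :
    ∃ K : ℝ, 0 ≤ K ∧ ∀ x y z, IsScore μ X s D x → IsScore μ X s D y →
      IsScore μ X s D z → ∀ n k N b, IsDesign n k N b →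
      Integrable (fun ω => k * (avg (fun i : ↥(Finset.range N) => bmean x k i ω) *
        avg (fun i : ↥(Finset.range N) => bmean y k i ω) *
        avg (fun i : ↥(Finset.range N) => bmean z k i ω))) μ ∧
      |∫ ω, k * (avg (fun i : ↥(Finset.range N) => bmean x k i ω) *
        avg (fun i : ↥(Finset.range N) => bmean y k i ω) *
        avg (fun i : ↥(Finset.range N) => bmean z k i ω)) ∂μ| ≤ K * ((k : ℝ) / n) := by
  have hP := hR.four_le
  obtain ⟨C₁, hC₁, hm₁⟩ := hR.exists_moments hD (q := 1) le_rfl (by omega)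
  obtain ⟨C₂, hC₂, hm₂⟩ := hR.exists_moments hD (q := 2) (by norm_num) (by omega)
  refine ⟨2 * (C₁ + 2 * C₂), by positivity, fun x y z hx hy hz n k N b hd => ?_⟩
  have hk := hd.k_pos
  obtain ⟨ix, bx⟩ := hR.integral_avg_bmean_pow_le hx (hm₁ x hx) (by omega) hd.one_le_k hd.one_le_N
  obtain ⟨iy, by'⟩ := hR.integral_avg_bmean_pow_le hy (hm₂ y hy) (by omega) hd.one_le_k hd.one_le_N
  obtain ⟨iz, bz⟩ := hR.integral_avg_bmean_pow_le hz (hm₂ z hz) (by omega) hd.one_le_k hd.one_le_N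
  have hm : ∀ w, IsScore μ X s D w →
      Measurable fun ω => avg (fun i : ↥(Finset.range N) => bmean w k i ω) := fun w hw =>
    measurable_avg fun i : ↥(Finset.range N) => hw.measurable_bmean hR.meas k i
  obtain ⟨i1, b1⟩ := integrable_and_abs_integral_le (μ := μ)
    ((((hm x hx).mul (hm y hy)).mul (hm z hz)).const_mul (k : ℝ))
    (((ix.add iy).add iz).const_mul (k : ℝ)) fun ω => by
      simp only [Pi.mul_apply, Pi.add_apply]
      rw [abs_mul, Nat.abs_cast]
      exact mul_le_mul_of_nonneg_left (abs_mul_mul_le _ _ _) hk.le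
  refine ⟨i1, b1.trans ?_⟩
  have e1 := integral_add (ix.add iy) iz
  have e2 := integral_add ix iy
  simp only [Pi.add_apply] at e1 e2 ⊢
  rw [integral_const_mul, e1, e2]
  have hN1 : 1 / (N : ℝ) ≤ 1 := by
    rw [div_le_one hd.N_pos]; exact_mod_cast hd.one_le_N
  have hN0 : 0 ≤ 1 / (N : ℝ) := by have := hd.N_pos; positivity
  have h2 : (1 / (N : ℝ)) ^ 2 ≤ 1 / (N : ℝ) := by nlinarith
  have h3 := hd.one_div_N_le
  calc _ ≤ (k : ℝ) * (C₁ * (1 / (N : ℝ)) ^ 1 + C₂ * (1 / (N : ℝ)) ^ 2 +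
        C₂ * (1 / (N : ℝ)) ^ 2) := by gcongr
    _ ≤ (k : ℝ) * (C₁ * (2 / n) + C₂ * (2 / n) + C₂ * (2 / n)) := by
        rw [pow_one]; gcongr <;> linarith
    _ = _ := by ring

lemma IsRegular.exists_integral_avg_centred_le (hR : IsRegular μ X s Ca P) (hD : 0 ≤ D) :
    ∃ K : ℝ, 0 ≤ K ∧ ∀ x y z, IsScore μ X s D x → IsScore μ X s D y →
      IsScore μ X s D z → ∀ n k N b, IsDesign n k N b → ∀ F : Ω → ℝ, Measurable F →
      (∀ ω, F ω = k / b * avg fun i : ↥(Finset.range N) =>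
        (bmean y k i ω - avg (fun i : ↥(Finset.range N) => bmean y k i ω)) *
        (bmean x k i ω - avg (fun i : ↥(Finset.range N) => bmean x k i ω)) *
        (bmean z k i ω - avg (fun i : ↥(Finset.range N) => bmean z k i ω))) →
      Integrable F μ ∧ |∫ ω, F ω ∂μ| ≤ K * ((k : ℝ) / n) := by
  have hP := hR.four_le
  obtain ⟨C₁, hC₁, hm₁⟩ := hR.exists_moments hD (q := 1) le_rfl (by omega)
  obtain ⟨C₂, hC₂, hm₂⟩ := hR.exists_moments hD (q := 2) (by norm_num) (by omega)
  refine ⟨2 * (C₁ + 32 * C₂), by positivity, fun x y z hx hy hz n k N b hd F hF hFe => ?_⟩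
  have : Nonempty ↥(Finset.range N) := ⟨⟨0, Finset.mem_range.2 hd.one_le_N⟩⟩
  have hk := hd.k_pos
  have hb := hd.b_pos
  have hi : ∀ w, IsScore μ X s D w → ∀ q, 2 * q ≤ P → ∀ i : ↥(Finset.range N),
      Integrable (fun ω => bmean w k i ω ^ (2 * q)) μ := fun w hw q hq i =>
    hR.integrable_bmean_pow hw k i hq
  have hb' : ∀ w, IsScore μ X s D w → ∀ q C, 2 * q ≤ P → HasMoments μ w q C →
      ∫ ω, avg (fun i : ↥(Finset.range N) => bmean w k i ω ^ (2 * q)) ∂μ ≤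
        C * (1 / (k : ℝ)) ^ q := fun w hw q C hq hwm => by
    rw [integral_avg (hi w hw q hq)]
    exact (avg_mono fun i : ↥(Finset.range N) =>
      hwm.integral_bmean_pow_le hd.one_le_k i).trans_eq (avg_const _)
  have ix := integrable_avg (hi x hx 1 (by omega))
  have iy := (integrable_avg (hi y hy 2 (by omega))).const_mul 16
  have iz := (integrable_avg (hi z hz 2 (by omega))).const_mul 16
  obtain ⟨i1, b1⟩ := integrable_and_abs_integral_le hF
    (((ix.add iy).add iz).const_mul ((k : ℝ) / b)) fun ω => by
      simp only [Pi.add_apply]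
      rw [hFe ω, abs_mul, abs_of_pos (by positivity : 0 < (k : ℝ) / b)]
      exact mul_le_mul_of_nonneg_left (abs_avg_centred_mul_mul_le _ _ _) (by positivity)
  refine ⟨i1, b1.trans ?_⟩
  have e1 := integral_add (ix.add iy) iz
  have e2 := integral_add ix iy
  simp only [Pi.add_apply] at e1 e2 ⊢
  rw [integral_const_mul, e1, e2, integral_const_mul, integral_const_mul]
  have bx := hb' x hx 1 C₁ (by omega) (hm₁ x hx)
  have by' := hb' y hy 2 C₂ (by omega) (hm₂ y hy)
  have bz := hb' z hz 2 C₂ (by omega) (hm₂ z hz)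
  have hk1 : 1 / (k : ℝ) ≤ 1 := by
    rw [div_le_one hk]; exact_mod_cast hd.one_le_k
  have hk0 : 0 ≤ 1 / (k : ℝ) := by positivity
  have h2 : (1 / (k : ℝ)) ^ 2 ≤ 1 / (k : ℝ) := by nlinarith
  calc _ ≤ (k : ℝ) / b * (C₁ * (1 / (k : ℝ)) ^ 1 + 16 * (C₂ * (1 / (k : ℝ)) ^ 2) +
        16 * (C₂ * (1 / (k : ℝ)) ^ 2)) := by gcongr
    _ ≤ (k : ℝ) / b * (C₁ * (1 / (k : ℝ)) + 16 * (C₂ * (1 / (k : ℝ))) +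
        16 * (C₂ * (1 / (k : ℝ)))) := by rw [pow_one]; gcongr
    _ = (C₁ + 32 * C₂) * (k * (1 / ((k : ℝ) * b))) := by field_simp; ring
    _ ≤ (C₁ + 32 * C₂) * (k * (2 / n)) := by have := hd.one_div_mul_le; gcongr
    _ = _ := by ring

/-- Expected bootstrap covariance between a linear and a quadratic statistic. -/
lemma IsRegular.exists_integral_acov_le (hR : IsRegular μ X s Ca P) (hD : 0 ≤ D)
    (hP : 8 ≤ P) : ∃ K : ℝ, 0 ≤ K ∧ ∀ x y z, IsScore μ X s D x → IsScore μ X s D y →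
      IsScore μ X s D z → ∀ n k N b, IsDesign n k N b → ∀ F : Ω → ℝ,
      (∀ ω, F ω = k * b * acov
        (fun f : Fin b → ↥(Finset.range N) =>
          resMean (fun i : ↥(Finset.range N) => bmean y k i ω) f)
        (fun f => resMean (fun i : ↥(Finset.range N) => bmean x k i ω) f *
          resMean (fun i : ↥(Finset.range N) => bmean z k i ω) f)) →
      Integrable F μ ∧ |∫ ω, F ω ∂μ| ≤ K * ((k : ℝ) / n) := by
  obtain ⟨K₁, hK₁, h₁⟩ := hR.exists_integral_avg_mul_avg_le hD hP
  obtain ⟨K₂, hK₂, h₂⟩ := hR.exists_integral_avg_mul_mul_le hD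
  obtain ⟨K₃, hK₃, h₃⟩ := hR.exists_integral_avg_centred_le hD
  refine ⟨2 * K₁ + 2 * K₂ + K₃, by positivity, fun x y z hx hy hz n k N b hd F hF => ?_⟩
  have : Nonempty ↥(Finset.range N) := ⟨⟨0, Finset.mem_range.2 hd.one_le_N⟩⟩
  obtain ⟨i1, b1⟩ := h₁ x y z hx hy hz n k N b hd
  obtain ⟨i2, b2⟩ := h₁ z y x hz hy hx n k N b hd
  obtain ⟨i3, b3⟩ := h₂ x y z hx hy hz n k N b hd
  obtain ⟨i4, b4⟩ := h₂ z y x hz hy hx n k N b hd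
  have hm : ∀ w, IsScore μ X s D w → ∀ i : ↥(Finset.range N),
      Measurable fun ω => bmean w k i ω := fun w hw i => hw.measurable_bmean hR.meas k i
  have hm' : ∀ w, IsScore μ X s D w → ∀ i : ↥(Finset.range N), Measurable fun ω =>
      bmean w k i ω - avg (fun i : ↥(Finset.range N) => bmean w k i ω) := fun w hw i =>
    (hm w hw i).sub (measurable_avg (hm w hw))
  obtain ⟨i5, b5⟩ := h₃ x y z hx hy hz n k N b hd _ ((measurable_avg fun i =>
    ((hm' y hy i).mul (hm' x hx i)).mul (hm' z hz i)).const_mul ((k : ℝ) / b)) fun ω => rfl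
  have e := fun ω => (hF ω).trans (mul_acov_resMean_mul
    (fun i : ↥(Finset.range N) => bmean y k i ω) (fun i => bmean x k i ω)
    (fun i => bmean z k i ω) hd.one_le_b k)
  obtain rfl := funext e
  refine ⟨((i1.sub i3).add (i2.sub i4)).add i5, ?_⟩
  have e1 := integral_add ((i1.sub i3).add (i2.sub i4)) i5
  have e2 := integral_add (i1.sub i3) (i2.sub i4)
  have e3 := integral_sub i1 i3
  have e4 := integral_sub i2 i4
  simp only [Pi.add_apply, Pi.sub_apply, Pi.mul_apply] at e1 e2 e3 e4 b5
  rw [e1, e2, e3, e4]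
  rw [abs_le] at *
  constructor <;> linarith [b1.1, b1.2, b2.1, b2.2, b3.1, b3.2, b4.1, b4.2, b5.1, b5.2]

end Cumulant

lemma norm_pow_le_sum_pow (w : Fin d → ℝ) {p : ℕ} (hp : Even p) (h0 : p ≠ 0) :
    ‖w‖ ^ p ≤ ∑ j, w j ^ p := by
  have hn : ∀ j ∈ Finset.univ, 0 ≤ w j ^ p := fun j _ => hp.pow_nonneg _
  rcases isEmpty_or_nonempty (Fin d) with he | he
  · rw [Subsingleton.elim w 0, norm_zero, zero_pow h0]
    exact Finset.sum_nonneg fun j _ => hp.pow_nonneg _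
  · obtain ⟨j, hj⟩ := Finite.exists_max fun j => |w j|
    have h1 : ‖w‖ ≤ |w j| := (pi_norm_le_iff_of_nonneg (abs_nonneg _)).2 fun i => hj i
    calc ‖w‖ ^ p ≤ |w j| ^ p := pow_le_pow_left₀ (norm_nonneg _) h1 p
      _ = w j ^ p := hp.pow_abs _
      _ ≤ _ := Finset.single_le_sum (f := fun j => w j ^ p) hn (Finset.mem_univ j)

lemma pow_four_le_of_abs_le {r C x y : ℝ} (h : |r| ≤ C * (x + y)) :
    r ^ 4 ≤ 8 * C ^ 4 * (x ^ 4 + y ^ 4) := by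
  have h1 : r ^ 4 ≤ (C * (x + y)) ^ 4 := by
    rw [← Even.pow_abs (by decide : Even 4) r]
    exact pow_le_pow_left₀ (abs_nonneg _) h 4
  have h2 := sub_pow_four_le x (-y)
  rw [sub_neg_eq_add, Even.neg_pow (by decide)] at h2
  rw [mul_pow] at h1
  have : 0 ≤ C ^ 4 := Even.pow_nonneg (by decide) C
  nlinarith

lemma abs_quadratic_le (β : Fin d → Fin d → ℝ) (w : Fin d → ℝ) :
    |∑ j, ∑ l, β j l * (w j * w l)| ≤ (∑ j, ∑ l, |β j l|) * ‖w‖ ^ 2 := by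
  rw [Finset.sum_mul]
  refine (Finset.abs_sum_le_sum_abs _ _).trans (Finset.sum_le_sum fun j _ => ?_)
  rw [Finset.sum_mul]
  refine (Finset.abs_sum_le_sum_abs _ _).trans (Finset.sum_le_sum fun l _ => ?_)
  rw [abs_mul, abs_mul, sq]
  have h1 : |w j| ≤ ‖w‖ := norm_le_pi_norm w j
  have h2 : |w l| ≤ ‖w‖ := norm_le_pi_norm w l
  gcongr

/-- Sum over coordinates of the averaged `p`-th powers. -/
def avgPow {α : Type*} [Fintype α] (W : α → Fin d → ℝ) (p : ℕ) : ℝ := ∑ j, avg fun a => W a j ^ p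

lemma avg_norm_pow_le {α : Type*} [Fintype α] (W : α → Fin d → ℝ) {p : ℕ} (hp : Even p)
    (h0 : p ≠ 0) : avg (fun a => ‖W a‖ ^ p) ≤ avgPow W p := by
  rw [avgPow, ← avg_finsetSum]
  exact avg_mono fun a => norm_pow_le_sum_pow (W a) hp h0

lemma avgPow_nonneg {α : Type*} [Fintype α] (W : α → Fin d → ℝ) {p : ℕ} (hp : Even p) :
    0 ≤ avgPow W p :=
  Finset.sum_nonneg fun _ _ => avg_nonneg fun _ => hp.pow_nonneg _

lemma avg_pow_four_le {α : Type*} [Fintype α] (W : α → Fin d → ℝ) {F : α → ℝ} {c : ℝ} {p : ℕ}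
    (h0 : p ≠ 0) (h : ∀ a, |F a| ≤ c * ‖W a‖ ^ p) :
    avg (fun a => F a ^ 4) ≤ c ^ 4 * avgPow W (4 * p) := by
  refine le_trans ?_ (mul_le_mul_of_nonneg_left (avg_norm_pow_le W (p := 4 * p) ⟨2 * p, by ring⟩
    (by omega)) (Even.pow_nonneg (by decide) c))
  rw [← avg_const_mul]
  refine avg_mono fun a => ?_
  calc F a ^ 4 = |F a| ^ 4 := (Even.pow_abs (by decide) _).symm
    _ ≤ (c * ‖W a‖ ^ p) ^ 4 := pow_le_pow_left₀ (abs_nonneg _) (h a) 4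
    _ = _ := by rw [mul_pow, ← pow_mul, mul_comm p 4]

lemma exists_acov_expansion_le {H : (Fin d → ℝ) → ℝ} {x : Fin d → ℝ} (lin : (Fin d → ℝ) →L[ℝ] ℝ)
    {β : Fin d → Fin d → ℝ} {C : ℝ} {a₀ : ℕ}
    (hH : ∀ w, |H (x + w) - H x - lin w - ∑ j, ∑ l, β j l * (w j * w l)| ≤
      C * (‖w‖ ^ 3 + ‖w‖ ^ (3 + a₀))) :
    ∃ A : ℝ, 0 ≤ A ∧ ∀ (α : Type) [Fintype α] [Nonempty α] (W : α → Fin d → ℝ) (m n : ℝ),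
      0 ≤ m → m ≤ n → 1 ≤ n →
      (m * (acov (fun a => H (x + W a)) (fun a => H (x + W a)) -
        acov (fun a => lin (W a)) (fun a => lin (W a)) -
        2 * acov (fun a => lin (W a)) (fun a => ∑ j, ∑ l, β j l * (W a j * W a l)))) ^ 2 ≤
        A * (avgPow W 4 + n ^ 2 * avgPow W 8 +
          n ^ 4 * (avgPow W 12 + avgPow W (4 * (3 + a₀)))) ∧
      (m * acov (fun a => lin (W a)) (fun a => ∑ j, ∑ l, β j l * (W a j * W a l))) ^ 2 ≤
        A * (n * avgPow W 4 + n ^ 3 * avgPow W 8) := by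
  set cL := ‖lin‖ ^ 4 with hcL
  set cQ := (∑ j, ∑ l, |β j l|) ^ 4 with hcQ
  set cR := 8 * C ^ 4 with hcR
  have cL0 : 0 ≤ cL := by positivity
  have cQ0 : 0 ≤ cQ := by positivity
  have cR0 : 0 ≤ cR := mul_nonneg (by norm_num) (Even.pow_nonneg (by decide) C)
  refine ⟨3 * cL + 12 * cQ + 27 * cR, by positivity, fun α _ _ W m n hm hmn hn => ?_⟩
  have B4 := avgPow_nonneg W (p := 4) (by decide)
  have B8 := avgPow_nonneg W (p := 8) (by decide)
  have B12 := avgPow_nonneg W (p := 12) (by decide)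
  have Ba := avgPow_nonneg W (p := 4 * (3 + a₀)) ⟨2 * (3 + a₀), by ring⟩
  have hL : avg (fun a => lin (W a) ^ 4) ≤ cL * avgPow W 4 :=
    avg_pow_four_le W (p := 1) one_ne_zero fun a => by rw [pow_one]; exact lin.le_opNorm _
  have hQ : avg (fun a => (∑ j, ∑ l, β j l * (W a j * W a l)) ^ 4) ≤ cQ * avgPow W 8 :=
    avg_pow_four_le W (p := 2) two_ne_zero fun a => abs_quadratic_le β (W a)
  have hR : avg (fun a => (H (x + W a) - H x - lin (W a) -
      ∑ j, ∑ l, β j l * (W a j * W a l)) ^ 4) ≤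
      cR * (avgPow W 12 + avgPow W (4 * (3 + a₀))) := by
    have h1 := avg_norm_pow_le W (p := 12) (by decide) (by norm_num)
    have h2 := avg_norm_pow_le W (p := 4 * (3 + a₀)) ⟨2 * (3 + a₀), by ring⟩ (by omega)
    refine le_trans ?_ (mul_le_mul_of_nonneg_left (add_le_add h1 h2) cR0)
    rw [← avg_add, ← avg_const_mul]
    refine avg_mono fun a => (pow_four_le_of_abs_le (hH (W a))).trans_eq ?_
    rw [← pow_mul, ← pow_mul, mul_comm 4]
  have h1 := sq_acov_expansion_le (H x) (fun a => lin (W a))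
    (fun a => ∑ j, ∑ l, β j l * (W a j * W a l)) (fun a => H (x + W a) - H x - lin (W a) -
      ∑ j, ∑ l, β j l * (W a j * W a l)) hm hmn hn
  have h2 := sq_mul_acov_le (fun a => lin (W a))
    (fun a => ∑ j, ∑ l, β j l * (W a j * W a l)) hm hmn (by linarith)
  have n2 : 0 ≤ n ^ 2 := by positivity
  have n3 : 0 ≤ n ^ 3 := by positivity
  have n4 : 0 ≤ n ^ 4 := by positivity
  simp only [show ∀ a, H x + (lin (W a) + ∑ j, ∑ l, β j l * (W a j * W a l) +
    (H (x + W a) - H x - lin (W a) - ∑ j, ∑ l, β j l * (W a j * W a l))) = H (x + W a) from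
    fun a => by ring] at h1
  set b4 := avgPow W 4
  set b8 := avgPow W 8
  set b12 := avgPow W 12 + avgPow W (4 * (3 + a₀))
  have B12' : 0 ≤ b12 := add_nonneg B12 Ba
  constructor
  · refine h1.trans ?_
    calc _ ≤ 3 * (cL * b4 + 4 * n ^ 2 * (cQ * b8) + 9 * n ^ 4 * (cR * b12)) := by gcongr
      _ = 3 * cL * b4 + 12 * cQ * (n ^ 2 * b8) + 27 * cR * (n ^ 4 * b12) := by ring
      _ ≤ (3 * cL + 12 * cQ + 27 * cR) * b4 + (3 * cL + 12 * cQ + 27 * cR) * (n ^ 2 * b8) +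
          (3 * cL + 12 * cQ + 27 * cR) * (n ^ 4 * b12) := by gcongr <;> linarith
      _ = _ := by ring
  · refine h2.trans ?_
    calc _ ≤ n * (cL * b4) + n ^ 3 * (cQ * b8) := by gcongr
      _ = cL * (n * b4) + cQ * (n ^ 3 * b8) := by ring
      _ ≤ (3 * cL + 12 * cQ + 27 * cR) * (n * b4) +
          (3 * cL + 12 * cQ + 27 * cR) * (n ^ 3 * b8) := by gcongr <;> linarith
      _ = _ := by ring

/-- Mean and variance of a leading term perturbed by three small remainders. -/
lemma exists_mean_variance_le {A : ℝ} (hA : 0 ≤ A) : ∃ K : ℝ, 0 ≤ K ∧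
    ∀ (μ : Measure Ω) [IsProbabilityMeasure μ] (T M S V G : Ω → ℝ) (ε : ℝ), 0 ≤ ε → ε ≤ 1 →
      (∀ ω, T ω = M ω - S ω + 2 * V ω + G ω) → MemLp M 2 μ → MemLp S 2 μ → MemLp V 2 μ →
      MemLp G 2 μ → variance M μ ≤ A * ε → ∫ ω, S ω ^ 2 ∂μ ≤ A * ε → |∫ ω, S ω ∂μ| ≤ A * ε →
      ∫ ω, V ω ^ 2 ∂μ ≤ A * ε → |∫ ω, V ω ∂μ| ≤ A * ε → ∫ ω, G ω ^ 2 ∂μ ≤ A * ε ^ 2 →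
      |∫ ω, T ω ∂μ - ∫ ω, M ω ∂μ| ≤ K * ε ∧ variance T μ ≤ K * ε := by
  refine ⟨1 + 38 * A, by positivity, fun μ _ T M S V G ε h0 h1 hT hM hS hV hG vM s2 s1 v2 v1 g2 => ?_⟩
  have iM := hM.integrable one_le_two
  have iS := hS.integrable one_le_two
  have iV := hV.integrable one_le_two
  have iG := hG.integrable one_le_two
  have hT2 : MemLp T 2 μ := by
    rw [show T = M - S + (2 : ℝ) • V + G from funext hT]
    exact ((hM.sub hS).add (hV.const_smul 2)).add hG
  have hεA : 0 ≤ A * ε := by positivity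
  constructor
  · have g1 : |∫ ω, G ω ∂μ| ≤ (1 + A) * ε := by
      refine abs_le_of_sq_le_sq ?_ (by positivity)
      have hv := variance_nonneg G μ
      rw [variance_eq_sub hG] at hv
      simp only [Pi.pow_apply] at hv
      nlinarith [sq_nonneg ε, mul_nonneg hA (sq_nonneg ε), mul_nonneg (sq_nonneg A) (sq_nonneg ε)]
    have e : ∫ ω, T ω ∂μ = ∫ ω, M ω ∂μ - ∫ ω, S ω ∂μ + 2 * ∫ ω, V ω ∂μ + ∫ ω, G ω ∂μ := by
      have e1 := integral_add ((iM.sub iS).add (iV.const_mul 2)) iG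
      have e2 := integral_add (iM.sub iS) (iV.const_mul 2)
      have e3 := integral_sub iM iS
      simp only [Pi.add_apply, Pi.sub_apply] at e1 e2 e3
      simp only [hT]
      rw [e1, e2, e3, integral_const_mul]
    rw [e]
    rw [abs_le] at *
    constructor <;> linarith [s1.1, s1.2, v1.1, v1.2, g1.1, g1.2]
  · have hc : variance T μ = variance (fun ω => T ω - ∫ ω, M ω ∂μ) μ :=
      (variance_sub_const hT2.aestronglyMeasurable _).symm
    have iM2 : Integrable (fun ω => (M ω - ∫ ω, M ω ∂μ) ^ 2) μ :=
      (hM.sub (memLp_const _)).integrable_sq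
    have iS2 := hS.integrable_sq
    have iV2 := hV.integrable_sq
    have iG2 := hG.integrable_sq
    rw [hc]
    refine (variance_le_expectation_sq
      (hT2.aestronglyMeasurable.sub aestronglyMeasurable_const)).trans ?_
    have hle : ∫ ω, (T ω - ∫ ω, M ω ∂μ) ^ 2 ∂μ ≤ ∫ ω, (2 * (M ω - ∫ ω, M ω ∂μ) ^ 2 +
        6 * S ω ^ 2 + 24 * V ω ^ 2 + 6 * G ω ^ 2) ∂μ := by
      refine integral_mono (hT2.sub (memLp_const _)).integrable_sq
        ((((iM2.const_mul 2).add (iS2.const_mul 6)).add (iV2.const_mul 24)).add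
          (iG2.const_mul 6)) fun ω => ?_
      simp only [hT]
      nlinarith [sq_nonneg (M ω - ∫ ω, M ω ∂μ - (-S ω + 2 * V ω + G ω)),
        sq_nonneg (S ω + 2 * V ω), sq_nonneg (S ω + G ω), sq_nonneg (2 * V ω - G ω)]
    have e1 := integral_add (((iM2.const_mul 2).add (iS2.const_mul 6)).add (iV2.const_mul 24))
      (iG2.const_mul 6)
    have e2 := integral_add ((iM2.const_mul 2).add (iS2.const_mul 6)) (iV2.const_mul 24)
    have e3 := integral_add (iM2.const_mul 2) (iS2.const_mul 6)
    simp only [Pi.add_apply] at e1 e2 e3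
    rw [e1, e2, e3, integral_const_mul, integral_const_mul, integral_const_mul,
      integral_const_mul, ← variance_eq_integral hM.aemeasurable] at hle
    have : A * ε ^ 2 ≤ A * ε := mul_le_mul_of_nonneg_left (by nlinarith) hA
    simp only [Pi.pow_apply, Pi.sub_apply]
    linarith

lemma measurable_acov {α : Type*} [Fintype α] {F G : α → Ω → ℝ} (hF : ∀ a, Measurable (F a))
    (hG : ∀ a, Measurable (G a)) : Measurable fun ω => acov (fun a => F a ω) fun a => G a ω :=
  (measurable_avg fun a => (hF a).mul (hG a)).sub ((measurable_avg hF).mul (measurable_avg hG))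

/-- The vector of bootstrap resample means of the block means of the coordinates of `Z`. -/
def resVec (Z : Fin d → ℤ → Ω → ℝ) (k N : ℕ) {b : ℕ} (ω : Ω) (f : Fin b → ↥(Finset.range N)) :
    Fin d → ℝ :=
  fun j => resMean (fun i : ↥(Finset.range N) => bmean (Z j) k i ω) f

omit [MeasurableSpace Ω] in
lemma map_resVec (lin : (Fin d → ℝ) →L[ℝ] ℝ) {Z : Fin d → ℤ → Ω → ℝ} {Y : ℤ → Ω → ℝ}
    (hY : ∀ i ω, Y i ω = lin fun j => Z j i ω) (k N : ℕ) {b : ℕ} (ω : Ω)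
    (f : Fin b → ↥(Finset.range N)) :
    lin (resVec Z k N ω f) = resMean (fun i : ↥(Finset.range N) => bmean Y k i ω) f := by
  have : resVec Z k N ω f = (b : ℝ)⁻¹ • ∑ a, (k : ℝ)⁻¹ • ∑ t ∈ Finset.range k,
      fun j => Z j (1 + ((f a : ℕ) : ℤ) + t) ω := by
    ext j
    simp [resVec, resMean, bmean, psum, div_eq_inv_mul]
  rw [this]
  simp [resMean, bmean, psum, div_eq_inv_mul, hY]

section Assembly

variable {μ : Measure Ω} [IsProbabilityMeasure μ] {X : ℤ → Ω → Fin d → ℝ} {s Ca D : ℝ} {P : ℕ}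

omit [IsProbabilityMeasure μ] in
lemma measurable_resVec (hmeas : ∀ i, Measurable (X i)) {Z : Fin d → ℤ → Ω → ℝ}
    (hZ : ∀ j, IsScore μ X s D (Z j)) (k N : ℕ) {b : ℕ} (f : Fin b → ↥(Finset.range N)) :
    Measurable fun ω => resVec Z k N ω f :=
  measurable_pi_iff.2 fun j => (Finset.measurable_fun_sum _ fun a _ =>
    (hZ j).measurable_bmean hmeas k (f a)).div_const _

lemma IsRegular.exists_integral_avgPow_le (hR : IsRegular μ X s Ca P) (hD : 0 ≤ D) {q : ℕ}
    (hq : 1 ≤ q) (hqP : 2 * q ≤ P) : ∃ C : ℝ, 0 ≤ C ∧ ∀ Z : Fin d → ℤ → Ω → ℝ,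
      (∀ j, IsScore μ X s D (Z j)) → ∀ n k N b, IsDesign n k N b →
      Integrable (fun ω => avgPow (resVec Z k N (b := b) ω) (2 * q)) μ ∧
      ∫ ω, avgPow (resVec Z k N (b := b) ω) (2 * q) ∂μ ≤ C * (1 / (n : ℝ)) ^ q := by
  obtain ⟨C, hC, h⟩ := hR.exists_resMean_moment hD hq hqP
  refine ⟨d * C, by positivity, fun Z hZ n k N b hd => ?_⟩
  have h' := fun j => h (Z j) (hZ j) n k N b hd
  refine ⟨integrable_finsetSum _ fun j _ => (h' j).1, ?_⟩
  simp only [avgPow]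
  refine (integral_finsetSum _ fun j _ => (h' j).1).trans_le ?_
  refine (Finset.sum_le_sum fun j _ => (h' j).2).trans_eq ?_
  simp [mul_assoc]

lemma IsRegular.exists_integral_quadratic_le (hR : IsRegular μ X s Ca P) (hD : 0 ≤ D)
    (hP : 8 ≤ P) (lin : (Fin d → ℝ) →L[ℝ] ℝ) (β : Fin d → Fin d → ℝ)
    {Z : Fin d → ℤ → Ω → ℝ} {Y : ℤ → Ω → ℝ} (hZ : ∀ j, IsScore μ X s D (Z j))
    (hYs : IsScore μ X s D Y) (hY : ∀ i ω, Y i ω = lin fun j => Z j i ω) :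
    ∃ K : ℝ, 0 ≤ K ∧ ∀ n k N b, IsDesign n k N b →
      |∫ ω, k * b * acov (fun f : Fin b → ↥(Finset.range N) => lin (resVec Z k N ω f))
        (fun f => ∑ j, ∑ l, β j l * (resVec Z k N ω f j * resVec Z k N ω f l)) ∂μ| ≤
        K * ((k : ℝ) / n) := by
  obtain ⟨K, hK, h⟩ := hR.exists_integral_acov_le hD hP
  refine ⟨(∑ j, ∑ l, |β j l|) * K, by positivity, fun n k N b hd => ?_⟩
  have h' := fun j l => h (Z j) Y (Z l) (hZ j) hYs (hZ l) n k N b hd _ fun ω => rfl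
  have e : ∀ ω, k * b * acov (fun f : Fin b → ↥(Finset.range N) => lin (resVec Z k N ω f))
      (fun f => ∑ j, ∑ l, β j l * (resVec Z k N ω f j * resVec Z k N ω f l)) =
      ∑ j, ∑ l, β j l * (k * b * acov
        (fun f : Fin b → ↥(Finset.range N) =>
          resMean (fun i : ↥(Finset.range N) => bmean Y k i ω) f)
        (fun f => resMean (fun i : ↥(Finset.range N) => bmean (Z j) k i ω) f *
          resMean (fun i : ↥(Finset.range N) => bmean (Z l) k i ω) f)) := fun ω => by
    simp only [map_resVec lin hY, acov_finsetSum_right, acov_const_mul_right, Finset.mul_sum]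
    refine Finset.sum_congr rfl fun j _ => Finset.sum_congr rfl fun l _ => ?_
    simp only [resVec]
    ring
  simp only [e]
  rw [integral_finsetSum _ fun j _ => integrable_finsetSum _ fun l _ =>
    ((h' j l).1).const_mul (β j l)]
  rw [Finset.sum_mul, Finset.sum_mul]
  refine (Finset.abs_sum_le_sum_abs _ _).trans (Finset.sum_le_sum fun j _ => ?_)
  rw [integral_finsetSum _ fun l _ => ((h' j l).1).const_mul (β j l)]
  rw [Finset.sum_mul, Finset.sum_mul]
  refine (Finset.abs_sum_le_sum_abs _ _).trans (Finset.sum_le_sum fun l _ => ?_)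
  rw [integral_const_mul, abs_mul, mul_assoc]
  exact mul_le_mul_of_nonneg_left (h' j l).2 (abs_nonneg _)

end Assembly

section Assembly

variable {μ : Measure Ω} [IsProbabilityMeasure μ] {X : ℤ → Ω → Fin d → ℝ} {s Ca D : ℝ} {P : ℕ}

omit [IsProbabilityMeasure μ] in
lemma memLp_two_of_sq_le {F G : Ω → ℝ} (hF : Measurable F) (hG : Integrable G μ)
    (h : ∀ ω, F ω ^ 2 ≤ G ω) : MemLp F 2 μ ∧ ∫ ω, F ω ^ 2 ∂μ ≤ ∫ ω, G ω ∂μ := by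
  have hi : Integrable (fun ω => F ω ^ 2) μ := hG.mono' (hF.pow_const 2).aestronglyMeasurable
    (ae_of_all _ fun ω => by rw [Real.norm_eq_abs, abs_of_nonneg (sq_nonneg _)]; exact h ω)
  exact ⟨(memLp_two_iff_integrable_sq hF.aestronglyMeasurable).2 hi, integral_mono hi hG h⟩

lemma IsRegular.exists_avg_bmean_sq_le (hR : IsRegular μ X s Ca P) (hD : 0 ≤ D) :
    ∃ K : ℝ, 0 ≤ K ∧ ∀ Y, IsScore μ X s D Y → ∀ n k N b, IsDesign n k N b →
      MemLp (fun ω => k * avg (fun i : ↥(Finset.range N) => bmean Y k i ω) ^ 2) 2 μ ∧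
      ∫ ω, (k * avg (fun i : ↥(Finset.range N) => bmean Y k i ω) ^ 2) ^ 2 ∂μ ≤
        K * ((k : ℝ) / n) ∧
      |∫ ω, k * avg (fun i : ↥(Finset.range N) => bmean Y k i ω) ^ 2 ∂μ| ≤ K * ((k : ℝ) / n) := by
  have hP := hR.four_le
  obtain ⟨C₁, hC₁, hm₁⟩ := hR.exists_moments hD (q := 1) le_rfl (by omega)
  obtain ⟨C₂, hC₂, hm₂⟩ := hR.exists_moments hD (q := 2) (by norm_num) (by omega)
  refine ⟨2 * C₁ + 4 * C₂, by positivity, fun Y hY n k N b hd => ?_⟩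
  have hk := hd.k_pos
  have hn := hd.n_pos
  have hN := hd.N_pos
  obtain ⟨i1, b1⟩ := hR.integral_avg_bmean_pow_le hY (hm₁ Y hY) (by omega) hd.one_le_k hd.one_le_N
  obtain ⟨i2, b2⟩ := hR.integral_avg_bmean_pow_le hY (hm₂ Y hY) (by omega) hd.one_le_k hd.one_le_N
  have hm : Measurable fun ω => avg (fun i : ↥(Finset.range N) => bmean Y k i ω) :=
    measurable_avg fun i : ↥(Finset.range N) => hY.measurable_bmean hR.meas k i
  have hε : (k : ℝ) / n ≤ 1 := by
    rw [div_le_one hn]; exact_mod_cast hd.k_le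
  have hε0 : 0 ≤ (k : ℝ) / n := by positivity
  have hkN := hd.div_N_le
  have hkN0 : 0 ≤ (k : ℝ) / N := by positivity
  obtain ⟨hS, bS⟩ := memLp_two_of_sq_le ((hm.pow_const 2).const_mul (k : ℝ))
    (i2.const_mul ((k : ℝ) ^ 2)) fun ω => by ring_nf; rfl
  refine ⟨hS, bS.trans ?_, ?_⟩
  · rw [integral_const_mul]
    calc _ ≤ (k : ℝ) ^ 2 * (C₂ * (1 / (N : ℝ)) ^ 2) := by gcongr
      _ = C₂ * ((k : ℝ) / N) ^ 2 := by ring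
      _ ≤ C₂ * (2 * ((k : ℝ) / n)) ^ 2 := by gcongr
      _ = 4 * C₂ * ((k : ℝ) / n * ((k : ℝ) / n)) := by ring
      _ ≤ 4 * C₂ * (1 * ((k : ℝ) / n)) := by gcongr
      _ ≤ _ := by nlinarith
  · rw [abs_of_nonneg (integral_nonneg fun ω => by positivity), integral_const_mul]
    calc _ ≤ (k : ℝ) * (C₁ * (1 / (N : ℝ)) ^ 1) := by gcongr
      _ = C₁ * ((k : ℝ) / N) := by ring
      _ ≤ C₁ * (2 * ((k : ℝ) / n)) := by gcongr
      _ ≤ _ := by nlinarith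

set_option maxHeartbeats 1000000 in
/-- Mean and variance of the block bootstrap variance estimator of a smooth function of means. -/
theorem IsRegular.exists_bootstrap_le (hR : IsRegular μ X s Ca P) (hD : 0 ≤ D) {a₀ : ℕ}
    (hP : 12 + 4 * a₀ ≤ P) {H : (Fin d → ℝ) → ℝ} (hHm : Measurable H) {x : Fin d → ℝ}
    (lin : (Fin d → ℝ) →L[ℝ] ℝ) {β : Fin d → Fin d → ℝ} {C : ℝ}
    (hH : ∀ w, |H (x + w) - H x - lin w - ∑ j, ∑ l, β j l * (w j * w l)| ≤
      C * (‖w‖ ^ 3 + ‖w‖ ^ (3 + a₀)))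
    {Z : Fin d → ℤ → Ω → ℝ} {Y : ℤ → Ω → ℝ} (hZ : ∀ j, IsScore μ X s D (Z j))
    (hYs : IsScore μ X s D Y) (hY : ∀ i ω, Y i ω = lin fun j => Z j i ω) :
    ∃ K : ℝ, 0 ≤ K ∧ ∀ n k N b, IsDesign n k N b → ∀ T : Ω → ℝ,
      (∀ ω, T ω = k * b * acov (fun f : Fin b → ↥(Finset.range N) => H (x + resVec Z k N ω f))
        (fun f => H (x + resVec Z k N ω f))) →
      |∫ ω, T ω ∂μ - ∫ ω, k * avg (fun i : ↥(Finset.range N) => bmean Y k i ω ^ 2) ∂μ| ≤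
        K * ((k : ℝ) / n) ∧ variance T μ ≤ K * ((k : ℝ) / n) := by
  obtain ⟨A, hA, hexp⟩ := exists_acov_expansion_le lin hH
  obtain ⟨K₁, hK₁, hM⟩ := hR.exists_variance_avg_sq_le hD (by omega)
  obtain ⟨K₂, hK₂, hS⟩ := hR.exists_avg_bmean_sq_le hD
  obtain ⟨K₃, hK₃, hV⟩ := hR.exists_integral_quadratic_le hD (by omega) lin β hZ hYs hY
  obtain ⟨c₄, hc₄, h₄⟩ := hR.exists_integral_avgPow_le hD (q := 2) (by norm_num) (by omega)
  obtain ⟨c₈, hc₈, h₈⟩ := hR.exists_integral_avgPow_le hD (q := 4) (by norm_num) (by omega)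
  obtain ⟨c₁₂, hc₁₂, h₁₂⟩ := hR.exists_integral_avgPow_le hD (q := 6) (by norm_num) (by omega)
  obtain ⟨cₐ, hcₐ, hₐ⟩ := hR.exists_integral_avgPow_le hD (q := 2 * (3 + a₀)) (by omega) (by omega)
  set A' := K₁ + K₂ + K₃ + A * (c₄ + c₈ + c₁₂ + cₐ) with hA'
  have hA'0 : 0 ≤ A' := by positivity
  have hA4 : 0 ≤ A * c₄ := by positivity
  have hA8 : 0 ≤ A * c₈ := by positivity
  have hA12 : 0 ≤ A * c₁₂ := by positivity
  have hAa : 0 ≤ A * cₐ := by positivity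
  obtain ⟨K, hK, hfin⟩ := exists_mean_variance_le (Ω := Ω) hA'0
  refine ⟨K, hK, fun n k N b hd T hT => ?_⟩
  have : Nonempty ↥(Finset.range N) := ⟨⟨0, Finset.mem_range.2 hd.one_le_N⟩⟩
  have hk := hd.k_pos
  have hn := hd.n_pos
  have hb := hd.b_pos
  have hn1 : (1 : ℝ) ≤ n := by exact_mod_cast hd.one_le_n
  have hε : (k : ℝ) / n ≤ 1 := by
    rw [div_le_one hn]; exact_mod_cast hd.k_le
  have hε0 : 0 ≤ (k : ℝ) / n := by positivity
  have hη := hd.one_div_n_le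
  have hη0 : 0 ≤ 1 / (n : ℝ) := by positivity
  have hη2 : (1 / (n : ℝ)) ^ 2 ≤ ((k : ℝ) / n) ^ 2 := by gcongr
  obtain ⟨i4, b4⟩ := h₄ Z hZ n k N b hd
  obtain ⟨i8, b8⟩ := h₈ Z hZ n k N b hd
  obtain ⟨i12, b12⟩ := h₁₂ Z hZ n k N b hd
  obtain ⟨ia, ba⟩ := hₐ Z hZ n k N b hd
  rw [show 2 * (2 * (3 + a₀)) = 4 * (3 + a₀) by ring] at ia ba
  have hmL : ∀ f : Fin b → ↥(Finset.range N), Measurable fun ω => lin (resVec Z k N ω f) :=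
    fun f => lin.measurable.comp (measurable_resVec hR.meas hZ k N f)
  have hmQ : ∀ f : Fin b → ↥(Finset.range N), Measurable fun ω =>
      ∑ j, ∑ l, β j l * (resVec Z k N ω f j * resVec Z k N ω f l) := fun f => by
    have := measurable_pi_iff.1 (measurable_resVec hR.meas hZ k N f)
    exact Finset.measurable_fun_sum _ fun j _ => Finset.measurable_fun_sum _ fun l _ =>
      ((this j).mul (this l)).const_mul _
  have hmH : ∀ f : Fin b → ↥(Finset.range N), Measurable fun ω => H (x + resVec Z k N ω f) :=
    fun f => hHm.comp ((measurable_resVec hR.meas hZ k N f).const_add x)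
  have hmV := (measurable_acov hmL hmQ).const_mul ((k : ℝ) * b)
  have hmG := ((((measurable_acov hmH hmH).sub (measurable_acov hmL hmL))).sub
    ((measurable_acov hmL hmQ).const_mul 2)).const_mul ((k : ℝ) * b)
  have hex := fun ω => hexp _ (resVec Z k N (b := b) ω) ((k : ℝ) * b) n (by positivity)
    (by exact_mod_cast hd.mul_le) hn1
  obtain ⟨mG, gG⟩ := memLp_two_of_sq_le hmG (((i4.add (i8.const_mul ((n : ℝ) ^ 2))).add
    ((i12.add ia).const_mul ((n : ℝ) ^ 4))).const_mul A) fun ω => (hex ω).1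
  obtain ⟨mV, gV⟩ := memLp_two_of_sq_le hmV (((i4.const_mul (n : ℝ)).add
    (i8.const_mul ((n : ℝ) ^ 3))).const_mul A) fun ω => (hex ω).2
  obtain ⟨mM, vM⟩ := hM Y hYs n k N b hd
  obtain ⟨mS, vS, eS⟩ := hS Y hYs n k N b hd
  refine hfin μ T _ _ _ _ _ hε0 hε (fun ω => ?_) mM mS mV mG ?_ ?_ ?_ ?_ ?_ ?_
  · rw [hT ω]
    have e : acov (fun f : Fin b → ↥(Finset.range N) => lin (resVec Z k N ω f))
        (fun f => lin (resVec Z k N ω f)) =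
        (avg (fun i : ↥(Finset.range N) => bmean Y k i ω ^ 2) -
          avg (fun i : ↥(Finset.range N) => bmean Y k i ω) ^ 2) / b := by
      simp only [map_resVec lin hY]
      rw [acov_resMean _ _ hd.one_le_b]
      simp only [acov, sq]
    simp only [Pi.sub_apply]
    rw [e]
    field_simp
    ring
  · exact vM.trans (mul_le_mul_of_nonneg_right (by linarith) hε0)
  · exact vS.trans (mul_le_mul_of_nonneg_right (by linarith) hε0)
  · exact eS.trans (mul_le_mul_of_nonneg_right (by linarith) hε0)
  · refine gV.trans ?_
    have e1 := integral_add (i4.const_mul (n : ℝ)) (i8.const_mul ((n : ℝ) ^ 3))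
    simp only [Pi.add_apply] at e1 ⊢
    rw [integral_const_mul, e1, integral_const_mul, integral_const_mul]
    calc _ ≤ A * ((n : ℝ) * (c₄ * (1 / (n : ℝ)) ^ 2) + (n : ℝ) ^ 3 * (c₈ * (1 / (n : ℝ)) ^ 4)) := by
          gcongr
      _ = (A * c₄ + A * c₈) * (1 / (n : ℝ)) := by field_simp
      _ ≤ (A * c₄ + A * c₈) * ((k : ℝ) / n) := by gcongr
      _ ≤ _ := mul_le_mul_of_nonneg_right (by linarith) hε0
  · exact (hV n k N b hd).trans (mul_le_mul_of_nonneg_right (by linarith) hε0)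
  · refine gG.trans ?_
    have e1 := integral_add (i4.add (i8.const_mul ((n : ℝ) ^ 2)))
      ((i12.add ia).const_mul ((n : ℝ) ^ 4))
    have e2 := integral_add i4 (i8.const_mul ((n : ℝ) ^ 2))
    have e3 := integral_add i12 ia
    simp only [Pi.add_apply] at e1 e2 e3 ⊢
    rw [integral_const_mul, e1, e2, integral_const_mul, integral_const_mul, e3]
    have hpow : (1 / (n : ℝ)) ^ (2 * (3 + a₀)) ≤ (1 / (n : ℝ)) ^ 6 :=
      pow_le_pow_of_le_one hη0 (by rw [div_le_one hn]; exact hn1) (by omega)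
    calc _ ≤ A * (c₄ * (1 / (n : ℝ)) ^ 2 + (n : ℝ) ^ 2 * (c₈ * (1 / (n : ℝ)) ^ 4) +
          (n : ℝ) ^ 4 * (c₁₂ * (1 / (n : ℝ)) ^ 6 + cₐ * (1 / (n : ℝ)) ^ 6)) := by
          gcongr
          exact ba.trans (mul_le_mul_of_nonneg_left hpow hcₐ)
      _ = A * (c₄ + c₈ + c₁₂ + cₐ) * (1 / (n : ℝ)) ^ 2 := by field_simp; ring
      _ ≤ A * (c₄ + c₈ + c₁₂ + cₐ) * ((k : ℝ) / n) ^ 2 := by gcongr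
      _ ≤ _ := mul_le_mul_of_nonneg_right (by linarith) (sq_nonneg _)

end Assembly

section Stationary

variable {μ : Measure Ω} [IsProbabilityMeasure μ] {X : ℤ → Ω → Fin d → ℝ}

omit [IsProbabilityMeasure μ] in
lemma IsStationary.identDistrib (hmeas : ∀ i, Measurable (X i)) (hstat : IsStationary μ X)
    (i j : ℤ) : IdentDistrib (fun ω t => X (t + i) ω) (fun ω t => X (t + j) ω) μ μ :=
  ⟨(measurable_pi_lambda _ fun _ => hmeas _).aemeasurable,
    (measurable_pi_lambda _ fun _ => hmeas _).aemeasurable, (hstat i).trans (hstat j).symm⟩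

omit [IsProbabilityMeasure μ] in
lemma IsStationary.identDistrib_coord (hmeas : ∀ i, Measurable (X i)) (hstat : IsStationary μ X)
    (i : ℤ) : IdentDistrib (X i) (X 1) μ μ := by
  have := (hstat.identDistrib hmeas (i - 1) 0).comp (measurable_pi_apply (1 : ℤ))
  simpa [Function.comp_def] using this

lemma IsStationary.exists_isScore (hmeas : ∀ i, Measurable (X i)) (hstat : IsStationary μ X)
    {s : ℝ} (hs : 1 ≤ s) (hint : Integrable (fun ω => ‖X 1 ω‖ ^ s) μ)
    (lin : (Fin d → ℝ) →L[ℝ] ℝ) : ∃ D : ℝ, 0 ≤ D ∧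
      IsScore μ X s D fun i ω => lin fun j => X i ω j - meanVec μ X j := by
  have hs0 : 0 < s := by linarith
  set g : (Fin d → ℝ) → ℝ := fun v => lin (v - meanVec μ X) with hg
  have hgm : Measurable g := lin.measurable.comp (measurable_id.sub_const _)
  have hid : ∀ i, IdentDistrib (fun ω => g (X i ω)) (fun ω => g (X 1 ω)) μ μ := fun i =>
    (hstat.identDistrib_coord hmeas i).comp hgm
  have hX : MemLp (X 1) (ENNReal.ofReal s) μ := by
    rw [← integrable_norm_rpow_iff (hmeas 1).aestronglyMeasurable (by simpa using hs0)
      ENNReal.ofReal_ne_top, ENNReal.toReal_ofReal hs0.le]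
    exact hint
  have hXi : Integrable (X 1) μ := hX.integrable (by simpa using hs)
  have hgL : MemLp (fun ω => g (X 1 ω)) (ENNReal.ofReal s) μ :=
    lin.comp_memLp' (hX.sub (memLp_const (meanVec μ X)))
  have hgi : Integrable (fun ω => |g (X 1 ω)| ^ s) μ := by
    have := hgL.integrable_norm_rpow (by simpa using hs0) ENNReal.ofReal_ne_top
    rwa [ENNReal.toReal_ofReal hs0.le] at this
  have hpow : Measurable fun r : ℝ => |r| ^ s := by fun_prop
  refine ⟨∫ ω, |g (X 1 ω)| ^ s ∂μ, integral_nonneg fun ω => by positivity,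
    fun i => hgm.comp (measurable_sigmaOf X rfl), fun i => ?_, fun i => ?_, fun i => ?_⟩
  · refine (hid i).integral_eq.trans ?_
    have hsub : Integrable (fun ω => X 1 ω - meanVec μ X) μ := hXi.sub (integrable_const _)
    change ∫ ω, lin (X 1 ω - meanVec μ X) ∂μ = 0
    rw [lin.integral_comp_comm hsub, integral_sub hXi (integrable_const _)]
    have : ∫ ω, X 1 ω ∂μ = meanVec μ X := by
      ext j
      exact eval_integral (fun j => hXi.eval j) j
    rw [this]
    simp
  · exact ((hid i).comp hpow).integrable_iff.2 hgi
  · exact ((hid i).comp hpow).integral_eq.le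

omit [IsProbabilityMeasure μ] in
lemma IsScore.mono {s D D' : ℝ} {Z : ℤ → Ω → ℝ} (hZ : IsScore μ X s D Z) (h : D ≤ D') :
    IsScore μ X s D' Z :=
  ⟨hZ.meas, hZ.mean, hZ.int, fun i => (hZ.bound i).trans h⟩

omit [IsProbabilityMeasure μ] in
lemma IsStationary.integral_bmean_sq (hmeas : ∀ i, Measurable (X i)) (hstat : IsStationary μ X)
    {g : (Fin d → ℝ) → ℝ} (hg : Measurable g) (k i : ℕ) :
    ∫ ω, bmean (fun t ω => g (X t ω)) k i ω ^ 2 ∂μ =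
      ∫ ω, bmean (fun t ω => g (X t ω)) k 0 ω ^ 2 ∂μ := by
  have hΦ : Measurable fun p : ℤ → Fin d → ℝ => ((∑ t ∈ Finset.range k, g (p (1 + t))) / k) ^ 2 :=
    ((Finset.measurable_fun_sum _ fun t _ => hg.comp (measurable_pi_apply _)).div_const _).pow_const 2
  have := ((hstat.identDistrib hmeas i 0).comp hΦ).integral_eq
  simp only [Function.comp_def] at this
  simpa only [bmean, psum, Nat.cast_zero, add_zero, add_right_comm (1 : ℤ) (i : ℤ)] using this

lemma alphaMix_nonneg (μ : Measure Ω) (X : ℤ → Ω → Fin d → ℝ) (k : ℕ) : 0 ≤ alphaMix μ X k :=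
  Real.sSup_nonneg (by rintro x ⟨A, B, -, -, rfl⟩; exact abs_nonneg _)

lemma le_rpow_of_rpow_div_le {α B δ s c g : ℝ} {m : ℕ} (hα : 0 ≤ α) (hδ : 0 < δ)
    (hs : 0 < s) (hg : 1 ≤ g) (h : g ^ m * α ^ (δ / s) ≤ B) (hc : c ≤ m * (s / δ)) :
    α ≤ B ^ (s / δ) * g ^ (-c) := by
  have hg0 : 0 < g := by linarith
  have h1 : (g ^ m * α ^ (δ / s)) ^ (s / δ) ≤ B ^ (s / δ) :=
    Real.rpow_le_rpow (by positivity) h (by positivity)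
  rw [Real.mul_rpow (by positivity) (by positivity), ← Real.rpow_natCast, ← Real.rpow_mul hg0.le,
    ← Real.rpow_mul hα, show δ / s * (s / δ) = 1 by field_simp, Real.rpow_one] at h1
  have h2 : g ^ c ≤ g ^ ((m : ℝ) * (s / δ)) := Real.rpow_le_rpow_of_exponent_le hg hc
  have h3 : g ^ c * α ≤ B ^ (s / δ) := (mul_le_mul_of_nonneg_right h2 hα).trans h1
  rw [Real.rpow_neg hg0.le, ← div_eq_mul_inv, le_div_iff₀ (by positivity), mul_comm]
  exact h3

lemma CondM.exists_isRegular (hmeas : ∀ i, Measurable (X i)) (hstat : IsStationary μ X) {r : ℕ}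
    (hr : 3 ≤ r) (hM : CondM μ X r) : ∃ s Ca : ℝ, 1 ≤ s ∧
      Integrable (fun ω => ‖X 1 ω‖ ^ s) μ ∧ IsRegular μ X s Ca (2 * r - 2) := by
  obtain ⟨δ, hδ, hint, hsum⟩ := hM
  have hr' : (3 : ℝ) ≤ r := by exact_mod_cast hr
  set s : ℝ := 2 * r + δ with hs
  have hs0 : 0 < s := by positivity
  have hnn : ∀ k : ℕ, 0 ≤ (k : ℝ) ^ (2 * r - 1) * alphaMix μ X k ^ (δ / s) := fun k =>
    mul_nonneg (by positivity) (Real.rpow_nonneg (alphaMix_nonneg μ X k) _)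
  set B := ∑' k : ℕ, (k : ℝ) ^ (2 * r - 1) * alphaMix μ X k ^ (δ / s)
  have hB0 : 0 ≤ B := tsum_nonneg hnn
  have hP : ((2 * r - 2 : ℕ) : ℝ) = 2 * r - 2 := by
    rw [Nat.cast_sub (by omega)]; push_cast; ring
  have hm : ((2 * r - 1 : ℕ) : ℝ) = 2 * r - 1 := by
    rw [Nat.cast_sub (by omega)]; push_cast; ring
  refine ⟨s, B ^ (s / δ), by linarith, hint, hmeas, by positivity, by omega, by rw [hP]; linarith,
    alphaMix μ X, fun t h A C hA hC => mixing_shift hmeas hstat t h hA hC, fun g hg => ?_⟩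
  refine le_rpow_of_rpow_div_le (alphaMix_nonneg μ X g) hδ hs0 (by exact_mod_cast hg)
    (hsum.le_tsum g fun k _ => hnn k) ?_
  rw [hP, hm, mul_div_assoc, show s - (2 * r - 2) = δ + 2 by rw [hs]; ring]
  have h1 : s / (δ + 2) ≤ s / δ := by gcongr; linarith
  have : 0 ≤ s / δ := by positivity
  exact mul_le_mul (by linarith) h1 (by positivity) (by linarith)

end Stationary

omit [MeasurableSpace Ω] in
lemma sigmaHat_eq (X : ℤ → Ω → Fin d → ℝ) (H : (Fin d → ℝ) → ℝ) (m : Fin d → ℝ) {n k N b : ℕ}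
    (hk : 0 < k) (hb : 0 < b) (hN : n - k + 1 = N) (hnb : n / k = b) (ω : Ω) :
    sigmaHat X H n k ω = k * b * acov
      (fun f : Fin b → ↥(Finset.range N) => H (m + resVec (fun j i ω => X i ω j - m j) k N ω f))
      (fun f => H (m + resVec (fun j i ω => X i ω j - m j) k N ω f)) := by
  have hk' : (k : ℝ) ≠ 0 := by positivity
  have hb' : (b : ℝ) ≠ 0 := by positivity
  subst hN hnb
  have e : ∀ f : Fin (n / k) → ↥(Finset.range (n - k + 1)),
      m + resVec (fun j i ω => X i ω j - m j) k (n - k + 1) ω f =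
      fun j => (∑ a, (∑ t ∈ Finset.range k, X (1 + ((f a : ℕ) : ℤ) + t) ω j) / k) /
        ((n / k : ℕ) : ℝ) := fun f => by
    ext j
    simp only [Pi.add_apply, resVec, resMean, bmean, psum, Finset.sum_sub_distrib,
      Finset.sum_const, Finset.card_range, nsmul_eq_mul, sub_div]
    rw [mul_div_cancel_left₀ _ hk', Finset.card_univ, Fintype.card_fin, mul_div_cancel_left₀ _ hb']
    ring
  simp only [e, sigmaHat, mbbVar, mbbVarOn, acov, avg, Fintype.card_fun, Fintype.card_coe,
    Fintype.card_fin, Nat.cast_pow, sq]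

section Main

variable {μ : Measure Ω} [IsProbabilityMeasure μ] {X : ℤ → Ω → Fin d → ℝ}

/-- Bias and variance of the block bootstrap variance estimator, uniformly in the block length. -/
theorem exists_sigmaHat_le (hmeas : ∀ i, Measurable (X i)) (hstat : IsStationary μ X) {a₀ : ℕ}
    {H : (Fin d → ℝ) → ℝ} (hD : CondD H a₀) (hM : CondM μ X (7 + 2 * a₀)) :
    ∃ K : ℝ, 0 ≤ K ∧ ∀ n k : ℕ, 1 ≤ k → 2 * k ≤ n →
      |∫ ω, sigmaHat X H n k ω ∂μ - k * ∫ ω, Ybar μ X H k ω ^ 2 ∂μ| ≤ K * ((k : ℝ) / n) ∧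
      variance (sigmaHat X H n k) μ ≤ K * ((k : ℝ) / n) := by
  obtain ⟨s, Ca, hs, hint, hR⟩ := hM.exists_isRegular hmeas hstat (by omega)
  obtain ⟨β, C, -, hH⟩ := hD.exists_taylor (meanVec μ X)
  obtain ⟨D₀, hD₀, hY⟩ := hstat.exists_isScore hmeas hs hint (fderiv ℝ H (meanVec μ X))
  choose D' hD' hZ using fun j : Fin d => hstat.exists_isScore hmeas hs hint
    (ContinuousLinearMap.proj (R := ℝ) (φ := fun _ : Fin d => ℝ) j)
  have hsum : 0 ≤ ∑ j, D' j := Finset.sum_nonneg fun j _ => hD' j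
  obtain ⟨K, hK, h⟩ := hR.exists_bootstrap_le (D := D₀ + ∑ j, D' j) (by positivity)
    (a₀ := a₀) (by omega) hD.1.continuous.measurable (fderiv ℝ H (meanVec μ X)) hH
    (Z := fun j i ω => X i ω j - meanVec μ X j) (Y := Ylin μ X H)
    (fun j => (hZ j).mono (by
      have := Finset.single_le_sum (fun j _ => hD' j) (Finset.mem_univ j)
      linarith))
    (hY.mono (by linarith)) fun i ω => rfl
  refine ⟨K, hK, fun n k hk hkn => ?_⟩
  have hd := isDesign hk hkn
  have hb := hd.one_le_b
  have hk0 := hd.k_pos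
  obtain ⟨h1, h2⟩ := h n k _ _ hd _ fun ω =>
    sigmaHat_eq X H (meanVec μ X) hk hb rfl rfl ω
  refine ⟨?_, h2⟩
  have : Nonempty ↥(Finset.range (n - k + 1)) := ⟨⟨0, Finset.mem_range.2 hd.one_le_N⟩⟩
  have e : ∫ ω, k * avg (fun i : ↥(Finset.range (n - k + 1)) =>
      bmean (Ylin μ X H) k i ω ^ 2) ∂μ = k * ∫ ω, Ybar μ X H k ω ^ 2 ∂μ := by
    have hg : Measurable fun v : Fin d → ℝ =>
        fderiv ℝ H (meanVec μ X) fun j => v j - meanVec μ X j :=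
      (fderiv ℝ H (meanVec μ X)).measurable.comp
        (measurable_id.sub_const (meanVec μ X))
    have hst : ∀ i : ℕ, ∫ ω, bmean (Ylin μ X H) k i ω ^ 2 ∂μ =
        ∫ ω, Ybar μ X H k ω ^ 2 ∂μ := fun i => by
      refine (hstat.integral_bmean_sq hmeas hg k i).trans ?_
      simp only [bmean, psum, Ybar, Ylin, Nat.cast_zero, add_zero]
      simp only [add_comm (1 : ℤ)]
    have hY' : IsScore μ X s D₀ (Ylin μ X H) := hY
    have hi : ∀ i : ↥(Finset.range (n - k + 1)),
        Integrable (fun ω => bmean (Ylin μ X H) k i ω ^ 2) μ := fun i =>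
      hR.integrable_bmean_pow hY' k i (by omega)
    rw [integral_const_mul, integral_avg hi]
    simp only [hst, avg_const]
  rw [← e]
  exact h1

end Main

lemma eventually_four_mul_le {ℓ : ℕ → ℕ}
    (h : Tendsto (fun n : ℕ => (ℓ n : ℝ) * (n : ℝ) ^ (-(1 : ℝ) / 3)) atTop (nhds 0)) :
    ∀ᶠ n : ℕ in atTop, 4 * ℓ n ≤ n := by
  filter_upwards [h.eventually_lt_const (by norm_num : (0 : ℝ) < 1 / 4), eventually_ge_atTop 1]
    with n hn hn1
  have hn1' : (1 : ℝ) ≤ n := by exact_mod_cast hn1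
  have hn0 : (0 : ℝ) < n := by linarith
  rw [neg_div, Real.rpow_neg hn0.le, ← div_eq_mul_inv, div_lt_iff₀ (by positivity)] at hn
  have : (n : ℝ) ^ ((1 : ℝ) / 3) ≤ n := by
    simpa using Real.rpow_le_rpow_of_exponent_le hn1' (by norm_num : (1 : ℝ) / 3 ≤ 1)
  have h4 : (4 : ℝ) * ℓ n ≤ n := by linarith
  exact_mod_cast h4

omit [MeasurableSpace Ω] in
lemma sigmaHat_zero (X : ℤ → Ω → Fin d → ℝ) (H : (Fin d → ℝ) → ℝ) (n : ℕ) :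
    sigmaHat X H n 0 = fun _ => 0 := by
  ext ω
  simp [sigmaHat, mbbVar, mbbVarOn]

theorem statement_17 {Ω : Type*} [MeasurableSpace Ω] {d a₀ : ℕ}
    (μ : Measure Ω) [IsProbabilityMeasure μ]
    (X : ℤ → Ω → Fin d → ℝ) (H : (Fin d → ℝ) → ℝ)
    (hmeas : ∀ i, Measurable (X i))
    (hstat : IsStationary μ X)
    (hD : CondD H a₀)
    (hM : CondM μ X (7 + 2 * a₀))
    (hS : CondS μ X H)
    (hσ : SigLimit μ X H)
    (K : ℝ) (hK : 0 < K ∧ K⁻¹ < C0 μ X H ∧ C0 μ X H < K)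
    (ℓ₂ : ℕ → ℕ)
    (htune : Tendsto (fun n : ℕ => (ℓ₂ n : ℝ) * (n : ℝ) ^ (-(1 : ℝ) / 3)) atTop (nhds 0))
 :
    ∃ C : ℝ, 0 < C ∧ ∀ᶠ n : ℕ in atTop, ∀ k ∈ ({ℓ₂ n, 2 * ℓ₂ n} : Finset ℕ),
      |(∫ ω, sigmaHat X H n k ω ∂μ) - (k : ℝ) * ∫ ω, (Ybar μ X H k ω) ^ 2 ∂μ|
          ≤ C * ((k : ℝ) / (n : ℝ)) ∧
      variance (sigmaHat X H n k) μ ≤ C * ((k : ℝ) / (n : ℝ)) := by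
  obtain ⟨C, hC, h⟩ := exists_sigmaHat_le hmeas hstat hD hM
  refine ⟨C + 1, by positivity, ?_⟩
  filter_upwards [eventually_four_mul_le htune] with n hn k hk
  have hkn : 2 * k ≤ n := by
    rcases Finset.mem_insert.1 hk with rfl | hk
    · omega
    · rw [Finset.mem_singleton.1 hk]; omega
  rcases Nat.eq_zero_or_pos k with rfl | hk0
  · simp [sigmaHat_zero, variance_eq_integral aemeasurable_const]
  · have hle : C * ((k : ℝ) / n) ≤ (C + 1) * ((k : ℝ) / n) := by gcongr; linarith
    exact ⟨(h n k hk0 hkn).1.trans hle, (h n k hk0 hkn).2.trans hle⟩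

end BlockLength
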